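/- Let k₀ ∈ (0,1), let β be a fragment daughter distribution satisfying the mass-transfer form, local mass conservation, and the non-integrability bounds, and let Φ be the collision kernel with exponents k₀ ≤ λ₁ ≤ λ₂ ≤ 1. Let u^in ∈ X_{k₀} ∩ X_{k₀+1} be nonnegative and T ∈ (0,∞]. If u₁ and u₂ are two weak solutions to the collision-induced fragmentation equation on [0,T) with the same initial condition u^in, each satisfying that t ↦ M_{1+k₀+λ₂}(u_i(t)) belongs to L¹(0,t) for every t ∈ (0,T) (i = 1,2), then u₁(t,·) = u₂(t,·) almost everywhere on (0,∞) for every t ∈ [0,T). -/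

import Mathlib

open MeasureTheory Set Filter
open scoped ENNReal

noncomputable section

/-- The `k`-th moment `M_k(g) = ∫₀^∞ x^k g(x) dx`. -/
def Mk (k : ℝ) (g : ℝ → ℝ) : ℝ := ∫ x in Ioi (0:ℝ), x ^ k * g x

/-- Membership in the weighted space `X_k`. -/
def MemXk (k : ℝ) (g : ℝ → ℝ) : Prop :=
  MeasureTheory.IntegrableOn (fun x => x ^ k * g x) (Ioi (0:ℝ))

/-- The fragment daughter distribution built from `β_*` via the mass-transfer form
`β(x₃,x₁,x₂) = β_*(x₃,x₁,x₂)·1_{(0,x₁)}(x₃) + β_*(x₃,x₂,x₁)·1_{(0,x₂)}(x₃)`. -/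
def betaOf (bs : ℝ → ℝ → ℝ → ℝ) (x₃ x₁ x₂ : ℝ) : ℝ :=
  (if x₃ ∈ Ioo (0:ℝ) x₁ then bs x₃ x₁ x₂ else 0) +
  (if x₃ ∈ Ioo (0:ℝ) x₂ then bs x₃ x₂ x₁ else 0)

/-- The power-law `β_*(x₃,x₁,x₂) = (ν+2) x₃^ν x₁^{-ν-1} 1_{(0,x₁)}(x₃)`. -/
def betaPow (ν : ℝ) (x₃ x₁ x₂ : ℝ) : ℝ :=
  if x₃ ∈ Ioo (0:ℝ) x₁ then (ν + 2) * x₃ ^ ν * x₁ ^ (-ν - 1) else 0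

/-- The collision kernel `Φ(x₁,x₂) = x₁^{λ₁} x₂^{λ₂} + x₂^{λ₁} x₁^{λ₂}`. -/
def Phi (l₁ l₂ : ℝ) (x₁ x₂ : ℝ) : ℝ := x₁ ^ l₁ * x₂ ^ l₂ + x₂ ^ l₁ * x₁ ^ l₂

/-- `Υ_ς(x₁,x₂) = ∫₀^{x₁+x₂} ς(x₃) β(x₃,x₁,x₂) dx₃ - ς(x₁) - ς(x₂)`, where `β = betaOf bs`. -/
def Upsilon (bs : ℝ → ℝ → ℝ → ℝ) (ς : ℝ → ℝ) (x₁ x₂ : ℝ) : ℝ :=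
  (∫ x₃ in Ioo (0:ℝ) (x₁ + x₂), ς x₃ * betaOf bs x₃ x₁ x₂) - ς x₁ - ς x₂

/-- Assumptions on `β_*`: measurability, nonnegativity, local mass conservation, and the
non-integrability bounds `∫₀^{x₁} x₃^{k₀} β_*(x₃,x₁,x₂)^p dx₃ ≤ E_{k₀,p} x₁^{k₀+1-p}`
for `p ∈ [1,p₀]`, some `p₀ ∈ (1,1+k₀)`. -/
structure FragKernel (k₀ : ℝ) (bs : ℝ → ℝ → ℝ → ℝ) : Prop where
  meas : Measurable fun q : ℝ × ℝ × ℝ => bs q.1 q.2.1 q.2.2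
  nonneg : ∀ x₃ x₁ x₂ : ℝ, 0 ≤ bs x₃ x₁ x₂
  mass : ∀ x₁ ∈ Ioi (0:ℝ), ∀ x₂ ∈ Ioi (0:ℝ),
    ∫ x₃ in Ioo (0:ℝ) x₁, x₃ * bs x₃ x₁ x₂ = x₁
  bound : ∃ p₀ ∈ Ioo (1:ℝ) (1 + k₀), ∀ p ∈ Icc (1:ℝ) p₀, ∃ E : ℝ, 0 < E ∧
    ∀ x₁ ∈ Ioi (0:ℝ), ∀ x₂ ∈ Ioi (0:ℝ),
      ∫ x₃ in Ioo (0:ℝ) x₁, x₃ ^ k₀ * (bs x₃ x₁ x₂) ^ p ≤ E * x₁ ^ (k₀ + 1 - p)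

/-- `ς(0) = 0` and `ς` is Hölder continuous with exponent `k₀` on `[0,∞)`. -/
def HolderZero (k₀ : ℝ) (ς : ℝ → ℝ) : Prop :=
  ς 0 = 0 ∧ ∃ H : ℝ, ∀ a b : ℝ, 0 ≤ a → 0 ≤ b → |ς a - ς b| ≤ H * |a - b| ^ k₀

/-- `ς` is bounded on `[0,∞)`. -/
def BddOnNonneg (ς : ℝ → ℝ) : Prop := ∃ C : ℝ, ∀ x : ℝ, 0 ≤ x → |ς x| ≤ C

/-- A weak solution on `[0,T)` to the collision-induced fragmentation equation with
daughter distribution `betaOf bs` and collision kernel `K`. -/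
structure IsWeakSolution (k₀ : ℝ) (bs : ℝ → ℝ → ℝ → ℝ) (K : ℝ → ℝ → ℝ)
    (uin : ℝ → ℝ) (T : ℝ≥0∞) (u : ℝ → ℝ → ℝ) : Prop where
  meas : Measurable (Function.uncurry u)
  nonneg : ∀ t : ℝ, 0 ≤ t → ENNReal.ofReal t < T → ∀ x ∈ Ioi (0:ℝ), 0 ≤ u t x
  init : ∀ x ∈ Ioi (0:ℝ), u 0 x = uin x
  cont : ∀ g : ℝ → ℝ, Measurable g → (∃ C : ℝ, ∀ x : ℝ, |g x| ≤ C) →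
    ContinuousOn (fun t => ∫ x in Ioi (0:ℝ), g x * (x ^ k₀ * u t x))
      {t : ℝ | 0 ≤ t ∧ ENNReal.ofReal t < T}
  massBdd : ∃ C : ℝ, ∀ t : ℝ, 0 ≤ t → ENNReal.ofReal t < T →
    (∫⁻ x in Ioi (0:ℝ), ENNReal.ofReal (x * u t x)) ≤ ENNReal.ofReal C
  integ : ∀ t : ℝ, 0 < t → ENNReal.ofReal t < T →
    MeasureTheory.IntegrableOn
      (fun q : ℝ × ℝ × ℝ =>
        (q.2.1 ^ k₀ + q.2.2 ^ k₀) * K q.2.1 q.2.2 * u q.1 q.2.1 * u q.1 q.2.2)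
      (Ioo (0:ℝ) t ×ˢ (Ioi (0:ℝ) ×ˢ Ioi (0:ℝ)))
  weak : ∀ t : ℝ, 0 < t → ENNReal.ofReal t < T → ∀ ς : ℝ → ℝ,
    HolderZero k₀ ς → BddOnNonneg ς →
    ∫ x in Ioi (0:ℝ), ς x * u t x =
      (∫ x in Ioi (0:ℝ), ς x * uin x) +
      (1/2) * ∫ τ in Ioo (0:ℝ) t, ∫ x₁ in Ioi (0:ℝ), ∫ x₂ in Ioi (0:ℝ),
        Upsilon bs ς x₁ x₂ * K x₁ x₂ * u τ x₁ * u τ x₂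

/-- Mass conservation on `[0,T)`. -/
def MassConserving (uin : ℝ → ℝ) (T : ℝ≥0∞) (u : ℝ → ℝ → ℝ) : Prop :=
  ∀ t : ℝ, 0 ≤ t → ENNReal.ofReal t < T → Mk 1 (u t) = Mk 1 uin

/-- The formation term `F` with kernel `K`. -/
def Fform (bs : ℝ → ℝ → ℝ → ℝ) (K : ℝ → ℝ → ℝ) (v : ℝ → ℝ) (x₁ : ℝ) : ℝ :=
  (1/2) * ∫ x₂ in Ioi x₁, ∫ x₃ in Ioo (0:ℝ) x₂,
    betaOf bs x₁ (x₂ - x₃) x₃ * K (x₂ - x₃) x₃ * v (x₂ - x₃) * v x₃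

/-- The loss term `L` with kernel `K`. -/
def Lform (K : ℝ → ℝ → ℝ) (v : ℝ → ℝ) (x₁ : ℝ) : ℝ :=
  v x₁ * ∫ x₂ in Ioi (0:ℝ), K x₁ x₂ * v x₂

/-- The norm of `X_{k₀} ∩ X₁`, i.e. the `L¹` norm with weight `x^{k₀} + x`. -/
def N01 (k₀ : ℝ) (g : ℝ → ℝ) : ℝ := ∫ x in Ioi (0:ℝ), (x ^ k₀ + x) * |g x|

/-- The truncated collision kernel `Φ_n`. -/
def PhiTrunc (l₁ l₂ : ℝ) (n : ℕ) (x₁ x₂ : ℝ) : ℝ :=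
  if x₁ ∈ Ioo ((n:ℝ)⁻¹) (n:ℝ) ∧ x₂ ∈ Ioo ((n:ℝ)⁻¹) (n:ℝ) then Phi l₁ l₂ x₁ x₂ else 0

/-- `u` is a continuously differentiable curve in `X_{k₀} ∩ X₁` on `[0,∞)`, with `u(0) = v0`,
solving `∂ₜ u = F u - L u` in the strong (norm) sense; the derivative
`t ↦ F u(t) - L u(t)` is moreover continuous in the norm of `X_{k₀} ∩ X₁`. -/
def SolvesTrunc (k₀ : ℝ) (bs : ℝ → ℝ → ℝ → ℝ) (K : ℝ → ℝ → ℝ) (v0 : ℝ → ℝ)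
    (u : ℝ → ℝ → ℝ) : Prop :=
  Measurable (Function.uncurry u) ∧
  (∀ x ∈ Ioi (0:ℝ), u 0 x = v0 x) ∧
  (∀ t : ℝ, 0 ≤ t → MemXk k₀ (u t) ∧ MemXk 1 (u t)) ∧
  (∀ t : ℝ, 0 ≤ t →
    Tendsto (fun h : ℝ =>
        N01 k₀ (fun x => (u (t + h) x - u t x) / h - (Fform bs K (u t) x - Lform K (u t) x)))
      (nhdsWithin 0 {h : ℝ | h ≠ 0 ∧ 0 ≤ t + h}) (nhds 0)) ∧
  (∀ t₀ : ℝ, 0 ≤ t₀ →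
    Tendsto (fun t : ℝ =>
        N01 k₀ (fun x =>
          (Fform bs K (u t) x - Lform K (u t) x) - (Fform bs K (u t₀) x - Lform K (u t₀) x)))
      (nhdsWithin t₀ (Ici (0:ℝ))) (nhds 0))

/-- Bundled data and standing assumptions of the paper. -/
structure Setup where
  k₀ : ℝ
  l₁ : ℝ
  l₂ : ℝ
  bs : ℝ → ℝ → ℝ → ℝ
  E₁ : ℝ
  uin : ℝ → ℝ
  hk₀ : k₀ ∈ Ioo (0:ℝ) 1
  hl₁ : k₀ ≤ l₁
  hl₁₂ : l₁ ≤ l₂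
  hl₂ : l₂ ≤ 1
  hβ : FragKernel k₀ bs
  hE₁pos : 0 < E₁
  hE₁ : ∀ x₁ ∈ Ioi (0:ℝ), ∀ x₂ ∈ Ioi (0:ℝ),
    ∫ x₃ in Ioo (0:ℝ) x₁, x₃ ^ k₀ * bs x₃ x₁ x₂ ≤ E₁ * x₁ ^ k₀
  hmeas : Measurable uin
  hnn : ∀ x : ℝ, 0 ≤ uin x
  hXk₀ : MemXk k₀ uin
  hX1 : MemXk 1 uin
  hX1k₀ : MemXk (1 + k₀) uin
  hρ : 0 < Mk 1 uin

/-- Apply a function of the seven quantities `k₀, λ₁, λ₂, ρ, M_{k₀}(u^in), M_{k₀+1}(u^in), E_{k₀,1}`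
to the data of a setup. -/
def app7 {α : Sort*} (f : ℝ → ℝ → ℝ → ℝ → ℝ → ℝ → ℝ → α) (S : Setup) : α :=
  f S.k₀ S.l₁ S.l₂ (Mk 1 S.uin) (Mk S.k₀ S.uin) (Mk (S.k₀ + 1) S.uin) S.E₁

/-- A nonnegative `C¹` solution of the truncated equation with truncated initial condition,
satisfying the mass bound and the `(k₀+1)`-moment bound. -/
def IsTruncSolution (S : Setup) (n : ℕ) (u : ℝ → ℝ → ℝ) : Prop :=
  SolvesTrunc S.k₀ S.bs (PhiTrunc S.l₁ S.l₂ n) ((Ioo (0:ℝ) (2 * n)).indicator S.uin) u ∧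
  (∀ t : ℝ, 0 ≤ t → ∀ x ∈ Ioi (0:ℝ), 0 ≤ u t x) ∧
  (∀ t : ℝ, 0 ≤ t → Mk 1 (u t) ≤ Mk 1 S.uin) ∧
  (∀ t : ℝ, 0 ≤ t → Mk (S.k₀ + 1) (u t) ≤ Mk (S.k₀ + 1) S.uin)

end

open MeasureTheory Set Filter
open scoped ENNReal

theorem ac_abs {F : ℝ → ℝ} {a b : ℝ} (h : AbsolutelyContinuousOnInterval F a b) :
    AbsolutelyContinuousOnInterval (fun x => |F x|) a b := by
  rw [absolutelyContinuousOnInterval_iff] at h ⊢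
  intro ε hε
  obtain ⟨δ, hδ, H⟩ := h ε hε
  refine ⟨δ, hδ, fun E hE hl => lt_of_le_of_lt ?_ (H E hE hl)⟩
  refine Finset.sum_le_sum fun i _ => ?_
  simp only [Real.dist_eq]
  exact abs_abs_sub_abs_le_abs_sub _ _

theorem ode_abs {t : ℝ} (ht : 0 < t) {f g : ℝ → ℝ} (hg : IntegrableOn g (Ioo 0 t))
    (hft : f t = ∫ s in Ioo 0 t, g s)
    (hf : ∀ᵐ τ ∂volume.restrict (Ioo 0 t), f τ = ∫ s in Ioo 0 τ, g s) :
    |f t| = ∫ s in Ioo 0 t, Real.sign (f s) * g s := by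
  set F : ℝ → ℝ := fun τ => ∫ s in (0:ℝ)..τ, g s with hF
  have hF' : ∀ τ, 0 ≤ τ → F τ = ∫ s in Ioo 0 τ, g s := by
    intro τ h
    simp only [hF]
    rw [intervalIntegral.integral_of_le h, integral_Ioc_eq_integral_Ioo]
  have hgi : IntervalIntegrable g volume 0 t := by
    rw [intervalIntegrable_iff_integrableOn_Ioo_of_le ht.le]; exact hg
  have hac : AbsolutelyContinuousOnInterval F 0 t :=
    hgi.absolutelyContinuousOnInterval_intervalIntegral (by simp)
  have hac2 := ac_abs hac
  have h1 := hac2.integral_deriv_eq_sub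
  have h0 : F 0 = 0 := by simp [hF]
  have h2 : |f t| = ∫ x in (0:ℝ)..t, deriv (fun x => |F x|) x := by
    rw [h1, h0, hft, hF' t ht.le]; simp
  rw [h2, intervalIntegral.integral_of_le ht.le, integral_Ioc_eq_integral_Ioo]
  apply integral_congr_ae
  have h3 := hac2.ae_differentiableAt
  have h4 := hgi.ae_hasDerivAt_integral
  filter_upwards [hf, ae_restrict_of_ae h3, ae_restrict_of_ae h4, ae_restrict_mem measurableSet_Ioo]
    with s hs h3 h4 hsm
  have hmem : s ∈ uIcc 0 t := by rw [uIcc_of_le ht.le]; exact ⟨hsm.1.le, hsm.2.le⟩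
  have h3 := h3 hmem
  have h4 : HasDerivAt F (g s) s := h4 hmem 0 (by simp)
  have hfs : f s = F s := by rw [hs, hF' s hsm.1.le]
  rw [hfs]
  rcases lt_trichotomy (F s) 0 with h | h | h
  · rw [Real.sign_of_neg h]
    have : (fun x => |F x|) =ᶠ[nhds s] fun x => - F x := by
      filter_upwards [h4.continuousAt.eventually_lt_const h] with x hx
      exact abs_of_neg hx
    rw [this.deriv_eq]
    simpa using h4.neg.deriv
  · rw [h]; simp only [Real.sign_zero, zero_mul]
    apply IsLocalMin.deriv_eq_zero
    apply Filter.Eventually.of_forall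
    intro x; simp [h]
  · rw [Real.sign_of_pos h]
    have : (fun x => |F x|) =ᶠ[nhds s] fun x => F x := by
      filter_upwards [h4.continuousAt.eventually_const_lt h] with x hx
      exact abs_of_pos hx
    rw [this.deriv_eq]
    simpa using h4.deriv

theorem ode_abs' {t : ℝ} (ht : 0 < t) {f g : ℝ → ℝ} {a b : ℝ → ℝ≥0∞}
    (hg : IntegrableOn g (Ioo 0 t)) (hfm : Measurable f)
    (hft : f t = ∫ s in Ioo 0 t, g s)
    (hf : ∀ᵐ τ ∂volume.restrict (Ioo 0 t), f τ = ∫ s in Ioo 0 τ, g s)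
    (ha : AEMeasurable a (volume.restrict (Ioo 0 t)))
    (hb : AEMeasurable b (volume.restrict (Ioo 0 t)))
    (hai : ∫⁻ s in Ioo 0 t, a s ≠ ⊤) (hbi : ∫⁻ s in Ioo 0 t, b s ≠ ⊤)
    (hab : ∀ᵐ s ∂volume.restrict (Ioo 0 t),
      Real.sign (f s) * g s + (a s).toReal ≤ (b s).toReal) :
    ENNReal.ofReal |f t| + ∫⁻ s in Ioo 0 t, a s ≤ ∫⁻ s in Ioo 0 t, b s := by
  have hai' := integrable_toReal_of_lintegral_ne_top ha hai
  have hbi' := integrable_toReal_of_lintegral_ne_top hb hbi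
  have hsm : Measurable (fun s => Real.sign (f s)) := by
    unfold Real.sign
    refine Measurable.ite (measurableSet_lt hfm measurable_const) measurable_const ?_
    exact Measurable.ite (measurableSet_lt measurable_const hfm) measurable_const measurable_const
  have hsg : Integrable (fun s => Real.sign (f s) * g s) (volume.restrict (Ioo 0 t)) := by
    refine Integrable.mono hg (hsm.aestronglyMeasurable.mul hg.1) ?_
    filter_upwards with s
    rw [norm_mul]
    have : ‖Real.sign (f s)‖ ≤ 1 := by
      rcases Real.sign_apply_eq (f s) with h | h | h <;> rw [h] <;> simp
    nlinarith [norm_nonneg (g s)]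
  have h1 := ode_abs ht hg hft hf
  have h2 : |f t| + ∫ s in Ioo 0 t, (a s).toReal ≤ ∫ s in Ioo 0 t, (b s).toReal := by
    rw [h1, ← integral_add hsg hai']
    exact integral_mono_ae (hsg.add hai') hbi' hab
  rw [integral_toReal ha (ae_lt_top' ha hai), integral_toReal hb (ae_lt_top' hb hbi)] at h2
  rw [← ENNReal.toReal_le_toReal (by simp [hai]) hbi, ENNReal.toReal_add (by simp) hai,
    ENNReal.toReal_ofReal (abs_nonneg _)]
  exact h2

theorem gronwall_zero {t0 : ℝ} (ht0 : 0 < t0) {R m : ℝ → ℝ≥0∞} {K : ℝ≥0∞} (hK : K ≠ ⊤)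
    (hm : ∫⁻ s in Ioo 0 t0, m s ≠ ⊤)
    (hRK : ∀ t, 0 < t → t ≤ t0 → R t ≤ K)
    (hR : ∀ t, 0 < t → t ≤ t0 → R t ≤ ∫⁻ s in Ioo 0 t, m s * R s) :
    R t0 = 0 := by
  let S : Set ℝ := {x | ∀ r, 0 < r → r ≤ x → r ≤ t0 → R r = 0}
  suffices h : Icc 0 t0 ⊆ S from h ⟨ht0.le, le_rfl⟩ t0 ht0 le_rfl le_rfl
  have key : ∀ x, 0 < x → x ≤ t0 → (∀ r, 0 < r → r < x → R r = 0) → R x = 0 := by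
    intro x hx hxt h
    have := hR x hx hxt
    rw [setLIntegral_congr_fun (g := fun _ => 0) measurableSet_Ioo
      (fun s hs => by simp [h s hs.1 hs.2])] at this
    simpa using this
  apply IsClosed.Icc_subset_of_forall_exists_gt
  · rw [← isSeqClosed_iff_isClosed]
    intro x p hx hp
    have hpI : p ∈ Icc 0 t0 := isClosed_Icc.mem_of_tendsto hp (Eventually.of_forall fun n => (hx n).2)
    refine ⟨?_, hpI⟩
    have hlt : ∀ r, 0 < r → r < p → R r = 0 := by
      intro r hr hrp
      obtain ⟨n, hn⟩ := (hp.eventually_const_lt hrp).exists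
      exact (hx n).1 r hr hn.le (hrp.le.trans hpI.2)
    intro r hr hrp hrt
    rcases hrp.lt_or_eq with h | h
    · exact hlt r hr h
    · subst h; exact key r hr hrt hlt
  · intro r hr hr0; exact absurd hr (not_lt.2 hr0)
  · rintro x ⟨hxS, hx0, hxt⟩ y hy
    have hy : x < y := hy
    have hlim : Tendsto (fun z => ∫⁻ s in Ioo x z, m s ∂(volume.restrict (Ioo 0 t0)))
        (nhdsWithin x (Ioi x)) (nhds 0) := by
      apply tendsto_setLIntegral_zero hm
      have : Tendsto (fun z : ℝ => ENNReal.ofReal (z - x)) (nhdsWithin x (Ioi x)) (nhds 0) := by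
        have : Tendsto (fun z : ℝ => ENNReal.ofReal (z - x)) (nhds x) (nhds (ENNReal.ofReal (x - x))) := by
          apply ENNReal.tendsto_ofReal
          exact (continuous_id.sub continuous_const).tendsto x
        rw [sub_self, ENNReal.ofReal_zero] at this
        exact this.mono_left nhdsWithin_le_nhds
      refine tendsto_of_tendsto_of_tendsto_of_le_of_le tendsto_const_nhds this
        (fun _ => zero_le) (fun z => ?_)
      refine (Measure.restrict_le_self _).trans ?_
      simp
    have hex := (hlim.eventually_lt_const (show (0:ℝ≥0∞) < 1/2 by simp)).and
      (Ioo_mem_nhdsGT (show x < min y t0 from lt_min hy hxt))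
    obtain ⟨z, hz1, hz2, hz3⟩ := hex.exists
    have hzy := (lt_min_iff.1 hz3).1
    have hzt := (lt_min_iff.1 hz3).2
    refine ⟨z, ?_, hz2, hzy.le⟩
    rw [Measure.restrict_restrict measurableSet_Ioo] at hz1
    have hsub : Ioo x z ∩ Ioo 0 t0 = Ioo x z := by
      apply inter_eq_left.2
      intro s hs; exact ⟨hx0.trans_lt hs.1, hs.2.trans hzt⟩
    rw [hsub] at hz1
    set B := ⨆ r ∈ Ioc x z, R r with hB
    have hBK : B ≤ K := iSup₂_le fun r hr => hRK r (hx0.trans_lt hr.1) (hr.2.trans hzt.le)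
    have hBB : B ≤ B * (1/2) := by
      refine iSup₂_le fun r hr => ?_
      have hr0 : 0 < r := hx0.trans_lt hr.1
      calc R r ≤ ∫⁻ s in Ioo 0 r, m s * R s := hR r hr0 (hr.2.trans hzt.le)
        _ ≤ ∫⁻ s in Ioo x z, B * m s := by
          rw [← lintegral_indicator measurableSet_Ioo, ← lintegral_indicator measurableSet_Ioo]
          apply lintegral_mono
          intro s
          by_cases hs : s ∈ Ioo 0 r
          · rw [indicator_of_mem hs]
            by_cases hsx : s ≤ x
            · rw [hxS s hs.1 hsx (hsx.trans hxt.le)]; simp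
            · have : s ∈ Ioo x z := ⟨not_le.1 hsx, hs.2.trans_le hr.2⟩
              rw [indicator_of_mem this, mul_comm]
              gcongr
              exact le_iSup₂ (f := fun r (_ : r ∈ Ioc x z) => R r) s ⟨this.1, this.2.le⟩
          · rw [indicator_of_notMem hs]; exact zero_le
        _ = B * ∫⁻ s in Ioo x z, m s := lintegral_const_mul' _ _ (ne_top_of_le_ne_top hK hBK)
        _ ≤ B * (1/2) := by gcongr
    have hB0 : B = 0 := by
      have hBt := ne_top_of_le_ne_top hK hBK
      have := ENNReal.toReal_mono (by finiteness) hBB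
      rw [ENNReal.toReal_mul] at this
      simp at this
      have h0 := ENNReal.toReal_nonneg (a := B)
      have : B.toReal = 0 := by linarith
      exact (ENNReal.toReal_eq_zero_iff _).1 this |>.resolve_right hBt
    intro r hr hrz hrt
    by_cases hrx : r ≤ x
    · exact hxS r hr hrx hrt
    · have : R r ≤ B := le_iSup₂ (f := fun r (_ : r ∈ Ioc x z) => R r) r ⟨not_le.1 hrx, hrz⟩
      rw [hB0] at this
      simpa using this

open MeasureTheory Set Filter
open scoped ENNReal

noncomputable section

/-- Lebesgue measure on the positive half-line. -/
abbrev nu : Measure ℝ := volume.restrict (Ioi (0:ℝ))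

/-- Powers with values in the extended nonnegative reals. -/
def pw (a x : ℝ) : ℝ≥0∞ := ENNReal.ofReal (x ^ a)

theorem pw_meas (a : ℝ) : Measurable (pw a) := by
  unfold pw; fun_prop

def Jk (k : ℝ) (bs : ℝ → ℝ → ℝ → ℝ) (x y : ℝ) : ℝ≥0∞ :=
  ∫⁻ z in Ioo (0:ℝ) x, ENNReal.ofReal (z ^ k * bs z x y)

def Gd (k : ℝ) (bs : ℝ → ℝ → ℝ → ℝ) : Set (ℝ × ℝ) :=
  {q | Jk k bs q.1 q.2 < ⊤ ∧ Jk k bs q.2 q.1 < ⊤}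

open Classical in
def be (k : ℝ) (bs : ℝ → ℝ → ℝ → ℝ) (z x y : ℝ) : ℝ≥0∞ :=
  if (x, y) ∈ Gd k bs then ENNReal.ofReal (betaOf bs z x y) else 0

structure KerProp (k E : ℝ) (b : ℝ → ℝ → ℝ → ℝ≥0∞) : Prop where
  meas : Measurable fun q : ℝ × ℝ × ℝ => b q.1 q.2.1 q.2.2
  symm : ∀ z x y, b z x y = b z y x
  P1 : ∀ x y, 0 < x → 0 < y →
    ∫⁻ z, pw k z * b z x y ∂nu ≤ ENNReal.ofReal E * (pw k x + pw k y)
  P2 : ∀ x y, 0 < x → 0 < y →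
    ∫⁻ z, pw (1 + k) z * b z x y ∂nu < pw (1 + k) x + pw (1 + k) y

theorem betaOf_meas {k : ℝ} {bs : ℝ → ℝ → ℝ → ℝ} (h : FragKernel k bs) :
    Measurable fun q : ℝ × ℝ × ℝ => betaOf bs q.1 q.2.1 q.2.2 := by
  have hm := h.meas
  unfold betaOf
  refine Measurable.add (Measurable.ite ?_ hm measurable_const)
    (Measurable.ite ?_ ?_ measurable_const)
  · exact (measurableSet_lt measurable_const measurable_fst).inter
      (measurableSet_lt measurable_fst (measurable_fst.comp measurable_snd))
  · exact (measurableSet_lt measurable_const measurable_fst).inter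
      (measurableSet_lt measurable_fst (measurable_snd.comp measurable_snd))
  · exact hm.comp (measurable_fst.prodMk
      ((measurable_snd.comp measurable_snd).prodMk (measurable_fst.comp measurable_snd)))

theorem bs_meas {k : ℝ} {bs : ℝ → ℝ → ℝ → ℝ} (h : FragKernel k bs) (x y : ℝ) :
    Measurable fun z => bs z x y :=
  h.meas.comp (measurable_id.prodMk (measurable_const (a := (x, y))))

theorem betaOf_meas1 {k : ℝ} {bs : ℝ → ℝ → ℝ → ℝ} (h : FragKernel k bs) (x y : ℝ) :
    Measurable fun z => betaOf bs z x y :=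
  (betaOf_meas h).comp (measurable_id.prodMk (measurable_const (a := (x, y))))

theorem betaOf_nonneg {k : ℝ} {bs : ℝ → ℝ → ℝ → ℝ} (h : FragKernel k bs) (z x y : ℝ) :
    0 ≤ betaOf bs z x y := by
  have h1 := h.nonneg z x y
  have h2 := h.nonneg z y x
  unfold betaOf
  split_ifs <;> linarith

theorem betaOf_symm (bs : ℝ → ℝ → ℝ → ℝ) (z x y : ℝ) :
    betaOf bs z x y = betaOf bs z y x := by
  unfold betaOf; rw [add_comm]

theorem Jk_meas {k : ℝ} {bs : ℝ → ℝ → ℝ → ℝ} (h : FragKernel k bs) :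
    Measurable fun q : ℝ × ℝ => Jk k bs q.1 q.2 := by
  have : (fun q : ℝ × ℝ => Jk k bs q.1 q.2) = fun q : ℝ × ℝ => ∫⁻ z,
      (if z ∈ Ioo 0 q.1 then ENNReal.ofReal (z ^ k * bs z q.1 q.2) else 0) := by
    ext q
    unfold Jk
    rw [← lintegral_indicator measurableSet_Ioo]
    congr 1
    ext z
    simp [indicator]
  rw [this]
  apply Measurable.lintegral_prod_right' (f := fun (w : (ℝ × ℝ) × ℝ) =>
    (if w.2 ∈ Ioo 0 w.1.1 then ENNReal.ofReal (w.2 ^ k * bs w.2 w.1.1 w.1.2) else 0))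
  refine Measurable.ite ?_ ?_ measurable_const
  · exact (measurableSet_lt measurable_const measurable_snd).inter
      (measurableSet_lt measurable_snd (measurable_fst.comp measurable_fst))
  · have : Measurable fun w : (ℝ × ℝ) × ℝ => bs w.2 w.1.1 w.1.2 :=
      h.meas.comp (measurable_snd.prodMk measurable_fst)
    exact ENNReal.measurable_ofReal.comp ((measurable_snd.pow_const k).mul this)

theorem Gd_meas {k : ℝ} {bs : ℝ → ℝ → ℝ → ℝ} (h : FragKernel k bs) :
    MeasurableSet (Gd k bs) := by
  have hJ := Jk_meas h
  exact (measurableSet_lt hJ measurable_const).inter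
    (measurableSet_lt (hJ.comp measurable_swap) measurable_const)

theorem Gd_symm {k : ℝ} {bs : ℝ → ℝ → ℝ → ℝ} (x y : ℝ) :
    (x, y) ∈ Gd k bs ↔ (y, x) ∈ Gd k bs := by
  simp only [Gd, mem_ofPred_eq]; tauto

/-- splitting of integrals against betaOf -/
theorem lint_betaOf {k : ℝ} {bs : ℝ → ℝ → ℝ → ℝ} (h : FragKernel k bs) {s : ℝ → ℝ≥0∞}
    (hs : Measurable s) (x y : ℝ) :
    ∫⁻ z, s z * ENNReal.ofReal (betaOf bs z x y) ∂nu =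
      (∫⁻ z in Ioo 0 x, s z * ENNReal.ofReal (bs z x y)) +
      ∫⁻ z in Ioo 0 y, s z * ENNReal.ofReal (bs z y x) := by
  have hm1 := bs_meas h x y
  have hm2 := bs_meas h y x
  rw [← lintegral_indicator measurableSet_Ioi, ← lintegral_indicator measurableSet_Ioo,
    ← lintegral_indicator measurableSet_Ioo, ← lintegral_add_left]
  · congr 1
    ext z
    unfold betaOf
    by_cases hz : 0 < z
    · have h1 := h.nonneg z x y
      have h2 := h.nonneg z y x
      by_cases hx : z < x <;> by_cases hy : z < y <;>
        simp [indicator, hz, hx, hy, ENNReal.ofReal_add h1 h2, mul_add]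
    · simp [indicator, hz]
  · exact Measurable.indicator (by fun_prop) measurableSet_Ioo

theorem mass_lint {k : ℝ} {bs : ℝ → ℝ → ℝ → ℝ} (h : FragKernel k bs) {x y : ℝ}
    (hx : 0 < x) (hy : 0 < y) :
    ∫⁻ z in Ioo 0 x, ENNReal.ofReal z * ENNReal.ofReal (bs z x y) = ENNReal.ofReal x := by
  have hm := h.mass x hx y hy
  have hi : Integrable (fun z => z * bs z x y) (volume.restrict (Ioo 0 x)) := by
    by_contra hc
    rw [integral_undef hc] at hm
    exact hx.ne hm
  conv_rhs => rw [← hm]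
  rw [ofReal_integral_eq_lintegral_ofReal hi]
  · apply setLIntegral_congr_fun measurableSet_Ioo
    intro z hz
    simp only
    rw [ENNReal.ofReal_mul hz.1.le]
  · filter_upwards [ae_restrict_mem measurableSet_Ioo] with z hz
    exact mul_nonneg hz.1.le (h.nonneg _ _ _)

theorem mass_betaOf {k : ℝ} {bs : ℝ → ℝ → ℝ → ℝ} (h : FragKernel k bs) {x y : ℝ}
    (hx : 0 < x) (hy : 0 < y) :
    ∫⁻ z, ENNReal.ofReal z * ENNReal.ofReal (betaOf bs z x y) ∂nu =
      ENNReal.ofReal x + ENNReal.ofReal y := by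
  rw [lint_betaOf h ENNReal.measurable_ofReal, mass_lint h hx hy, mass_lint h hy hx]

theorem half_P2 {k : ℝ} (hk : 0 < k) {bs : ℝ → ℝ → ℝ → ℝ} (h : FragKernel k bs) {x y : ℝ}
    (hx : 0 < x) (hy : 0 < y) :
    ∫⁻ z in Ioo 0 x, pw (1 + k) z * ENNReal.ofReal (bs z x y) < pw (1 + k) x := by
  have hm := mass_lint h hx hy
  have hbm := bs_meas h x y
  have hpm := pw_meas (1 + k)
  have e : pw (1 + k) x = ∫⁻ z in Ioo 0 x, pw k x * (ENNReal.ofReal z * ENNReal.ofReal (bs z x y)) := by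
    rw [lintegral_const_mul _ (by fun_prop), hm]
    unfold pw
    rw [← ENNReal.ofReal_mul (by positivity), add_comm, Real.rpow_add_one hx.ne']
  have hle : ∀ z ∈ Ioo 0 x, 0 < bs z x y → pw (1 + k) z * ENNReal.ofReal (bs z x y) <
      pw k x * (ENNReal.ofReal z * ENNReal.ofReal (bs z x y)) := by
    intro z hz hb
    unfold pw
    have hz0 := hz.1
    rw [← ENNReal.ofReal_mul (by positivity), ← ENNReal.ofReal_mul (by positivity),
      ← ENNReal.ofReal_mul (by positivity), add_comm, Real.rpow_add_one hz0.ne']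
    rw [ENNReal.ofReal_lt_ofReal_iff (by positivity)]
    have := Real.rpow_lt_rpow hz0.le hz.2 hk
    rw [mul_assoc]
    gcongr
  have hle' : ∀ z ∈ Ioo 0 x, pw (1 + k) z * ENNReal.ofReal (bs z x y) ≤
      pw k x * (ENNReal.ofReal z * ENNReal.ofReal (bs z x y)) := by
    intro z hz
    rcases (h.nonneg z x y).lt_or_eq with hb | hb
    · exact (hle z hz hb).le
    · simp [← hb]
  have hmono : ∫⁻ z in Ioo 0 x, pw (1 + k) z * ENNReal.ofReal (bs z x y) ≤ pw (1 + k) x := by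
    rw [e]; exact setLIntegral_mono' measurableSet_Ioo hle'
  have hfin : ∫⁻ z in Ioo 0 x, pw (1 + k) z * ENNReal.ofReal (bs z x y) ≠ ⊤ :=
    ne_top_of_le_ne_top (by simp [pw]) hmono
  rw [e]
  apply lintegral_strict_mono_of_ae_le_of_ae_lt_on (by fun_prop) hfin
    (s := {z | 0 < bs z x y})
  · filter_upwards [ae_restrict_mem measurableSet_Ioo] with z hz using hle' z hz
  · intro h0
    have : ∫⁻ z in Ioo 0 x, ENNReal.ofReal z * ENNReal.ofReal (bs z x y) = 0 := by
      rw [lintegral_eq_zero_iff (by fun_prop)]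
      have h1 : ∀ᵐ z ∂(volume.restrict (Ioo 0 x)), ¬ 0 < bs z x y := by
        rw [ae_iff]; simpa using h0
      filter_upwards [h1] with z hz
      simp [ENNReal.ofReal_of_nonpos (not_lt.1 hz)]
    rw [hm] at this
    simp at this
    linarith
  · filter_upwards [ae_restrict_mem measurableSet_Ioo] with z hz hb using hle z hz hb

theorem half_P1 {k : ℝ} {bs : ℝ → ℝ → ℝ → ℝ} (h : FragKernel k bs) :
    ∃ E : ℝ, 0 < E ∧ ∀ x y, 0 < x → 0 < y → Jk k bs x y < ⊤ →
    ∫⁻ z in Ioo 0 x, pw k z * ENNReal.ofReal (bs z x y) ≤ ENNReal.ofReal E * pw k x := by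
  obtain ⟨p0, hp0, H⟩ := h.bound
  obtain ⟨E, hE, H⟩ := H 1 ⟨le_rfl, hp0.1.le⟩
  refine ⟨E, hE, fun x y hx hy hJ => ?_⟩
  have H := H x hx y hy
  simp only [Real.rpow_one, add_sub_cancel_right] at H
  have hbm := bs_meas h x y
  have hi : Integrable (fun z => z ^ k * bs z x y) (volume.restrict (Ioo 0 x)) := by
    refine ⟨by fun_prop, ?_⟩
    rw [hasFiniteIntegral_iff_ofReal]
    · exact hJ
    · filter_upwards [ae_restrict_mem measurableSet_Ioo] with z hz
      exact mul_nonneg (Real.rpow_nonneg hz.1.le _) (h.nonneg _ _ _)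
  unfold pw
  rw [← ENNReal.ofReal_mul hE.le]
  refine le_trans (le_of_eq ?_) (ENNReal.ofReal_le_ofReal H)
  rw [ofReal_integral_eq_lintegral_ofReal hi]
  · apply setLIntegral_congr_fun measurableSet_Ioo
    intro z hz
    simp only
    rw [ENNReal.ofReal_mul (Real.rpow_nonneg hz.1.le _)]
  · filter_upwards [ae_restrict_mem measurableSet_Ioo] with z hz
    exact mul_nonneg (Real.rpow_nonneg hz.1.le _) (h.nonneg _ _ _)

theorem kerProp_be {k : ℝ} (hk : 0 < k) {bs : ℝ → ℝ → ℝ → ℝ} (h : FragKernel k bs) :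
    ∃ E : ℝ, 0 < E ∧ KerProp k E (be k bs) := by
  obtain ⟨E, hE, H⟩ := half_P1 h
  refine ⟨E, hE, ?_, ?_, ?_, ?_⟩
  · unfold be
    refine Measurable.ite ?_ ?_ measurable_const
    · exact measurable_snd (Gd_meas h)
    · exact ENNReal.measurable_ofReal.comp (betaOf_meas h)
  · intro z x y
    unfold be
    rw [betaOf_symm bs z x y]
    by_cases hg : (x, y) ∈ Gd k bs
    · rw [if_pos hg, if_pos ((Gd_symm _ _).1 hg)]
    · rw [if_neg hg, if_neg (fun h => hg ((Gd_symm _ _).1 h))]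
  · intro x y hx hy
    unfold be
    by_cases hg : (x, y) ∈ Gd k bs
    · simp only [if_pos hg]
      rw [lint_betaOf h (pw_meas k), mul_add]
      exact add_le_add (H x y hx hy hg.1) (H y x hy hx hg.2)
    · simp [if_neg hg]
  · intro x y hx hy
    unfold be
    by_cases hg : (x, y) ∈ Gd k bs
    · simp only [if_pos hg]
      rw [lint_betaOf h (pw_meas _)]
      exact ENNReal.add_lt_add (half_P2 hk h hx hy) (half_P2 hk h hy hx)
    · simp only [if_neg hg]
      simp [pw]
      left; positivity

/-- the base test function -/
def s0 (k z : ℝ) : ℝ := (min (max z 0) 1) ^ k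

def Theta (b : ℝ → ℝ → ℝ → ℝ≥0∞) (s : ℝ → ℝ) (x y : ℝ) : ℝ≥0∞ :=
  ∫⁻ z, ENNReal.ofReal (s z) * b z x y ∂nu

theorem Theta_meas {k E : ℝ} {b : ℝ → ℝ → ℝ → ℝ≥0∞} (hb : KerProp k E b) {s : ℝ → ℝ}
    (hs : Measurable s) : Measurable fun q : ℝ × ℝ => Theta b s q.1 q.2 := by
  unfold Theta
  apply Measurable.lintegral_prod_right' (f := fun (w : (ℝ × ℝ) × ℝ) =>
    ENNReal.ofReal (s w.2) * b w.2 w.1.1 w.1.2)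
  have : Measurable fun w : (ℝ × ℝ) × ℝ => b w.2 w.1.1 w.1.2 :=
      hb.meas.comp (measurable_snd.prodMk measurable_fst)
  exact (ENNReal.measurable_ofReal.comp (hs.comp measurable_snd)).mul this

theorem Theta_le {k E : ℝ} {b : ℝ → ℝ → ℝ → ℝ≥0∞} (hb : KerProp k E b) {s : ℝ → ℝ}
    {C : ℝ} (hC : 0 ≤ C) (hs : ∀ z, 0 < z → s z ≤ C * z ^ k) {x y : ℝ} (hx : 0 < x) (hy : 0 < y) :
    Theta b s x y ≤ ENNReal.ofReal (C * E) * (pw k x + pw k y) := by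
  have hbm : Measurable fun z => b z x y :=
    hb.meas.comp (measurable_id.prodMk (measurable_const (a := (x, y))))
  have hpm := pw_meas k
  calc Theta b s x y ≤ ∫⁻ z, ENNReal.ofReal C * (pw k z * b z x y) ∂nu := by
        apply setLIntegral_mono' measurableSet_Ioi
        intro z hz
        rw [← mul_assoc]
        unfold pw
        rw [← ENNReal.ofReal_mul hC]
        gcongr
        exact hs z hz
    _ = ENNReal.ofReal C * ∫⁻ z, pw k z * b z x y ∂nu := lintegral_const_mul _ (by fun_prop)
    _ ≤ _ := by
        rw [ENNReal.ofReal_mul hC, mul_assoc]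
        gcongr
        exact hb.P1 x y hx hy

theorem Ups_form {k : ℝ} (hk : k ∈ Ioo (0:ℝ) 1) {bs : ℝ → ℝ → ℝ → ℝ} (h : FragKernel k bs)
    {s : ℝ → ℝ} (hsm : Measurable s) (hs0 : ∀ z, 0 < z → s0 k z ≤ s z)
    {x y : ℝ} (hx : 0 < x) (hy : 0 < y) :
    Upsilon bs s x y = (Theta (be k bs) s x y).toReal - s x - s y := by
  unfold Upsilon
  congr 2
  have hbm := betaOf_meas1 h x y
  have hsnn : ∀ z, 0 < z → 0 ≤ s z := fun z hz => le_trans (by unfold s0; positivity) (hs0 z hz)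
  have hnn : ∀ᵐ z ∂nu, 0 ≤ s z * betaOf bs z x y := by
    filter_upwards [ae_restrict_mem measurableSet_Ioi] with z hz
    exact mul_nonneg (hsnn z hz) (betaOf_nonneg h _ _ _)
  have e1 : ∫ z in Ioo 0 (x + y), s z * betaOf bs z x y = ∫ z, s z * betaOf bs z x y ∂nu := by
    symm
    apply setIntegral_eq_of_subset_of_forall_sdiff_eq_zero measurableSet_Ioi
    · exact fun z hz => hz.1
    · intro z hz
      have hz0 : 0 < z := hz.1
      have hz1 : x + y ≤ z := by
        by_contra hc; exact hz.2 ⟨hz0, not_le.1 hc⟩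
      have h1 : ¬ z < x := by linarith
      have h2 : ¬ z < y := by linarith
      simp [betaOf, h1, h2]
  rw [e1]
  have e2 : ∫⁻ z, ENNReal.ofReal (s z * betaOf bs z x y) ∂nu =
      ∫⁻ z, ENNReal.ofReal (s z) * ENNReal.ofReal (betaOf bs z x y) ∂nu := by
    apply setLIntegral_congr_fun measurableSet_Ioi
    intro z hz
    exact ENNReal.ofReal_mul (hsnn z hz)
  unfold Theta be
  by_cases hg : (x, y) ∈ Gd k bs
  · simp only [if_pos hg]
    rw [integral_eq_lintegral_of_nonneg_ae hnn (by fun_prop), e2]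
  · simp only [if_neg hg, mul_zero, lintegral_zero, ENNReal.toReal_zero]
    apply integral_undef
    intro hi
    apply hg
    have hfin : ∫⁻ z, ENNReal.ofReal (s z) * ENNReal.ofReal (betaOf bs z x y) ∂nu < ⊤ := by
      rw [← e2, ← hasFiniteIntegral_iff_ofReal hnn]; exact hi.2
    have hpm := pw_meas k
    have hfin2 : ∫⁻ z, pw k z * ENNReal.ofReal (betaOf bs z x y) ∂nu < ⊤ := by
      calc ∫⁻ z, pw k z * ENNReal.ofReal (betaOf bs z x y) ∂nu
          ≤ ∫⁻ z, (ENNReal.ofReal (s z) * ENNReal.ofReal (betaOf bs z x y) +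
            ENNReal.ofReal z * ENNReal.ofReal (betaOf bs z x y)) ∂nu := by
            apply setLIntegral_mono' measurableSet_Ioi
            intro z hz
            rw [← add_mul]
            gcongr
            have hz : 0 < z := hz
            rw [← ENNReal.ofReal_add (hsnn z hz) hz.le]
            apply ENNReal.ofReal_le_ofReal
            refine le_trans ?_ (add_le_add_left (hs0 z hz) z)
            unfold s0
            rw [max_eq_left hz.le]
            rcases le_total z 1 with h1 | h1
            · rw [min_eq_left h1]; linarith
            · rw [min_eq_right h1]
              have := Real.rpow_le_rpow_of_exponent_le h1 hk.2.le
              rw [Real.rpow_one] at this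
              have : (0:ℝ) ≤ 1 ^ k := by positivity
              linarith
        _ < ⊤ := by
            rw [lintegral_add_left (by fun_prop), mass_betaOf h hx hy]
            exact ENNReal.add_lt_top.2 ⟨hfin, by simp⟩
    rw [lint_betaOf h hpm, ENNReal.add_lt_top] at hfin2
    have conv : ∀ x y, Jk k bs x y = ∫⁻ z in Ioo 0 x, pw k z * ENNReal.ofReal (bs z x y) := by
      intro x y
      apply setLIntegral_congr_fun measurableSet_Ioo
      intro z hz
      exact ENNReal.ofReal_mul (Real.rpow_nonneg hz.1.le _)
    refine ⟨?_, ?_⟩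
    · simp only; rw [conv]; exact hfin2.1
    · simp only; rw [conv]; exact hfin2.2

end

open MeasureTheory Set Filter
open scoped ENNReal

noncomputable section

theorem ae_eq_of_rat {S : Set ℝ} {F G : ℝ → ℝ≥0∞}
    (hF : AEMeasurable F (volume.restrict S)) (hG : AEMeasurable G (volume.restrict S))
    (hFi : ∫⁻ z in S, F z ≠ ⊤) (hGi : ∫⁻ z in S, G z ≠ ⊤)
    (h : ∀ p q : ℚ, ∫⁻ z in Ioo (p:ℝ) q ∩ S, F z = ∫⁻ z in Ioo (p:ℝ) q ∩ S, G z) :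
    F =ᵐ[volume.restrict S] G := by
  rw [← withDensity_eq_iff hF hG hFi]
  have : IsFiniteMeasure ((volume.restrict S).withDensity F) :=
    isFiniteMeasure_withDensity hFi
  have : IsFiniteMeasure ((volume.restrict S).withDensity G) :=
    isFiniteMeasure_withDensity hGi
  apply Real.measure_ext_Ioo_rat
  intro p q
  rw [withDensity_apply _ measurableSet_Ioo, withDensity_apply _ measurableSet_Ioo,
    Measure.restrict_restrict measurableSet_Ioo]
  exact h p q

/-- trapezoidal test functions -/
def trap (n : ℕ) (a b z : ℝ) : ℝ := max 0 (min (min 1 (n * (z - a))) (n * (b - z)))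

theorem trap_meas (n : ℕ) (a b : ℝ) : Measurable (trap n a b) := by
  unfold trap; fun_prop

theorem trap_nonneg (n : ℕ) (a b z : ℝ) : 0 ≤ trap n a b z := le_max_left _ _

theorem trap_le_one (n : ℕ) (a b z : ℝ) : trap n a b z ≤ 1 :=
  max_le zero_le_one ((min_le_left _ _).trans (min_le_left _ _))

theorem trap_lip1 (n : ℕ) (a b z w : ℝ) : trap n a b z ≤ trap n a b w + n * |z - w| := by
  unfold trap
  have hn : (0:ℝ) ≤ n := n.cast_nonneg
  have h0 : 0 ≤ n * |z - w| := by positivity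
  have h1 : (n:ℝ) * (z - w) ≤ n * |z - w| := by gcongr; exact le_abs_self _
  have h2 : (n:ℝ) * (w - z) ≤ n * |z - w| := by
    gcongr; rw [abs_sub_comm]; exact le_abs_self _
  apply max_le
  · have := le_max_left (0:ℝ) (min (min 1 ((n:ℝ) * (w - a))) (n * (b - w)))
    linarith
  · refine le_trans ?_ (add_le_add_left (le_max_right _ _) _)
    rw [← min_add_add_right, ← min_add_add_right]
    apply min_le_min
    · apply min_le_min
      · linarith
      · linarith
    · linarith

theorem trap_lip (n : ℕ) (a b z w : ℝ) : |trap n a b z - trap n a b w| ≤ n * |z - w| := by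
  have h1 := trap_lip1 n a b z w
  have h2 := trap_lip1 n a b w z
  rw [abs_sub_comm w z] at h2
  rw [abs_le]; constructor <;> linarith

theorem trap_zero (n : ℕ) {a b : ℝ} (ha : 0 ≤ a) : trap n a b 0 = 0 := by
  unfold trap
  apply max_eq_left
  refine (min_le_left _ _).trans ((min_le_right _ _).trans ?_)
  have hn : (0:ℝ) ≤ n := n.cast_nonneg
  nlinarith

theorem lip_hold {k : ℝ} (hk : k ∈ Ioo (0:ℝ) 1) {n : ℕ} {a b z w : ℝ} :
    |trap n a b z - trap n a b w| ≤ (n + 1) * |z - w| ^ k := by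
  have hn : (0:ℝ) ≤ n := n.cast_nonneg
  have hp : 0 ≤ |z - w| ^ k := by positivity
  rcases le_total |z - w| 1 with h | h
  · have h1 := trap_lip n a b z w
    have h2 : |z - w| ≤ |z - w| ^ k := by
      rcases (abs_nonneg (z - w)).lt_or_eq with h0 | h0
      · have := Real.rpow_le_rpow_of_exponent_ge h0 h hk.2.le
        rwa [Real.rpow_one] at this
      · rw [← h0]; positivity
    nlinarith
  · have h1 : |trap n a b z - trap n a b w| ≤ 1 := by
      have := trap_nonneg n a b z
      have := trap_nonneg n a b w
      have := trap_le_one n a b z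
      have := trap_le_one n a b w
      rw [abs_le]; constructor <;> linarith
    have h2 : 1 ≤ |z - w| ^ k := Real.one_le_rpow h hk.1.le
    nlinarith

theorem trap_le_pow {k : ℝ} (hk : k ∈ Ioo (0:ℝ) 1) {n : ℕ} {a b z : ℝ} (ha : 0 ≤ a)
    (hz : 0 < z) : trap n a b z ≤ (n + 1) * z ^ k := by
  have := lip_hold hk (n := n) (a := a) (b := b) (z := z) (w := 0)
  rw [trap_zero n ha, sub_zero, sub_zero, abs_of_pos hz] at this
  exact (le_abs_self _).trans this

theorem trap_le_id {n : ℕ} {a b z : ℝ} (ha : 0 ≤ a)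
    (hz : 0 < z) : trap n a b z ≤ n * z := by
  have := trap_lip1 n a b z 0
  rw [trap_zero n ha, sub_zero, abs_of_pos hz] at this
  linarith

theorem s0_meas (k : ℝ) : Measurable (s0 k) := by unfold s0; fun_prop

theorem s0_nonneg (k z : ℝ) : 0 ≤ s0 k z := by unfold s0; positivity

theorem s0_le_one {k : ℝ} (hk : k ∈ Ioo (0:ℝ) 1) (z : ℝ) : s0 k z ≤ 1 := by
  unfold s0
  exact Real.rpow_le_one (by positivity) (min_le_right _ _) hk.1.le

theorem s0_zero {k : ℝ} (hk : k ∈ Ioo (0:ℝ) 1) : s0 k 0 = 0 := by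
  unfold s0
  simp [Real.zero_rpow hk.1.ne']

theorem s0_le_pow {k : ℝ} (hk : k ∈ Ioo (0:ℝ) 1) {z : ℝ} (hz : 0 < z) : s0 k z ≤ z ^ k := by
  unfold s0
  rw [max_eq_left hz.le]
  exact Real.rpow_le_rpow (by positivity) (min_le_left _ _) hk.1.le

theorem pow_hold1 {k : ℝ} (hk : k ∈ Ioo (0:ℝ) 1) {x y : ℝ} (hx : 0 ≤ x) (hy : 0 ≤ y) :
    x ^ k ≤ y ^ k + |x - y| ^ k := by
  refine le_trans ?_ (Real.rpow_add_le_add_rpow hy (abs_nonneg (x - y)) hk.1.le hk.2.le)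
  apply Real.rpow_le_rpow hx _ hk.1.le
  have := le_abs_self (x - y)
  linarith

theorem s0_hold1 {k : ℝ} (hk : k ∈ Ioo (0:ℝ) 1) (x y : ℝ) :
    s0 k x ≤ s0 k y + |x - y| ^ k := by
  unfold s0
  refine (pow_hold1 hk (x := min (max x 0) 1) (y := min (max y 0) 1) (by positivity)
    (by positivity)).trans ?_
  refine add_le_add le_rfl ?_
  apply Real.rpow_le_rpow (abs_nonneg _) _ hk.1.le
  refine (abs_min_sub_min_le_max _ _ _ _).trans ?_
  rw [sub_self, abs_zero, max_eq_left (abs_nonneg _)]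
  refine (abs_max_sub_max_le_max _ _ _ _).trans ?_
  rw [sub_self, abs_zero, max_eq_left (abs_nonneg _)]

theorem s0_hold {k : ℝ} (hk : k ∈ Ioo (0:ℝ) 1) (x y : ℝ) :
    |s0 k x - s0 k y| ≤ |x - y| ^ k := by
  have h1 := s0_hold1 hk x y
  have h2 := s0_hold1 hk y x
  rw [abs_sub_comm y x] at h2
  rw [abs_le]; constructor <;> linarith

theorem hz_s0 {k : ℝ} (hk : k ∈ Ioo (0:ℝ) 1) : HolderZero k (s0 k) :=
  ⟨s0_zero hk, 1, fun a b _ _ => by rw [one_mul]; exact s0_hold hk a b⟩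

theorem bd_s0 {k : ℝ} (hk : k ∈ Ioo (0:ℝ) 1) : BddOnNonneg (s0 k) :=
  ⟨1, fun x _ => by rw [abs_of_nonneg (s0_nonneg k x)]; exact s0_le_one hk x⟩

theorem hz_s1 {k : ℝ} (hk : k ∈ Ioo (0:ℝ) 1) (n : ℕ) {a b : ℝ} (ha : 0 ≤ a) :
    HolderZero k (fun z => s0 k z + trap n a b z) := by
  refine ⟨by simp [s0_zero hk, trap_zero n ha], 1 + (n + 1), fun x y _ _ => ?_⟩
  have h1 := s0_hold hk x y
  have h2 := lip_hold hk (n := n) (a := a) (b := b) (z := x) (w := y)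
  rw [abs_le] at *
  constructor <;> nlinarith

theorem bd_s1 {k : ℝ} (hk : k ∈ Ioo (0:ℝ) 1) (n : ℕ) {a b : ℝ}  :
    BddOnNonneg (fun z => s0 k z + trap n a b z) := by
  refine ⟨2, fun x _ => ?_⟩
  have := s0_nonneg k x
  have := s0_le_one hk x
  have := trap_nonneg n a b x
  have := trap_le_one n a b x
  rw [abs_le]; constructor <;> linarith

theorem trap_mono {m n : ℕ} (h : m ≤ n) (a b z : ℝ) : trap m a b z ≤ trap n a b z := by
  have hmn : (m:ℝ) ≤ n := by exact_mod_cast h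
  unfold trap
  by_cases h1 : z < a
  · refine le_trans (le_of_eq ?_) (le_max_left _ _)
    apply max_eq_left
    refine (min_le_left _ _).trans ((min_le_right _ _).trans ?_)
    have hn : (0:ℝ) ≤ m := m.cast_nonneg
    nlinarith
  by_cases h2 : b < z
  · refine le_trans (le_of_eq ?_) (le_max_left _ _)
    apply max_eq_left
    refine (min_le_right _ _).trans ?_
    have hn : (0:ℝ) ≤ m := m.cast_nonneg
    nlinarith
  push Not at h1 h2
  have h3 : 0 ≤ z - a := by linarith
  have h4 : 0 ≤ b - z := by linarith
  gcongr

theorem trap_sup (a b z : ℝ) :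
    ⨆ n : ℕ, ENNReal.ofReal (trap n a b z) = (Ioo a b).indicator (fun _ => 1) z := by
  by_cases hz : z ∈ Ioo a b
  · rw [indicator_of_mem hz]
    apply le_antisymm
    · exact iSup_le fun n => by
        rw [← ENNReal.ofReal_one]; exact ENNReal.ofReal_le_ofReal (trap_le_one _ _ _ _)
    · have h3 : 0 < z - a := by linarith [hz.1]
      have h4 : 0 < b - z := by linarith [hz.2]
      obtain ⟨n, hn⟩ := exists_nat_ge (max (1 / (z - a)) (1 / (b - z)))
      refine le_trans ?_ (le_iSup _ n)
      rw [← ENNReal.ofReal_one]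
      apply ENNReal.ofReal_le_ofReal
      unfold trap
      refine le_trans ?_ (le_max_right _ _)
      have h5 := (le_max_left _ _).trans hn
      have h6 := (le_max_right _ _).trans hn
      rw [div_le_iff₀ h3] at h5
      rw [div_le_iff₀ h4] at h6
      exact le_min (le_min le_rfl h5) h6
  · rw [indicator_of_notMem hz]
    simp only [ENNReal.iSup_eq_zero, ENNReal.ofReal_eq_zero]
    intro n
    have hn : (0:ℝ) ≤ n := n.cast_nonneg
    unfold trap
    apply max_le le_rfl
    by_cases h1 : z ≤ a
    · refine (min_le_left _ _).trans ((min_le_right _ _).trans ?_)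
      nlinarith
    · have : b ≤ z := by
        by_contra hc; exact hz ⟨not_le.1 h1, not_le.1 hc⟩
      refine (min_le_right _ _).trans ?_
      nlinarith

theorem lint_trap_sup {F : ℝ → ℝ≥0∞} (hF : Measurable F) (a b : ℝ) :
    ∫⁻ z in Ioo a b ∩ Ioi 0, F z = ⨆ n : ℕ, ∫⁻ z, ENNReal.ofReal (trap n a b z) * F z ∂nu := by
  rw [← lintegral_iSup]
  · rw [← Measure.restrict_restrict measurableSet_Ioo, ← lintegral_indicator measurableSet_Ioo]
    congr 1
    ext z
    rw [← ENNReal.iSup_mul, trap_sup]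
    by_cases hz : z ∈ Ioo a b <;> simp [hz]
  · intro n
    have := trap_meas n a b
    fun_prop
  · intro m n h z
    dsimp only
    gcongr
    exact trap_mono h a b z

theorem lemmaA {k : ℝ} (hk : k ∈ Ioo (0:ℝ) 1) {F G : ℝ → ℝ≥0∞} (hF : Measurable F)
    (hG : Measurable G) (hFi : ∫⁻ z, pw k z * F z ∂nu ≠ ⊤) (hGi : ∫⁻ z, pw k z * G z ∂nu ≠ ⊤)
    (h : ∀ (n : ℕ) (a b : ℝ), 0 ≤ a → ∫⁻ z, ENNReal.ofReal (trap n a b z) * F z ∂nu =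
      ∫⁻ z, ENNReal.ofReal (trap n a b z) * G z ∂nu) : F =ᵐ[nu] G := by
  have hfin : ∀ F : ℝ → ℝ≥0∞, Measurable F → ∫⁻ z, pw k z * F z ∂nu ≠ ⊤ → ∀ e : ℝ, 0 < e →
      ∫⁻ z in Ioi e, F z ≠ ⊤ := by
    intro F hF hFi e he
    have hpe : pw k e ≠ 0 := by
      unfold pw; simp; positivity
    have : pw k e * ∫⁻ z in Ioi e, F z ≤ ∫⁻ z, pw k z * F z ∂nu := by
      rw [← lintegral_const_mul _ hF]
      calc ∫⁻ z in Ioi e, pw k e * F z ≤ ∫⁻ z in Ioi e, pw k z * F z := by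
            apply setLIntegral_mono' measurableSet_Ioi
            intro z hz
            unfold pw
            gcongr
            · exact hk.1.le
            · exact le_of_lt hz
        _ ≤ _ := lintegral_mono_set (Ioi_subset_Ioi he.le)
    intro hc
    rw [hc, ENNReal.mul_top hpe, top_le_iff] at this
    exact hFi this
  have key : ∀ e : ℝ, 0 < e → F =ᵐ[volume.restrict (Ioi e)] G := by
    intro e he
    apply ae_eq_of_rat hF.aemeasurable hG.aemeasurable (hfin F hF hFi e he)
      (hfin G hG hGi e he)
    intro p q
    have : Ioo (p:ℝ) q ∩ Ioi e = Ioo (max (p:ℝ) e) q ∩ Ioi 0 := by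
      ext z
      simp only [mem_inter_iff, mem_Ioo, mem_Ioi, max_lt_iff]
      constructor
      · rintro ⟨⟨h1, h2⟩, h3⟩; exact ⟨⟨⟨h1, h3⟩, h2⟩, he.trans h3⟩
      · rintro ⟨⟨⟨h1, h3⟩, h2⟩, _⟩; exact ⟨⟨h1, h2⟩, h3⟩
    rw [this, lint_trap_sup hF, lint_trap_sup hG]
    congr 1
    ext n
    exact h n _ _ (he.le.trans (le_max_right _ _))
  have hu : Ioi (0:ℝ) = ⋃ n : ℕ, Ioi (1 / ((n:ℝ) + 1)) := by
    ext z
    simp only [mem_Ioi, mem_iUnion]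
    constructor
    · intro hz; exact exists_nat_one_div_lt hz
    · rintro ⟨n, hn⟩; exact lt_trans (by positivity) hn
  unfold nu
  rw [hu]
  show ∀ᵐ z ∂_, F z = G z
  rw [ae_restrict_iUnion_iff]
  intro n
  exact key _ (by positivity)

end

open MeasureTheory Set Filter
open scoped ENNReal

noncomputable section

abbrev nu2 : Measure (ℝ × ℝ) := nu.prod nu

/-- gain bilinear form -/
def Qg (b : ℝ → ℝ → ℝ → ℝ≥0∞) (P : ℝ → ℝ → ℝ≥0∞) (f g : ℝ → ℝ≥0∞) (z : ℝ) : ℝ≥0∞ :=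
  2⁻¹ * ∫⁻ q, b z q.1 q.2 * (P q.1 q.2 * (f q.1 * g q.2)) ∂nu2

/-- loss potential -/
def Al (P : ℝ → ℝ → ℝ≥0∞) (g : ℝ → ℝ≥0∞) (z : ℝ) : ℝ≥0∞ := ∫⁻ y, P z y * g y ∂nu

structure PProp (P : ℝ → ℝ → ℝ≥0∞) : Prop where
  meas : Measurable fun q : ℝ × ℝ => P q.1 q.2
  symm : ∀ x y, P x y = P y x

variable {k E : ℝ} {b : ℝ → ℝ → ℝ → ℝ≥0∞} {P : ℝ → ℝ → ℝ≥0∞}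

theorem PP_meas (hP : PProp P) {f g : ℝ → ℝ≥0∞} (hf : Measurable f) (hg : Measurable g) :
    Measurable fun q : ℝ × ℝ => P q.1 q.2 * (f q.1 * g q.2) :=
  hP.meas.mul ((hf.comp measurable_fst).mul (hg.comp measurable_snd))

theorem b_meas_xy (hb : KerProp k E b) (z : ℝ) : Measurable fun q : ℝ × ℝ => b z q.1 q.2 :=
  hb.meas.comp ((measurable_const (a := z)).prodMk measurable_id)

theorem b_meas_z (hb : KerProp k E b) (x y : ℝ) : Measurable fun z => b z x y :=
  hb.meas.comp (measurable_id.prodMk (measurable_const (a := (x, y))))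

/-- joint measurability with parameter -/
theorem Qg_meas (hb : KerProp k E b) (hP : PProp P) {U V : ℝ → ℝ → ℝ≥0∞}
    (hU : Measurable fun q : ℝ × ℝ => U q.1 q.2) (hV : Measurable fun q : ℝ × ℝ => V q.1 q.2) :
    Measurable fun q : ℝ × ℝ => Qg b P (U q.1) (V q.1) q.2 := by
  unfold Qg
  refine Measurable.const_mul ?_ _
  apply Measurable.lintegral_prod_right' (f := fun (w : (ℝ × ℝ) × (ℝ × ℝ)) =>
    b w.1.2 w.2.1 w.2.2 * (P w.2.1 w.2.2 * (U w.1.1 w.2.1 * V w.1.1 w.2.2)))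
  have h1 : Measurable fun w : (ℝ × ℝ) × (ℝ × ℝ) => b w.1.2 w.2.1 w.2.2 :=
    hb.meas.comp ((measurable_snd.comp measurable_fst).prodMk measurable_snd)
  have h2 : Measurable fun w : (ℝ × ℝ) × (ℝ × ℝ) => P w.2.1 w.2.2 := hP.meas.comp measurable_snd
  have h3 : Measurable fun w : (ℝ × ℝ) × (ℝ × ℝ) => U w.1.1 w.2.1 :=
    hU.comp ((measurable_fst.comp measurable_fst).prodMk (measurable_fst.comp measurable_snd))
  have h4 : Measurable fun w : (ℝ × ℝ) × (ℝ × ℝ) => V w.1.1 w.2.2 :=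
    hV.comp ((measurable_fst.comp measurable_fst).prodMk (measurable_snd.comp measurable_snd))
  exact h1.mul (h2.mul (h3.mul h4))

theorem Al_meas (hP : PProp P) {U : ℝ → ℝ → ℝ≥0∞}
    (hU : Measurable fun q : ℝ × ℝ => U q.1 q.2) :
    Measurable fun q : ℝ × ℝ => Al P (U q.1) q.2 := by
  unfold Al
  apply Measurable.lintegral_prod_right' (f := fun (w : (ℝ × ℝ) × ℝ) =>
    P w.1.2 w.2 * U w.1.1 w.2)
  have h2 : Measurable fun w : (ℝ × ℝ) × ℝ => P w.1.2 w.2 :=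
    hP.meas.comp ((measurable_snd.comp measurable_fst).prodMk measurable_snd)
  have h3 : Measurable fun w : (ℝ × ℝ) × ℝ => U w.1.1 w.2 :=
    hU.comp ((measurable_fst.comp measurable_fst).prodMk measurable_snd)
  exact h2.mul h3

theorem Qg_meas1 (hb : KerProp k E b) (hP : PProp P) {f g : ℝ → ℝ≥0∞} (hf : Measurable f)
    (hg : Measurable g) : Measurable (Qg b P f g) :=
  (Qg_meas hb hP (U := fun _ => f) (V := fun _ => g) (hf.comp measurable_snd)
    (hg.comp measurable_snd)).comp ((measurable_const (a := (0:ℝ))).prodMk measurable_id)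

theorem Al_meas1 (hP : PProp P) {f : ℝ → ℝ≥0∞} (hf : Measurable f) : Measurable (Al P f) :=
  (Al_meas hP (U := fun _ => f) (hf.comp measurable_snd)).comp
    ((measurable_const (a := (0:ℝ))).prodMk measurable_id)

theorem Qg_symm (hb : KerProp k E b) (hP : PProp P) (f g : ℝ → ℝ≥0∞) (z : ℝ) :
    Qg b P f g z = Qg b P g f z := by
  unfold Qg
  congr 1
  rw [← lintegral_prod_swap]
  congr 1
  ext q
  simp only [Prod.fst_swap, Prod.snd_swap]
  rw [hb.symm, hP.symm, mul_comm (f q.2)]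

theorem gain_test (hb : KerProp k E b) (hP : PProp P) {s f g : ℝ → ℝ≥0∞} (hs : Measurable s)
    (hf : Measurable f) (hg : Measurable g) :
    ∫⁻ z, s z * Qg b P f g z ∂nu =
      2⁻¹ * ∫⁻ q, (∫⁻ z, s z * b z q.1 q.2 ∂nu) * (P q.1 q.2 * (f q.1 * g q.2)) ∂nu2 := by
  have hH := PP_meas hP hf hg
  have hbm := b_meas_xy hb
  have hbz := b_meas_z hb
  have hbj : Measurable fun w : ℝ × (ℝ × ℝ) => s w.1 * b w.1 w.2.1 w.2.2 :=
    (hs.comp measurable_fst).mul hb.meas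
  unfold Qg
  have e1 : ∀ z, s z * (2⁻¹ * ∫⁻ q, b z q.1 q.2 * (P q.1 q.2 * (f q.1 * g q.2)) ∂nu2) =
      2⁻¹ * ∫⁻ q, s z * b z q.1 q.2 * (P q.1 q.2 * (f q.1 * g q.2)) ∂nu2 := by
    intro z
    rw [mul_left_comm, ← lintegral_const_mul _ (by exact (hbm z).mul hH)]
    simp only [mul_assoc]
  simp only [e1]
  rw [lintegral_const_mul']
  · congr 1
    rw [lintegral_lintegral_swap]
    · congr 1
      ext q
      rw [lintegral_mul_const _ (by exact hs.mul (hbz _ _))]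
    · exact (hbj.mul (hH.comp measurable_snd)).aemeasurable
  · simp

theorem loss_test (hP : PProp P) {s f g : ℝ → ℝ≥0∞} (hs : Measurable s)
    (hf : Measurable f) (hg : Measurable g) :
    ∫⁻ z, s z * (f z * Al P g z) ∂nu =
      ∫⁻ q, s q.1 * (P q.1 q.2 * (f q.1 * g q.2)) ∂nu2 := by
  have hH := PP_meas hP hf hg
  rw [lintegral_prod _ (by exact ((hs.comp measurable_fst).mul hH).aemeasurable)]
  congr 1
  ext z
  unfold Al
  have hPz : Measurable fun y => P z y :=
    hP.meas.comp ((measurable_const (a := z)).prodMk measurable_id)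
  rw [← mul_assoc, ← lintegral_const_mul _ (by exact hPz.mul hg)]
  congr 1
  ext y
  ring

/-- symmetrised loss -/
theorem loss_test2 (hP : PProp P) {s f : ℝ → ℝ≥0∞} (hs : Measurable s)
    (hf : Measurable f) :
    ∫⁻ z, s z * (f z * Al P f z) ∂nu =
      2⁻¹ * ∫⁻ q, (s q.1 + s q.2) * (P q.1 q.2 * (f q.1 * f q.2)) ∂nu2 := by
  have hH := PP_meas hP hf hf
  have h2 : ∫⁻ q, s q.2 * (P q.1 q.2 * (f q.1 * f q.2)) ∂nu2 =
      ∫⁻ q, s q.1 * (P q.1 q.2 * (f q.1 * f q.2)) ∂nu2 := by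
    rw [← lintegral_prod_swap]
    congr 1
    ext q
    simp only [Prod.fst_swap, Prod.snd_swap]
    rw [hP.symm, mul_comm (f q.2)]
  rw [loss_test hP hs hf hf]
  simp only [add_mul]
  rw [lintegral_add_left (by exact (hs.comp measurable_fst).mul hH), h2, ← two_mul, ← mul_assoc,
    ENNReal.inv_mul_cancel (by simp) (by simp), one_mul]

/-- integrating in time -/
theorem time_test {s : ℝ → ℝ≥0∞} (hs : Measurable s) {L : ℝ → ℝ → ℝ≥0∞}
    (hL : Measurable fun q : ℝ × ℝ => L q.1 q.2) (I : Set ℝ) :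
    ∫⁻ z, s z * (∫⁻ τ in I, L τ z) ∂nu = ∫⁻ τ in I, ∫⁻ z, s z * L τ z ∂nu := by
  rw [lintegral_lintegral_swap]
  · congr 1
    ext z
    rw [lintegral_const_mul]
    exact hL.comp (measurable_id.prodMk (measurable_const (a := z)))
  · exact ((hs.comp measurable_snd).mul hL).aemeasurable

theorem time_meas {L : ℝ → ℝ → ℝ≥0∞}
    (hL : Measurable fun q : ℝ × ℝ => L q.1 q.2) (I : Set ℝ) :
    Measurable fun z => ∫⁻ τ in I, L τ z :=
  Measurable.lintegral_prod_right' (f := fun (w : ℝ × ℝ) => L w.2 w.1) (hL.comp measurable_swap)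

end

open MeasureTheory Set Filter
open scoped ENNReal

noncomputable section

def PP (l₁ l₂ x y : ℝ) : ℝ≥0∞ := ENNReal.ofReal (Phi l₁ l₂ x y)

def UU (u : ℝ → ℝ → ℝ) (τ x : ℝ) : ℝ≥0∞ := ENNReal.ofReal (u τ x)

theorem PP_prop (l₁ l₂ : ℝ) : PProp (PP l₁ l₂) := by
  constructor
  · unfold PP Phi; fun_prop
  · intro x y; unfold PP Phi; congr 1; ring

def mu3 (t : ℝ) : Measure (ℝ × ℝ × ℝ) := (volume.restrict (Ioo 0 t)).prod nu2

theorem mu3_eq (t : ℝ) :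
    (volume.restrict (Ioo (0:ℝ) t ×ˢ (Ioi (0:ℝ) ×ˢ Ioi (0:ℝ))) : Measure (ℝ × ℝ × ℝ)) = mu3 t := by
  unfold mu3 nu2 nu
  rw [Measure.prod_restrict, Measure.prod_restrict]
  rfl

theorem mu3_ae (t : ℝ) : ∀ᵐ q ∂mu3 t, q.1 ∈ Ioo 0 t ∧ 0 < q.2.1 ∧ 0 < q.2.2 := by
  rw [← mu3_eq]
  filter_upwards [ae_restrict_mem (measurableSet_Ioo.prod (measurableSet_Ioi.prod measurableSet_Ioi))]
    with q hq
  exact ⟨hq.1, hq.2.1, hq.2.2⟩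

instance (t : ℝ) : SFinite (mu3 t) := by unfold mu3; infer_instance

def HH (l₁ l₂ : ℝ) (u : ℝ → ℝ → ℝ) (q : ℝ × ℝ × ℝ) : ℝ≥0∞ :=
  PP l₁ l₂ q.2.1 q.2.2 * (UU u q.1 q.2.1 * UU u q.1 q.2.2)

def Hr (l₁ l₂ : ℝ) (u : ℝ → ℝ → ℝ) (q : ℝ × ℝ × ℝ) : ℝ :=
  Phi l₁ l₂ q.2.1 q.2.2 * u q.1 q.2.1 * u q.1 q.2.2

theorem Phi_pos (l₁ l₂ : ℝ) {x y : ℝ} (hx : 0 < x) (hy : 0 < y) : 0 < Phi l₁ l₂ x y := by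
  unfold Phi; positivity

section
variable {k l₁ l₂ : ℝ} {bs : ℝ → ℝ → ℝ → ℝ} {uin : ℝ → ℝ} {T : ℝ≥0∞} {u : ℝ → ℝ → ℝ}

theorem UU_meas (h : IsWeakSolution k bs (Phi l₁ l₂) uin T u) :
    Measurable fun q : ℝ × ℝ => UU u q.1 q.2 := ENNReal.measurable_ofReal.comp h.meas

theorem u_meas1 (h : IsWeakSolution k bs (Phi l₁ l₂) uin T u) (t : ℝ) :
    Measurable (u t) := h.meas.comp ((measurable_const (a := t)).prodMk measurable_id)

theorem UU_meas1 (h : IsWeakSolution k bs (Phi l₁ l₂) uin T u) (t : ℝ) :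
    Measurable (UU u t) := ENNReal.measurable_ofReal.comp (u_meas1 h t)

theorem HH_meas (h : IsWeakSolution k bs (Phi l₁ l₂) uin T u) :
    Measurable (HH l₁ l₂ u) :=
  ((PP_prop l₁ l₂).meas.comp measurable_snd).mul
    (((UU_meas h).comp (measurable_fst.prodMk (measurable_fst.comp measurable_snd))).mul
    ((UU_meas h).comp (measurable_fst.prodMk (measurable_snd.comp measurable_snd))))

theorem Hr_meas (h : IsWeakSolution k bs (Phi l₁ l₂) uin T u) :
    Measurable (Hr l₁ l₂ u) := by
  have h1 : Measurable fun q : ℝ × ℝ × ℝ => Phi l₁ l₂ q.2.1 q.2.2 := by unfold Phi; fun_prop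
  exact (h1.mul (h.meas.comp (measurable_fst.prodMk (measurable_fst.comp measurable_snd)))).mul
    (h.meas.comp (measurable_fst.prodMk (measurable_snd.comp measurable_snd)))

theorem lt_T {t s : ℝ} (ht : ENNReal.ofReal t < T) (hs : s ≤ t) : ENNReal.ofReal s < T :=
  (ENNReal.ofReal_le_ofReal hs).trans_lt ht

theorem Hr_ae (h : IsWeakSolution k bs (Phi l₁ l₂) uin T u) {t : ℝ}
    (hT : ENNReal.ofReal t < T) :
    ∀ᵐ q ∂mu3 t, 0 < q.2.1 ∧ 0 < q.2.2 ∧ 0 ≤ Hr l₁ l₂ u q ∧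
      ENNReal.ofReal (Hr l₁ l₂ u q) = HH l₁ l₂ u q := by
  filter_upwards [mu3_ae t] with q hq
  obtain ⟨⟨h1, h2⟩, hx, hy⟩ := hq
  have hT' := lt_T hT h2.le
  have u1 := h.nonneg q.1 h1.le hT' _ hx
  have u2 := h.nonneg q.1 h1.le hT' _ hy
  have hp := Phi_pos l₁ l₂ hx hy
  refine ⟨hx, hy, ?_, ?_⟩
  · unfold Hr; positivity
  · unfold Hr HH PP UU
    rw [ENNReal.ofReal_mul (by positivity), ENNReal.ofReal_mul hp.le, mul_assoc]

theorem lint_mu3 {f : ℝ × ℝ × ℝ → ℝ≥0∞} (hf : Measurable f) (t : ℝ) :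
    ∫⁻ q, f q ∂mu3 t = ∫⁻ τ in Ioo 0 t, ∫⁻ q, f (τ, q) ∂nu2 := by
  unfold mu3
  rw [lintegral_prod _ hf.aemeasurable]

theorem d_lint3 (h : IsWeakSolution k bs (Phi l₁ l₂) uin T u) {t : ℝ} (ht : 0 < t)
    (hT : ENNReal.ofReal t < T) :
    ∫⁻ q, (pw k q.2.1 + pw k q.2.2) * HH l₁ l₂ u q ∂mu3 t < ⊤ := by
  have hi := h.integ t ht hT
  unfold IntegrableOn at hi
  rw [mu3_eq] at hi
  have hn : ∀ᵐ q ∂mu3 t, 0 ≤ (q.2.1 ^ k + q.2.2 ^ k) * Phi l₁ l₂ q.2.1 q.2.2 * u q.1 q.2.1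
      * u q.1 q.2.2 := by
    filter_upwards [Hr_ae h hT] with q hq
    obtain ⟨hx, hy, h0, -⟩ := hq
    have : 0 ≤ (q.2.1 ^ k + q.2.2 ^ k) := by positivity
    have := mul_nonneg this h0
    unfold Hr at this
    calc (0:ℝ) ≤ _ := this
      _ = _ := by ring
  have := (hasFiniteIntegral_iff_ofReal hn).1 hi.2
  refine lt_of_le_of_lt (le_of_eq ?_) this
  apply lintegral_congr_ae
  filter_upwards [Hr_ae h hT] with q hq
  obtain ⟨hx, hy, h0, e⟩ := hq
  rw [← e]
  unfold pw
  rw [← ENNReal.ofReal_add (by positivity) (by positivity), ← ENNReal.ofReal_mul (by positivity)]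
  congr 1
  unfold Hr
  ring

theorem d_lint (h : IsWeakSolution k bs (Phi l₁ l₂) uin T u) {t : ℝ} (ht : 0 < t)
    (hT : ENNReal.ofReal t < T) :
    ∫⁻ τ in Ioo 0 t, ∫⁻ q, (pw k q.1 + pw k q.2) *
      (PP l₁ l₂ q.1 q.2 * (UU u τ q.1 * UU u τ q.2)) ∂nu2 < ⊤ := by
  have := d_lint3 h ht hT
  rw [lint_mu3] at this
  · exact this
  · have hp := pw_meas k
    have := HH_meas h
    fun_prop

theorem B0 (h : IsWeakSolution k bs (Phi l₁ l₂) uin T u) {t : ℝ} (ht : 0 < t)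
    (hT : ENNReal.ofReal t < T) {c : ℝ × ℝ → ℝ≥0∞} (hc : Measurable c) {C : ℝ}
    (hcC : ∀ x y, 0 < x → 0 < y → c (x, y) ≤ ENNReal.ofReal C * (pw k x + pw k y)) :
    Integrable (fun q => (c q.2).toReal * Hr l₁ l₂ u q) (mu3 t) ∧
    ∫ q, (c q.2).toReal * Hr l₁ l₂ u q ∂mu3 t = (∫⁻ q, c q.2 * HH l₁ l₂ u q ∂mu3 t).toReal ∧
    ∫⁻ q, c q.2 * HH l₁ l₂ u q ∂mu3 t ≠ ⊤ := by
  have hHr := Hr_meas h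
  have hHH := HH_meas h
  have hp := pw_meas k
  have hm : Measurable (fun q : ℝ × ℝ × ℝ => (c q.2).toReal * Hr l₁ l₂ u q) := by fun_prop
  have hn : ∀ᵐ q ∂mu3 t, 0 ≤ (c q.2).toReal * Hr l₁ l₂ u q := by
    filter_upwards [Hr_ae h hT] with q hq
    exact mul_nonneg ENNReal.toReal_nonneg hq.2.2.1
  have he : ∫⁻ q, ENNReal.ofReal ((c q.2).toReal * Hr l₁ l₂ u q) ∂mu3 t =
      ∫⁻ q, c q.2 * HH l₁ l₂ u q ∂mu3 t := by
    apply lintegral_congr_ae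
    filter_upwards [Hr_ae h hT] with q hq
    rw [ENNReal.ofReal_mul ENNReal.toReal_nonneg, hq.2.2.2, ENNReal.ofReal_toReal]
    refine ne_top_of_le_ne_top ?_ (hcC q.2.1 q.2.2 hq.1 hq.2.1)
    exact ENNReal.mul_ne_top (by simp) (by simp [pw])
  have hfin : ∫⁻ q, c q.2 * HH l₁ l₂ u q ∂mu3 t ≠ ⊤ := by
    refine ne_top_of_le_ne_top (b := ∫⁻ q, ENNReal.ofReal C * ((pw k q.2.1 + pw k q.2.2) *
      HH l₁ l₂ u q) ∂mu3 t) ?_ ?_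
    · rw [lintegral_const_mul _ (by fun_prop)]
      exact ENNReal.mul_ne_top (by simp) (d_lint3 h ht hT).ne
    · apply lintegral_mono_ae
      filter_upwards [mu3_ae t] with q hq
      rw [← mul_assoc]
      gcongr
      exact hcC q.2.1 q.2.2 hq.2.1 hq.2.2
  refine ⟨⟨hm.aestronglyMeasurable, ?_⟩, ?_, hfin⟩
  · rw [hasFiniteIntegral_iff_ofReal hn, he]; exact hfin.lt_top
  · rw [integral_eq_lintegral_of_nonneg_ae hn hm.aestronglyMeasurable, he]

theorem weak_form (hk : k ∈ Ioo (0:ℝ) 1) (hβ : FragKernel k bs) {E : ℝ}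
    (hb : KerProp k E (be k bs))
    (h : IsWeakSolution k bs (Phi l₁ l₂) uin T u) {t : ℝ} (ht : 0 < t)
    (hT : ENNReal.ofReal t < T) {s : ℝ → ℝ} (hsm : Measurable s)
    (hs0 : ∀ z, 0 < z → s0 k z ≤ s z) {C : ℝ} (hC : 0 ≤ C) (hsC : ∀ z, 0 < z → s z ≤ C * z ^ k)
    (hz : HolderZero k s) (hbd : BddOnNonneg s) :
    ∫ x in Ioi (0:ℝ), s x * u t x = (∫ x in Ioi (0:ℝ), s x * uin x) + (1/2) *
      ((∫⁻ q, Theta (be k bs) s q.2.1 q.2.2 * HH l₁ l₂ u q ∂mu3 t).toReal -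
       (∫⁻ q, (ENNReal.ofReal (s q.2.1) + ENNReal.ofReal (s q.2.2)) * HH l₁ l₂ u q ∂mu3 t).toReal) := by
  rw [h.weak t ht hT s hz hbd]
  congr 2
  obtain ⟨i1, e1, -⟩ := B0 h ht hT (c := fun q => Theta (be k bs) s q.1 q.2) (Theta_meas hb hsm)
    (C := C * E) (fun x y hx hy => Theta_le hb hC hsC hx hy)
  obtain ⟨i2, e2, -⟩ := B0 h ht hT (c := fun q => ENNReal.ofReal (s q.1) + ENNReal.ofReal (s q.2))
    (by fun_prop) (C := C) (fun x y hx hy => by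
      unfold pw
      rw [mul_add, ← ENNReal.ofReal_mul hC, ← ENNReal.ofReal_mul hC]
      gcongr
      · exact hsC x hx
      · exact hsC y hy)
  rw [← e1, ← e2, ← integral_sub i1 i2]
  have hae : ∀ᵐ q ∂mu3 t, (Theta (be k bs) s q.2.1 q.2.2).toReal * Hr l₁ l₂ u q -
      (ENNReal.ofReal (s q.2.1) + ENNReal.ofReal (s q.2.2)).toReal * Hr l₁ l₂ u q =
      Upsilon bs s q.2.1 q.2.2 * Phi l₁ l₂ q.2.1 q.2.2 * u q.1 q.2.1 * u q.1 q.2.2 := by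
    filter_upwards [mu3_ae t] with q hq
    have hx := hq.2.1
    have hy := hq.2.2
    have n1 := (s0_nonneg k q.2.1).trans (hs0 _ hx)
    have n2 := (s0_nonneg k q.2.2).trans (hs0 _ hy)
    rw [Ups_form hk hβ hsm hs0 hx hy, ENNReal.toReal_add (by simp) (by simp),
      ENNReal.toReal_ofReal n1, ENNReal.toReal_ofReal n2]
    unfold Hr
    ring
  have hIntg := (i1.sub i2).congr hae
  rw [integral_congr_ae hae]
  unfold mu3 at hIntg ⊢
  rw [integral_prod _ hIntg]
  apply integral_congr_ae
  filter_upwards [hIntg.prod_right_ae] with τ hτ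
  rw [integral_prod _ hτ]

end
end

open MeasureTheory Set Filter
open scoped ENNReal

noncomputable section

/-- gain and loss along a solution -/
def gn (k : ℝ) (bs : ℝ → ℝ → ℝ → ℝ) (l₁ l₂ : ℝ) (u : ℝ → ℝ → ℝ) (τ z : ℝ) : ℝ≥0∞ :=
  Qg (be k bs) (PP l₁ l₂) (UU u τ) (UU u τ) z

def ls (l₁ l₂ : ℝ) (u : ℝ → ℝ → ℝ) (τ z : ℝ) : ℝ≥0∞ := UU u τ z * Al (PP l₁ l₂) (UU u τ) z

open Classical in
/-- the solution at good times, zero otherwise -/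
def Vt (k : ℝ) (u : ℝ → ℝ → ℝ) (t : ℝ) : ℝ → ℝ≥0∞ := if MemXk k (u t) then UU u t else 0

section
variable {k l₁ l₂ : ℝ} {bs : ℝ → ℝ → ℝ → ℝ} {uin : ℝ → ℝ} {T : ℝ≥0∞} {u : ℝ → ℝ → ℝ}

theorem gn_meas {E : ℝ} (hb : KerProp k E (be k bs))
    (h : IsWeakSolution k bs (Phi l₁ l₂) uin T u) :
    Measurable fun q : ℝ × ℝ => gn k bs l₁ l₂ u q.1 q.2 :=
  Qg_meas hb (PP_prop l₁ l₂) (UU_meas h) (UU_meas h)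

theorem ls_meas (h : IsWeakSolution k bs (Phi l₁ l₂) uin T u) :
    Measurable fun q : ℝ × ℝ => ls l₁ l₂ u q.1 q.2 :=
  (UU_meas h).mul (Al_meas (PP_prop l₁ l₂) (UU_meas h))

theorem gn_time {E : ℝ} (hb : KerProp k E (be k bs))
    (h : IsWeakSolution k bs (Phi l₁ l₂) uin T u) {s : ℝ → ℝ≥0∞} (hs : Measurable s) (I : Set ℝ) :
    ∫⁻ z, s z * (∫⁻ τ in I, gn k bs l₁ l₂ u τ z) ∂nu =
      2⁻¹ * ∫⁻ τ in I, ∫⁻ q, (∫⁻ z, s z * be k bs z q.1 q.2 ∂nu) *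
        (PP l₁ l₂ q.1 q.2 * (UU u τ q.1 * UU u τ q.2)) ∂nu2 := by
  rw [time_test hs (gn_meas hb h), ← lintegral_const_mul' _ _ (by simp)]
  congr 1
  ext τ
  exact gain_test hb (PP_prop l₁ l₂) hs (UU_meas1 h τ) (UU_meas1 h τ)

theorem ls_time 
    (h : IsWeakSolution k bs (Phi l₁ l₂) uin T u) {s : ℝ → ℝ≥0∞} (hs : Measurable s) (I : Set ℝ) :
    ∫⁻ z, s z * (∫⁻ τ in I, ls l₁ l₂ u τ z) ∂nu =
      2⁻¹ * ∫⁻ τ in I, ∫⁻ q, (s q.1 + s q.2) *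
        (PP l₁ l₂ q.1 q.2 * (UU u τ q.1 * UU u τ q.2)) ∂nu2 := by
  rw [time_test hs (ls_meas h), ← lintegral_const_mul' _ _ (by simp)]
  congr 1
  ext τ
  exact loss_test2 (PP_prop l₁ l₂) hs (UU_meas1 h τ)

/-- `φ u(t)` is integrable for functions bounded by the identity. -/
theorem phi_int (h : IsWeakSolution k bs (Phi l₁ l₂) uin T u) {t : ℝ} (ht : 0 ≤ t)
    (hT : ENNReal.ofReal t < T) {φ : ℝ → ℝ} (hφ : Measurable φ) (h0 : ∀ z, 0 ≤ φ z) {C : ℝ}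
    (hC : 0 ≤ C) (h1 : ∀ z, 0 < z → φ z ≤ C * z) : Integrable (fun x => φ x * u t x) nu := by
  obtain ⟨D, hD⟩ := h.massBdd
  have hu := u_meas1 h t
  refine ⟨by fun_prop, ?_⟩
  rw [hasFiniteIntegral_iff_ofReal]
  · calc ∫⁻ x, ENNReal.ofReal (φ x * u t x) ∂nu ≤
        ∫⁻ x, ENNReal.ofReal C * ENNReal.ofReal (x * u t x) ∂nu := by
          apply setLIntegral_mono' measurableSet_Ioi
          intro z hz
          rw [← ENNReal.ofReal_mul hC, ← mul_assoc]
          have := h.nonneg t ht hT z hz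
          gcongr
          exact h1 z hz
      _ < ⊤ := by
          rw [lintegral_const_mul _ (by fun_prop)]
          exact ENNReal.mul_lt_top (by simp) ((hD t ht hT).trans_lt (by simp))
  · filter_upwards [ae_restrict_mem measurableSet_Ioi] with z hz
    exact mul_nonneg (h0 z) (h.nonneg t ht hT z hz)

theorem lhs_diff (hk : k ∈ Ioo (0:ℝ) 1)
    (h : IsWeakSolution k bs (Phi l₁ l₂) uin T u) {t : ℝ} (ht : 0 ≤ t)
    (hT : ENNReal.ofReal t < T) {φ : ℝ → ℝ} (hφ : Measurable φ) (h0 : ∀ z, 0 ≤ φ z) {C : ℝ}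
    (hC : 0 ≤ C) (h1 : ∀ z, 0 < z → φ z ≤ C * z) :
    (∫ x in Ioi (0:ℝ), (s0 k x + φ x) * u t x) - (∫ x in Ioi (0:ℝ), s0 k x * u t x) =
      (∫⁻ z, ENNReal.ofReal (φ z) * Vt k u t z ∂nu).toReal ∧
      ∫⁻ z, ENNReal.ofReal (φ z) * Vt k u t z ∂nu ≠ ⊤ := by
  have hi := phi_int h ht hT hφ h0 hC h1
  have hu := u_meas1 h t
  have hs := s0_meas k
  have hnn : ∀ᵐ z ∂nu, 0 ≤ φ z * u t z := by
    filter_upwards [ae_restrict_mem measurableSet_Ioi] with z hz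
    exact mul_nonneg (h0 z) (h.nonneg t ht hT z hz)
  have he : ∫⁻ z, ENNReal.ofReal (φ z * u t z) ∂nu =
      ∫⁻ z, ENNReal.ofReal (φ z) * UU u t z ∂nu := by
    congr 1; ext z; exact ENNReal.ofReal_mul (h0 z)
  have hiff : Integrable (fun x => s0 k x * u t x) nu ↔ MemXk k (u t) := by
    constructor
    · intro hh
      have hid := phi_int h ht hT (φ := fun z => |z|) (by fun_prop) (fun z => abs_nonneg z)
        zero_le_one (fun z hz => by rw [one_mul, abs_of_pos hz])
      refine (hh.add hid).mono' (by fun_prop) ?_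
      filter_upwards [ae_restrict_mem measurableSet_Ioi] with z hz
      have hz : 0 < z := hz
      have hun := h.nonneg t ht hT z hz
      rw [Real.norm_of_nonneg (by positivity)]
      simp only [Pi.add_apply, ← add_mul]
      gcongr
      rw [abs_of_pos hz]
      unfold s0
      rw [max_eq_left hz.le]
      rcases le_total z 1 with h1 | h1
      · rw [min_eq_left h1]; linarith
      · rw [min_eq_right h1]
        have := Real.rpow_le_rpow_of_exponent_le h1 hk.2.le
        rw [Real.rpow_one] at this
        have : (0:ℝ) ≤ 1 ^ k := by positivity
        linarith
    · intro hh
      refine Integrable.mono' hh (by fun_prop) ?_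
      filter_upwards [ae_restrict_mem measurableSet_Ioi] with z hz
      have hz : 0 < z := hz
      have hun := h.nonneg t ht hT z hz
      have := s0_nonneg k z
      rw [Real.norm_of_nonneg (by positivity)]
      gcongr
      exact s0_le_pow hk hz
  by_cases hg : MemXk k (u t)
  · have hs0i := hiff.2 hg
    simp only [Vt, if_pos hg]
    rw [← he]
    refine ⟨?_, ?_⟩
    · simp only [add_mul]
      rw [integral_add hs0i hi, add_sub_cancel_left,
        integral_eq_lintegral_of_nonneg_ae hnn (by fun_prop)]
    · exact ((hasFiniteIntegral_iff_ofReal hnn).1 hi.2).ne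
  · simp only [Vt, if_neg hg]
    rw [integral_undef (f := fun x => s0 k x * u t x) (fun hc => hg (hiff.1 hc)), integral_undef]
    · simp
    · intro hc
      apply hg
      rw [← hiff]
      refine (hc.sub hi).congr (ae_of_all _ fun z => ?_)
      simp only [Pi.sub_apply]
      ring

theorem in_diff (hk : k ∈ Ioo (0:ℝ) 1) (hin : Measurable uin) (hnn : ∀ x, 0 ≤ uin x)
    (hX : MemXk k uin) {φ : ℝ → ℝ} (hφ : Measurable φ) (h0 : ∀ z, 0 ≤ φ z) {C : ℝ}
    (h1 : ∀ z, 0 < z → φ z ≤ C * z ^ k) :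
    (∫ x in Ioi (0:ℝ), (s0 k x + φ x) * uin x) - (∫ x in Ioi (0:ℝ), s0 k x * uin x) =
      (∫⁻ z, ENNReal.ofReal (φ z) * ENNReal.ofReal (uin z) ∂nu).toReal ∧
      ∫⁻ z, ENNReal.ofReal (φ z) * ENNReal.ofReal (uin z) ∂nu ≠ ⊤ := by
  have hs := s0_meas k
  have hi : Integrable (fun x => φ x * uin x) nu := by
    refine Integrable.mono' (hX.const_mul C) (by fun_prop) ?_
    filter_upwards [ae_restrict_mem measurableSet_Ioi] with z hz
    rw [Real.norm_of_nonneg (mul_nonneg (h0 z) (hnn z)), ← mul_assoc]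
    exact mul_le_mul_of_nonneg_right (h1 z hz) (hnn z)
  have hi0 : Integrable (fun x => s0 k x * uin x) nu := by
    refine Integrable.mono' hX (by fun_prop) ?_
    filter_upwards [ae_restrict_mem measurableSet_Ioi] with z hz
    rw [Real.norm_of_nonneg (mul_nonneg (s0_nonneg k z) (hnn z))]
    exact mul_le_mul_of_nonneg_right (s0_le_pow hk hz) (hnn z)
  have hn : ∀ᵐ z ∂nu, 0 ≤ φ z * uin z := ae_of_all _ fun z => mul_nonneg (h0 z) (hnn z)
  have he : ∫⁻ z, ENNReal.ofReal (φ z * uin z) ∂nu =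
      ∫⁻ z, ENNReal.ofReal (φ z) * ENNReal.ofReal (uin z) ∂nu := by
    congr 1; ext z; exact ENNReal.ofReal_mul (h0 z)
  rw [← he]
  refine ⟨?_, ?_⟩
  · simp only [add_mul]
    rw [integral_add hi0 hi, add_sub_cancel_left,
      integral_eq_lintegral_of_nonneg_ae hn (by fun_prop)]
  · exact ((hasFiniteIntegral_iff_ofReal hn).1 hi.2).ne

theorem trap_ident (hk : k ∈ Ioo (0:ℝ) 1) (hβ : FragKernel k bs) {E : ℝ}
    (hb : KerProp k E (be k bs)) (hin : Measurable uin) (hnn : ∀ x, 0 ≤ uin x)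
    (hX : MemXk k uin)
    (h : IsWeakSolution k bs (Phi l₁ l₂) uin T u) {t : ℝ} (ht : 0 < t)
    (hT : ENNReal.ofReal t < T) (n : ℕ) {a b : ℝ} (ha : 0 ≤ a) :
    ∫⁻ z, ENNReal.ofReal (trap n a b z) * Vt k u t z ∂nu +
      2⁻¹ * ∫⁻ q, (ENNReal.ofReal (trap n a b q.2.1) + ENNReal.ofReal (trap n a b q.2.2)) *
        HH l₁ l₂ u q ∂mu3 t =
    ∫⁻ z, ENNReal.ofReal (trap n a b z) * ENNReal.ofReal (uin z) ∂nu +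
      2⁻¹ * ∫⁻ q, Theta (be k bs) (trap n a b) q.2.1 q.2.2 * HH l₁ l₂ u q ∂mu3 t := by
  set φ := trap n a b with hφ
  have hφm : Measurable φ := trap_meas n a b
  have hφ0 : ∀ z, 0 ≤ φ z := trap_nonneg n a b
  have hφk : ∀ z, 0 < z → φ z ≤ (n + 1) * z ^ k := fun z hz => trap_le_pow hk ha hz
  have hn1 : (0:ℝ) ≤ n + 1 := by positivity
  have hs := s0_meas k
  have hHH := HH_meas h
  obtain ⟨eL, fL⟩ := lhs_diff hk h ht.le hT hφm hφ0 n.cast_nonneg (fun z hz => trap_le_id ha hz)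
  obtain ⟨eI, fI⟩ := in_diff hk hin hnn hX hφm hφ0 hφk
  have w1 := weak_form hk hβ hb h ht hT (s := fun z => s0 k z + φ z) (by fun_prop)
    (fun z _ => by linarith [hφ0 z]) (C := 1 + (n + 1)) (by positivity)
    (fun z hz => by linarith [hφk z hz, s0_le_pow hk hz]) (hz_s1 hk n ha) (bd_s1 hk n)
  have w0 := weak_form hk hβ hb h ht hT (s := s0 k) hs
    (fun z _ => le_rfl) (C := 1) zero_le_one
    (fun z hz => by linarith [s0_le_pow hk hz]) (hz_s0 hk) (bd_s0 hk)
  -- split the two lintegrals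
  have b1 := (B0 h ht hT (c := fun q => Theta (be k bs) φ q.1 q.2) (Theta_meas hb hφm)
    (C := (n + 1) * E) (fun x y hx hy => Theta_le hb hn1 hφk hx hy)).2.2
  have b2 := (B0 h ht hT (c := fun q => Theta (be k bs) (s0 k) q.1 q.2) (Theta_meas hb hs)
    (C := 1 * E) (fun x y hx hy => Theta_le hb zero_le_one
      (fun z hz => by linarith [s0_le_pow hk hz]) hx hy)).2.2
  have b3 := (B0 h ht hT (c := fun q => ENNReal.ofReal (φ q.1) + ENNReal.ofReal (φ q.2))
    (by fun_prop) (C := n + 1) (fun x y hx hy => by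
      unfold pw
      rw [mul_add, ← ENNReal.ofReal_mul hn1, ← ENNReal.ofReal_mul hn1]
      gcongr
      · exact hφk x hx
      · exact hφk y hy)).2.2
  have b4 := (B0 h ht hT (c := fun q => ENNReal.ofReal (s0 k q.1) + ENNReal.ofReal (s0 k q.2))
    (by fun_prop) (C := 1) (fun x y hx hy => by
      unfold pw
      rw [ENNReal.ofReal_one, one_mul]
      gcongr
      · exact s0_le_pow hk hx
      · exact s0_le_pow hk hy)).2.2
  have t1 : ∫⁻ q, Theta (be k bs) (fun z => s0 k z + φ z) q.2.1 q.2.2 * HH l₁ l₂ u q ∂mu3 t =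
      ∫⁻ q, Theta (be k bs) (s0 k) q.2.1 q.2.2 * HH l₁ l₂ u q ∂mu3 t +
      ∫⁻ q, Theta (be k bs) φ q.2.1 q.2.2 * HH l₁ l₂ u q ∂mu3 t := by
    rw [← lintegral_add_left (by exact ((Theta_meas hb hs).comp measurable_snd).mul hHH)]
    congr 1
    ext q
    rw [← add_mul]
    congr 1
    unfold Theta
    have := b_meas_z hb q.2.1 q.2.2
    rw [← lintegral_add_left (by fun_prop)]
    congr 1
    ext z
    rw [← add_mul, ENNReal.ofReal_add (s0_nonneg k z) (hφ0 z)]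
  have t2 : ∫⁻ q, (ENNReal.ofReal (s0 k q.2.1 + φ q.2.1) + ENNReal.ofReal (s0 k q.2.2 + φ q.2.2)) *
        HH l₁ l₂ u q ∂mu3 t =
      ∫⁻ q, (ENNReal.ofReal (s0 k q.2.1) + ENNReal.ofReal (s0 k q.2.2)) * HH l₁ l₂ u q ∂mu3 t +
      ∫⁻ q, (ENNReal.ofReal (φ q.2.1) + ENNReal.ofReal (φ q.2.2)) * HH l₁ l₂ u q ∂mu3 t := by
    rw [← lintegral_add_left (by fun_prop)]
    congr 1
    ext q
    rw [← add_mul, ENNReal.ofReal_add (s0_nonneg k _) (hφ0 _),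
      ENNReal.ofReal_add (s0_nonneg k _) (hφ0 _)]
    congr 1
    ring
  rw [t1, t2, ENNReal.toReal_add b2 b1, ENNReal.toReal_add b4 b3] at w1
  have h2 : (2⁻¹ : ℝ≥0∞) ≠ ⊤ := by simp
  rw [← ENNReal.toReal_eq_toReal_iff' (ENNReal.add_ne_top.2 ⟨fL, ENNReal.mul_ne_top h2 b3⟩)
    (ENNReal.add_ne_top.2 ⟨fI, ENNReal.mul_ne_top h2 b1⟩),
    ENNReal.toReal_add fL (ENNReal.mul_ne_top h2 b3),
    ENNReal.toReal_add fI (ENNReal.mul_ne_top h2 b1), ENNReal.toReal_mul, ENNReal.toReal_mul,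
    ENNReal.toReal_inv, ENNReal.toReal_ofNat]
  linarith

end
end

open MeasureTheory Set Filter
open scoped ENNReal

noncomputable section
section
variable {k l₁ l₂ : ℝ} {bs : ℝ → ℝ → ℝ → ℝ} {uin : ℝ → ℝ} {T : ℝ≥0∞} {u : ℝ → ℝ → ℝ}

theorem nu2_ae : ∀ᵐ q ∂nu2, 0 < q.1 ∧ 0 < q.2 := by
  unfold nu2 nu
  rw [Measure.prod_restrict]
  filter_upwards [ae_restrict_mem (measurableSet_Ioi.prod measurableSet_Ioi)] with q hq
  exact ⟨hq.1, hq.2⟩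

theorem gn_fin {E : ℝ} (hb : KerProp k E (be k bs))
    (h : IsWeakSolution k bs (Phi l₁ l₂) uin T u) {t : ℝ} (ht : 0 < t)
    (hT : ENNReal.ofReal t < T) :
    ∫⁻ z, pw k z * (∫⁻ τ in Ioo 0 t, gn k bs l₁ l₂ u τ z) ∂nu ≠ ⊤ := by
  rw [gn_time hb h (pw_meas k)]
  refine ENNReal.mul_ne_top (by simp) ?_
  refine ne_top_of_le_ne_top (ENNReal.mul_ne_top (a := ENNReal.ofReal E) (by simp)
    (d_lint h ht hT).ne) ?_
  rw [← lintegral_const_mul' _ _ (by simp)]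
  gcongr with τ
  rw [← lintegral_const_mul' _ _ (by simp)]
  apply lintegral_mono_ae
  filter_upwards [nu2_ae] with q hq
  exact le_trans (mul_le_mul' (hb.P1 _ _ hq.1 hq.2) le_rfl) (le_of_eq (mul_assoc _ _ _))

theorem ls_fin (h : IsWeakSolution k bs (Phi l₁ l₂) uin T u) {t : ℝ} (ht : 0 < t)
    (hT : ENNReal.ofReal t < T) :
    ∫⁻ z, pw k z * (∫⁻ τ in Ioo 0 t, ls l₁ l₂ u τ z) ∂nu ≠ ⊤ := by
  rw [ls_time h (pw_meas k)]
  exact ENNReal.mul_ne_top (by simp) (d_lint h ht hT).ne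

theorem pw_lint (u : ℝ → ℝ → ℝ) (t a : ℝ) :
    ∫⁻ z, ENNReal.ofReal (z ^ a * u t z) ∂nu = ∫⁻ z, pw a z * UU u t z ∂nu := by
  apply setLIntegral_congr_fun measurableSet_Ioi
  intro z hz
  exact ENNReal.ofReal_mul (Real.rpow_nonneg (le_of_lt hz) _)

theorem memXk_iff (h : IsWeakSolution k bs (Phi l₁ l₂) uin T u) {t : ℝ} (ht : 0 ≤ t)
    (hT : ENNReal.ofReal t < T) (a : ℝ) : MemXk a (u t) ↔ ∫⁻ z, pw a z * UU u t z ∂nu ≠ ⊤ := by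
  have hu := u_meas1 h t
  have hnn : ∀ᵐ z ∂nu, 0 ≤ z ^ a * u t z := by
    filter_upwards [ae_restrict_mem measurableSet_Ioi] with z hz
    exact mul_nonneg (Real.rpow_nonneg (le_of_lt hz) _) (h.nonneg t ht hT z hz)
  rw [← pw_lint, ← lt_top_iff_ne_top, ← hasFiniteIntegral_iff_ofReal hnn]
  exact ⟨fun h => h.2, fun h => ⟨by fun_prop, h⟩⟩

theorem Vt_meas (h : IsWeakSolution k bs (Phi l₁ l₂) uin T u) (t : ℝ) : Measurable (Vt k u t) := by
  unfold Vt
  split_ifs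
  · exact UU_meas1 h t
  · exact measurable_const

theorem Vt_fin (h : IsWeakSolution k bs (Phi l₁ l₂) uin T u) {t : ℝ} (ht : 0 ≤ t)
    (hT : ENNReal.ofReal t < T) : ∫⁻ z, pw k z * Vt k u t z ∂nu ≠ ⊤ := by
  unfold Vt
  split_ifs with hg
  · exact (memXk_iff h ht hT k).1 hg
  · simp

theorem in_fin {a : ℝ} (hnn : ∀ x, 0 ≤ uin x) (hX : MemXk a uin) :
    ∫⁻ z, pw a z * ENNReal.ofReal (uin z) ∂nu ≠ ⊤ := by
  have hn : ∀ᵐ z ∂nu, 0 ≤ z ^ a * uin z := by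
    filter_upwards [ae_restrict_mem measurableSet_Ioi] with z hz
    exact mul_nonneg (Real.rpow_nonneg (le_of_lt hz) _) (hnn z)
  have h1 := ((hasFiniteIntegral_iff_ofReal hn).1 hX.2).ne
  have : ∫⁻ z, ENNReal.ofReal (z ^ a * uin z) ∂nu = ∫⁻ z, pw a z * ENNReal.ofReal (uin z) ∂nu := by
    apply setLIntegral_congr_fun measurableSet_Ioi
    intro z hz
    exact ENNReal.ofReal_mul (Real.rpow_nonneg (le_of_lt hz) _)
  rwa [← this]

theorem step1 (hk : k ∈ Ioo (0:ℝ) 1) (hβ : FragKernel k bs) {E : ℝ}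
    (hb : KerProp k E (be k bs)) (hin : Measurable uin) (hnn : ∀ x, 0 ≤ uin x)
    (hX : MemXk k uin)
    (h : IsWeakSolution k bs (Phi l₁ l₂) uin T u) {t : ℝ} (ht : 0 < t)
    (hT : ENNReal.ofReal t < T) :
    ∀ᵐ z ∂nu, Vt k u t z + ∫⁻ τ in Ioo 0 t, ls l₁ l₂ u τ z =
      ENNReal.ofReal (uin z) + ∫⁻ τ in Ioo 0 t, gn k bs l₁ l₂ u τ z := by
  have hV := Vt_meas h (k := k) t
  have hp := pw_meas k
  have hl := time_meas (ls_meas h) (Ioo 0 t)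
  have hg := time_meas (gn_meas hb h) (Ioo 0 t)
  have hHH := HH_meas h
  refine lemmaA hk (F := fun z => Vt k u t z + ∫⁻ τ in Ioo 0 t, ls l₁ l₂ u τ z)
    (G := fun z => ENNReal.ofReal (uin z) + ∫⁻ τ in Ioo 0 t, gn k bs l₁ l₂ u τ z)
    (hV.add hl) (hin.ennreal_ofReal.add hg) ?_ ?_ ?_
  · simp only [mul_add]
    rw [lintegral_add_left (by fun_prop)]
    exact ENNReal.add_ne_top.2 ⟨Vt_fin h ht.le hT, ls_fin h ht hT⟩
  · simp only [mul_add]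
    rw [lintegral_add_left (by fun_prop)]
    exact ENNReal.add_ne_top.2 ⟨in_fin hnn hX, gn_fin hb h ht hT⟩
  · intro n a b ha
    have hφ := trap_meas n a b
    simp only [mul_add]
    rw [lintegral_add_left (by fun_prop), lintegral_add_left (by fun_prop),
      ls_time h (s := fun z => ENNReal.ofReal (trap n a b z)) (by fun_prop),
      gn_time hb h (s := fun z => ENNReal.ofReal (trap n a b z)) (by fun_prop)]
    have := trap_ident hk hβ hb hin hnn hX h ht hT n (b := b) ha
    rw [lint_mu3 (by fun_prop), lint_mu3 (by
      exact ((Theta_meas hb hφ).comp measurable_snd).mul hHH)] at this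
    exact this

end
end

open MeasureTheory Set Filter
open scoped ENNReal

noncomputable section

def Mm (a : ℝ) (f : ℝ → ℝ≥0∞) : ℝ≥0∞ := ∫⁻ z, pw a z * f z ∂nu

theorem pw_mul (a b : ℝ) {x : ℝ} (hx : 0 < x) : pw a x * pw b x = pw (a + b) x := by
  unfold pw
  rw [← ENNReal.ofReal_mul (by positivity), Real.rpow_add hx]

theorem pw_pos (a : ℝ) {x : ℝ} (hx : 0 < x) : pw a x ≠ 0 := by
  unfold pw; simp; positivity

theorem pw_fin (a x : ℝ) : pw a x ≠ ⊤ := by simp [pw]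

theorem pw_between {p a q : ℝ} (h1 : p ≤ a) (h2 : a ≤ q) {x : ℝ} (hx : 0 < x) :
    pw a x ≤ pw p x + pw q x := by
  rcases le_total x 1 with h | h
  · refine le_trans ?_ le_self_add
    exact ENNReal.ofReal_le_ofReal (Real.rpow_le_rpow_of_exponent_ge hx h h1)
  · refine le_trans ?_ le_add_self
    exact ENNReal.ofReal_le_ofReal (Real.rpow_le_rpow_of_exponent_le h h2)

theorem PP_eq (l₁ l₂ : ℝ) {x y : ℝ} (hx : 0 < x) (hy : 0 < y) :
    PP l₁ l₂ x y = pw l₁ x * pw l₂ y + pw l₁ y * pw l₂ x := by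
  unfold PP Phi pw
  rw [ENNReal.ofReal_add (by positivity) (by positivity), ENNReal.ofReal_mul (by positivity),
    ENNReal.ofReal_mul (by positivity)]

theorem Mm_prod {a b : ℝ} {f g : ℝ → ℝ≥0∞} (hf : Measurable f) (hg : Measurable g) :
    ∫⁻ q, (pw a q.1 * f q.1) * (pw b q.2 * g q.2) ∂nu2 = Mm a f * Mm b g := by
  have := pw_meas a
  have := pw_meas b
  unfold Mm
  rw [← lintegral_prod_mul (by fun_prop) (by fun_prop)]

theorem Mm_between {p a q : ℝ} (h1 : p ≤ a) (h2 : a ≤ q) {f : ℝ → ℝ≥0∞} (hf : Measurable f) :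
    Mm a f ≤ Mm p f + Mm q f := by
  have := pw_meas p
  unfold Mm
  rw [← lintegral_add_left (by fun_prop)]
  apply setLIntegral_mono' measurableSet_Ioi
  intro z hz
  rw [← add_mul]
  gcongr
  exact pw_between h1 h2 hz

theorem Mm_zero {a : ℝ} {f : ℝ → ℝ≥0∞} (hf : Measurable f) (h : Mm a f = 0) : ∀ᵐ z ∂nu, f z = 0 := by
  have := pw_meas a
  unfold Mm at h
  rw [lintegral_eq_zero_iff (by fun_prop)] at h
  filter_upwards [h, ae_restrict_mem measurableSet_Ioi] with z hz hz0
  simp only [Pi.zero_apply, mul_eq_zero] at hz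
  exact hz.resolve_left (pw_pos a hz0)

theorem Mm_of_zero {a : ℝ} {f : ℝ → ℝ≥0∞} (h : ∀ᵐ z ∂nu, f z = 0) : Mm a f = 0 := by
  unfold Mm
  rw [← lintegral_zero (μ := nu)]
  apply lintegral_congr_ae
  filter_upwards [h] with z hz
  simp [hz]

/-- no stationary state of the fragmentation dynamics -/
theorem no_stat {k l₁ l₂ E : ℝ} {b : ℝ → ℝ → ℝ → ℝ≥0∞} (hb : KerProp k E b)
    (hk : k ∈ Ioo (0:ℝ) 1) (hl₁ : k ≤ l₁) (hl₁₂ : l₁ ≤ l₂) (hl₂ : l₂ ≤ 1)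
    {f : ℝ → ℝ≥0∞} (hf : Measurable f) (hft : ∀ z, f z ≠ ⊤)
    (hm1 : Mm 1 f ≠ ⊤) (hm2 : Mm (1 + k + l₂) f ≠ ⊤)
    (hd : ∫⁻ q, (pw k q.1 + pw k q.2) * (PP l₁ l₂ q.1 q.2 * (f q.1 * f q.2)) ∂nu2 ≠ ⊤)
    (hbad : Mm k f = ⊤)
    (heq : ∀ᵐ z ∂nu, f z * Al (PP l₁ l₂) f z = Qg b (PP l₁ l₂) f f z) : False := by
  have hk0 := hk.1
  have hP := PP_prop l₁ l₂
  have hH := PP_meas hP hf hf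
  have hpk := pw_meas (1 + k)
  have hne : Mm (k + l₂) f ≠ 0 := by
    intro h0
    rw [Mm_of_zero (Mm_zero hf h0)] at hbad
    exact ENNReal.zero_ne_top hbad
  have hl1 : Mm l₁ f ≠ ⊤ := by
    have : Mm (k + l₂) f * Mm l₁ f ≠ ⊤ := by
      rw [← Mm_prod hf hf]
      refine ne_top_of_le_ne_top hd ?_
      apply lintegral_mono_ae
      filter_upwards [nu2_ae] with q hq
      rw [PP_eq _ _ hq.1 hq.2, ← pw_mul k l₂ hq.1]
      calc _ = pw k q.1 * (pw l₁ q.2 * pw l₂ q.1 * (f q.1 * f q.2)) := by ring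
        _ ≤ _ := by
          gcongr
          · exact le_self_add
          · exact le_add_self
    intro hc
    rw [hc, ENNReal.mul_top hne] at this
    exact this rfl
  have hl2 : Mm l₂ f ≠ ⊤ :=
    ne_top_of_le_ne_top (ENNReal.add_ne_top.2 ⟨hl1, hm1⟩) (Mm_between hl₁₂ hl₂ hf)
  have hx1 : Mm (1 + k + l₁) f ≠ ⊤ :=
    ne_top_of_le_ne_top (ENNReal.add_ne_top.2 ⟨hm1, hm2⟩)
      (Mm_between (by linarith) (by linarith) hf)
  have hloss : ∫⁻ q, pw (1 + k) q.1 * (PP l₁ l₂ q.1 q.2 * (f q.1 * f q.2)) ∂nu2 ≠ ⊤ := by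
    have e : ∫⁻ q, pw (1 + k) q.1 * (PP l₁ l₂ q.1 q.2 * (f q.1 * f q.2)) ∂nu2 =
        Mm (1 + k + l₁) f * Mm l₂ f + Mm (1 + k + l₂) f * Mm l₁ f := by
      have := pw_meas (1 + k + l₁)
      have := pw_meas l₂
      rw [← Mm_prod hf hf, ← Mm_prod hf hf, ← lintegral_add_left (by fun_prop)]
      apply lintegral_congr_ae
      filter_upwards [nu2_ae] with q hq
      rw [PP_eq _ _ hq.1 hq.2, ← pw_mul (1 + k) l₁ hq.1, ← pw_mul (1 + k) l₂ hq.1]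
      ring
    rw [e]
    exact ENNReal.add_ne_top.2 ⟨ENNReal.mul_ne_top hx1 hl2, ENNReal.mul_ne_top hm2 hl1⟩
  rw [← loss_test hP hpk hf hf, loss_test2 hP hpk hf] at hloss
  have e1 : ∫⁻ z, pw (1 + k) z * (f z * Al (PP l₁ l₂) f z) ∂nu =
      ∫⁻ z, pw (1 + k) z * Qg b (PP l₁ l₂) f f z ∂nu := by
    apply lintegral_congr_ae
    filter_upwards [heq] with z hz
    rw [hz]
  rw [loss_test2 hP hpk hf, gain_test hb hP hpk hf hf] at e1
  have h2 : (2⁻¹ : ℝ≥0∞) ≠ 0 := by simp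
  have h2' : (2⁻¹ : ℝ≥0∞) ≠ ⊤ := by simp
  rw [ENNReal.mul_right_inj h2 h2'] at e1
  have hlf : ∫⁻ q, (pw (1 + k) q.1 + pw (1 + k) q.2) * (PP l₁ l₂ q.1 q.2 * (f q.1 * f q.2)) ∂nu2
      ≠ ⊤ := by
    intro hc; rw [hc, ENNReal.mul_top h2] at hloss; exact hloss rfl
  refine absurd e1 (ne_of_gt ?_)
  set A : Set ℝ := {z | f z ≠ 0}
  have hA : nu A ≠ 0 := by
    intro h0
    have : ∀ᵐ z ∂nu, f z = 0 := by rw [ae_iff]; exact h0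
    rw [Mm_of_zero this] at hbad
    exact ENNReal.zero_ne_top hbad
  apply lintegral_strict_mono_of_ae_le_of_ae_lt_on (s := A ×ˢ A)
  · exact (((hpk.comp measurable_fst).add (hpk.comp measurable_snd)).mul hH).aemeasurable
  · rw [← e1]; exact hlf
  · filter_upwards [nu2_ae] with q hq
    gcongr
    exact (hb.P2 _ _ hq.1 hq.2).le
  · rw [Measure.prod_prod]; exact mul_ne_zero hA hA
  · filter_upwards [nu2_ae] with q hq hqA
    have hn0 : PP l₁ l₂ q.1 q.2 * (f q.1 * f q.2) ≠ 0 := by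
      refine mul_ne_zero ?_ (mul_ne_zero hqA.1 hqA.2)
      unfold PP
      simpa using Phi_pos l₁ l₂ hq.1 hq.2
    have hnt : PP l₁ l₂ q.1 q.2 * (f q.1 * f q.2) ≠ ⊤ :=
      ENNReal.mul_ne_top (by simp [PP]) (ENNReal.mul_ne_top (hft _) (hft _))
    exact ENNReal.mul_lt_mul_left hn0 hnt (hb.P2 _ _ hq.1 hq.2)

end

open MeasureTheory Set Filter
open scoped ENNReal

noncomputable section
theorem slice_meas {L : ℝ → ℝ → ℝ≥0∞} (hL : Measurable fun q : ℝ × ℝ => L q.1 q.2) (z : ℝ) :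
    Measurable fun τ => L τ z :=
  hL.comp (measurable_id.prodMk (measurable_const (a := z)))

theorem eq_meas {L M : ℝ → ℝ → ℝ≥0∞} (hL : Measurable fun q : ℝ × ℝ => L q.1 q.2)
    (hM : Measurable fun q : ℝ × ℝ => M q.1 q.2) :
    MeasurableSet {p : ℝ × ℝ | L p.2 p.1 = M p.2 p.1} :=
  measurableSet_eq_fun (hL.comp measurable_swap) (hM.comp measurable_swap)

section
variable {k l₁ l₂ : ℝ} {bs : ℝ → ℝ → ℝ → ℝ} {uin : ℝ → ℝ} {T : ℝ≥0∞} {u : ℝ → ℝ → ℝ}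

theorem ae_fin_of_pw {a : ℝ} {f : ℝ → ℝ≥0∞} (hf : Measurable f)
    (h : ∫⁻ z, pw a z * f z ∂nu ≠ ⊤) : ∀ᵐ z ∂nu, f z ≠ ⊤ := by
  have := pw_meas a
  filter_upwards [ae_lt_top (by fun_prop) h, ae_restrict_mem measurableSet_Ioi] with z hz hz0 hc
  rw [hc, ENNReal.mul_top (pw_pos a hz0)] at hz
  exact lt_irrefl _ hz

theorem mass_fin (h : IsWeakSolution k bs (Phi l₁ l₂) uin T u) :
    ∃ C : ℝ, ∀ t : ℝ, 0 ≤ t → ENNReal.ofReal t < T → Mm 1 (UU u t) ≤ ENNReal.ofReal C := by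
  obtain ⟨C, hC⟩ := h.massBdd
  refine ⟨C, fun t ht hT => ?_⟩
  refine le_trans (le_of_eq ?_) (hC t ht hT)
  apply setLIntegral_congr_fun measurableSet_Ioi
  intro z hz
  simp only [pw, UU, Real.rpow_one]
  rw [ENNReal.ofReal_mul (le_of_lt hz)]

theorem split_time (L : ℝ → ℝ≥0∞) {p q : ℝ} (hp : 0 < p) (hpq : p < q) :
    ∫⁻ τ in Ioo 0 q, L τ = (∫⁻ τ in Ioo 0 p, L τ) + ∫⁻ τ in Ioo p q, L τ := by
  have e1 : Ioo 0 q = Ioo 0 p ∪ Ico p q := (Ioo_union_Ico_eq_Ioo hp hpq.le).symm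
  rw [e1, lintegral_union measurableSet_Ico]
  · congr 1
    exact setLIntegral_congr Ioo_ae_eq_Ico.symm
  · rw [Set.disjoint_left]
    intro z hz hz'
    exact not_lt.2 hz'.1 hz.2

theorem no_bad_interval (hk : k ∈ Ioo (0:ℝ) 1) (hβ : FragKernel k bs) {E : ℝ}
    (hb : KerProp k E (be k bs)) (hl₁ : k ≤ l₁) (hl₁₂ : l₁ ≤ l₂) (hl₂ : l₂ ≤ 1)
    (hin : Measurable uin) (hnn : ∀ x, 0 ≤ uin x)
    (hX : MemXk k uin)
    (h : IsWeakSolution k bs (Phi l₁ l₂) uin T u)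
    (hm : ∀ t : ℝ, 0 < t → ENNReal.ofReal t < T →
      (∫⁻ τ in Ioo (0:ℝ) t, Mm (1 + k + l₂) (UU u τ)) < ⊤) {a b : ℝ} (ha : 0 ≤ a)
    (hab : a < b) (hbT : ENNReal.ofReal b < T) : ∃ t ∈ Ioo a b, MemXk k (u t) := by
  by_contra hbad
  push Not at hbad
  have hgm := gn_meas hb h
  have hlm := ls_meas h
  have hstep : ∀ p : ℝ, p ∈ Ioo a b → ∀ᵐ z ∂nu, ∫⁻ τ in Ioo 0 p, ls l₁ l₂ u τ z =
      ENNReal.ofReal (uin z) + ∫⁻ τ in Ioo 0 p, gn k bs l₁ l₂ u τ z := by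
    intro p hp
    have := step1 hk hβ hb hin hnn hX h (ha.trans_lt hp.1) (lt_T hbT hp.2.le)
    filter_upwards [this] with z hz
    simpa [Vt, if_neg (hbad p hp)] using hz
  have hfl : ∀ p : ℝ, p ∈ Ioo a b → ∀ᵐ z ∂nu, ∫⁻ τ in Ioo 0 p, ls l₁ l₂ u τ z ≠ ⊤ := fun p hp =>
    ae_fin_of_pw (time_meas hlm _) (ls_fin h (ha.trans_lt hp.1) (lt_T hbT hp.2.le))
  have hpq : ∀ p q : ℝ, p ∈ Ioo a b → q ∈ Ioo a b → p < q → ∀ᵐ z ∂nu,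
      ∫⁻ τ in Ioo p q, ls l₁ l₂ u τ z = ∫⁻ τ in Ioo p q, gn k bs l₁ l₂ u τ z ∧
      ∫⁻ τ in Ioo p q, ls l₁ l₂ u τ z ≠ ⊤ := by
    intro p q hp hq hlt
    filter_upwards [hstep p hp, hstep q hq, hfl p hp, hfl q hq] with z h1 h2 h3 h4
    have hp0 := ha.trans_lt hp.1
    rw [split_time _ hp0 hlt] at h4 h2
    rw [split_time (fun τ => gn k bs l₁ l₂ u τ z) hp0 hlt, ← add_assoc, ← h1] at h2
    exact ⟨(ENNReal.add_right_inj h3).1 h2, (ENNReal.add_ne_top.1 h4).2⟩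
  have hall : ∀ᵐ z ∂nu, ∀ p q : ℚ, (p:ℝ) ∈ Ioo a b → (q:ℝ) ∈ Ioo a b → (p:ℝ) < q →
      ∫⁻ τ in Ioo (p:ℝ) q, ls l₁ l₂ u τ z = ∫⁻ τ in Ioo (p:ℝ) q, gn k bs l₁ l₂ u τ z ∧
      ∫⁻ τ in Ioo (p:ℝ) q, ls l₁ l₂ u τ z ≠ ⊤ := by
    rw [ae_all_iff]; intro p
    rw [ae_all_iff]; intro q
    by_cases h1 : (p:ℝ) ∈ Ioo a b ∧ (q:ℝ) ∈ Ioo a b ∧ (p:ℝ) < q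
    · filter_upwards [hpq p q h1.1 h1.2.1 h1.2.2] with z hz _ _ _ using hz
    · exact ae_of_all _ fun z h2 h3 h4 => absurd ⟨h2, h3, h4⟩ h1
  obtain ⟨r, hr1, hr2⟩ := exists_rat_btwn hab
  obtain ⟨r', hr3, hr4⟩ := exists_rat_btwn hr2
  have hra : (r:ℝ) ∈ Ioo a b := ⟨hr1, hr2⟩
  have hrb : (r':ℝ) ∈ Ioo a b := ⟨hr1.trans hr3, hr4⟩
  have hae : ∀ᵐ z ∂nu, ∀ᵐ τ ∂(volume.restrict (Ioo (r:ℝ) r')),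
      ls l₁ l₂ u τ z = gn k bs l₁ l₂ u τ z := by
    filter_upwards [hall] with z hz
    have hmz : Measurable fun τ => ls l₁ l₂ u τ z :=
      slice_meas (L := ls l₁ l₂ u) hlm z
    have hmz' : Measurable fun τ => gn k bs l₁ l₂ u τ z :=
      slice_meas (L := gn k bs l₁ l₂ u) hgm z
    obtain ⟨e0, f0⟩ := hz r r' hra hrb hr3
    have f0' : ∫⁻ τ in Ioo (r:ℝ) r', gn k bs l₁ l₂ u τ z ≠ ⊤ := by rw [← e0]; exact f0
    refine ae_eq_of_rat (S := Ioo (r:ℝ) r') (F := fun τ => ls l₁ l₂ u τ z)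
      (G := fun τ => gn k bs l₁ l₂ u τ z) ?_ ?_ f0 f0' ?_
    · exact hmz.aemeasurable
    · exact hmz'.aemeasurable
    intro p q
    rw [Ioo_inter_Ioo]
    by_cases hlt : max p r < min q r'
    · have e1 : ((p:ℝ) ⊔ (r:ℝ)) = ((max p r : ℚ) : ℝ) := by push_cast; rfl
      have e2 : ((q:ℝ) ⊓ (r':ℝ)) = ((min q r' : ℚ) : ℝ) := by push_cast; rfl
      rw [e1, e2]
      have hlt' : ((max p r : ℚ) : ℝ) < ((min q r' : ℚ) : ℝ) := by exact_mod_cast hlt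
      have g1 : (r:ℝ) ≤ ((max p r : ℚ) : ℝ) := by exact_mod_cast le_max_right p r
      have g2 : ((min q r' : ℚ) : ℝ) ≤ (r':ℝ) := by exact_mod_cast min_le_right q r'
      exact (hz _ _ ⟨hr1.trans_le g1, (hlt'.trans_le g2).trans hr4⟩
        ⟨(hr1.trans_le g1).trans hlt', g2.trans_lt hr4⟩ hlt').1
    · have : Ioo ((p:ℝ) ⊔ (r:ℝ)) ((q:ℝ) ⊓ (r':ℝ)) = ∅ := by
        apply Ioo_eq_empty
        intro hc
        apply hlt
        exact_mod_cast hc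
      rw [this]; simp
  rw [Measure.ae_ae_comm] at hae
  swap
  · exact eq_meas (L := ls l₁ l₂ u) (M := gn k bs l₁ l₂ u) hlm hgm
  have hr0 : (0:ℝ) < r' := ha.trans_lt hrb.1
  have hrT := lt_T hbT hrb.2.le
  have hsub : volume.restrict (Ioo (r:ℝ) r') ≤ volume.restrict (Ioo (0:ℝ) r') :=
    Measure.restrict_mono (Ioo_subset_Ioo_left (ha.trans hr1.le)) le_rfl
  have hMmeas : Measurable fun τ => Mm (1 + k + l₂) (UU u τ) := by
    unfold Mm
    exact Measurable.lintegral_prod_right' (f := fun w : ℝ × ℝ => pw (1 + k + l₂) w.2 * UU u w.1 w.2)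
      (((pw_meas _).comp measurable_snd).mul (UU_meas h))
  have a1 : ∀ᵐ τ ∂(volume.restrict (Ioo (0:ℝ) r')), Mm (1 + k + l₂) (UU u τ) < ⊤ :=
    ae_lt_top hMmeas (hm r' hr0 hrT).ne
  have hdmeas : Measurable fun τ => ∫⁻ q, (pw k q.1 + pw k q.2) *
      (PP l₁ l₂ q.1 q.2 * (UU u τ q.1 * UU u τ q.2)) ∂nu2 := by
    have hp := pw_meas k
    have hHH := HH_meas h
    exact Measurable.lintegral_prod_right' (f := fun w : ℝ × ℝ × ℝ => (pw k w.2.1 + pw k w.2.2) *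
      HH l₁ l₂ u w) (by fun_prop)
  have a2 := ae_lt_top hdmeas (d_lint h hr0 hrT).ne
  have hne : NeBot (ae (volume.restrict (Ioo (r:ℝ) r'))) := by
    rw [ae_neBot]
    intro h0
    have := Measure.restrict_eq_zero.1 h0
    rw [Real.volume_Ioo] at this
    simp at this
    have : (r:ℝ) < r' := hr3
    have h' : (r':ℝ) ≤ r := by assumption_mod_cast
    linarith
  have a1' := a1.filter_mono (ae_mono hsub)
  have a2' := a2.filter_mono (ae_mono hsub)
  obtain ⟨τ, hτ, h1, h2, h3⟩ := (hae.and (a1'.and (a2'.and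
    (ae_restrict_mem measurableSet_Ioo)))).exists
  have hτab : τ ∈ Ioo a b := ⟨hr1.trans h3.1, h3.2.trans hr4⟩
  have hτ0 : 0 ≤ τ := ha.trans hτab.1.le
  have hτT := lt_T hbT hτab.2.le
  obtain ⟨C, hC⟩ := mass_fin h
  refine no_stat hb hk hl₁ hl₁₂ hl₂ (UU_meas1 h τ) (fun z => by simp [UU])
    (ne_top_of_le_ne_top (by simp) (hC τ hτ0 hτT)) h1.ne h2.ne ?_ hτ
  have := hbad τ hτab
  rw [memXk_iff h hτ0 hτT] at this
  simpa [Mm] using this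

theorem all_good (hk : k ∈ Ioo (0:ℝ) 1) (hβ : FragKernel k bs) {E : ℝ}
    (hb : KerProp k E (be k bs)) (hl₁ : k ≤ l₁) (hl₁₂ : l₁ ≤ l₂) (hl₂ : l₂ ≤ 1)
    (hin : Measurable uin) (hnn : ∀ x, 0 ≤ uin x)
    (hX : MemXk k uin)
    (h : IsWeakSolution k bs (Phi l₁ l₂) uin T u)
    (hm : ∀ t : ℝ, 0 < t → ENNReal.ofReal t < T →
      (∫⁻ τ in Ioo (0:ℝ) t, Mm (1 + k + l₂) (UU u τ)) < ⊤) {t : ℝ} (ht : 0 < t)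
    (hT : ENNReal.ofReal t < T) : MemXk k (u t) := by
  by_contra hbad
  have hfreq : ∃ᶠ s in nhdsWithin t (Iio t), MemXk k (u s) := by
    rw [frequently_iff]
    intro U hU
    obtain ⟨a, ha, hU⟩ := (mem_nhdsLT_iff_exists_Ioo_subset).1 hU
    obtain ⟨s, hs, hg⟩ := no_bad_interval hk hβ hb hl₁ hl₁₂ hl₂ hin hnn hX h hm
      (a := max a 0) (b := t) (le_max_right _ _) (max_lt ha ht) hT
    exact ⟨s, hU ⟨(le_max_left _ _).trans_lt hs.1, hs.2⟩, hg⟩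
  set D : Set ℝ := {t : ℝ | 0 ≤ t ∧ ENNReal.ofReal t < T}
  have hD : nhdsWithin t (Iio t) ≤ nhdsWithin t D := by
    apply nhdsWithin_le_iff.2
    filter_upwards [Ioo_mem_nhdsLT ht] with s hs
    exact ⟨hs.1.le, lt_T hT hs.2.le⟩
  have htD : t ∈ D := ⟨ht.le, hT⟩
  have hF := (h.cont (fun _ => 1) measurable_const ⟨1, by simp⟩) t htD
  have hF0 : ∫ x in Ioi (0:ℝ), 1 * (x ^ k * u t x) = 0 := by
    simp only [one_mul]
    exact integral_undef hbad
  have key : ∀ m : ℕ, ∫⁻ x in Ioo (1 / ((m:ℝ) + 1)) (m + 1), pw k x * UU u t x = 0 := by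
    intro m
    set J := Ioo (1 / ((m:ℝ) + 1)) (m + 1)
    set g : ℝ → ℝ := J.indicator (fun _ => 1)
    have hgm : Measurable g := measurable_const.indicator measurableSet_Ioo
    have hg0 : ∀ x, 0 ≤ g x := fun x => indicator_nonneg (fun _ _ => zero_le_one) x
    have hg1 : ∀ x, g x ≤ 1 := fun x => by
      by_cases hx : x ∈ J <;> simp [g, hx]
    have hG := (h.cont g hgm ⟨1, fun x => by rw [abs_of_nonneg (hg0 x)]; exact hg1 x⟩) t htD
    have hut := u_meas1 h t
    have hm1 : (0:ℝ) < (m:ℝ) + 1 := by positivity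
    have hJ0 : ∀ x ∈ J, 0 < x := fun x hx => lt_trans (by positivity) hx.1
    have hnn' : ∀ᵐ x ∂nu, 0 ≤ g x * (x ^ k * u t x) := by
      filter_upwards [ae_restrict_mem measurableSet_Ioi] with x hx
      exact mul_nonneg (hg0 x) (mul_nonneg (Real.rpow_nonneg (le_of_lt hx) _)
        (h.nonneg t ht.le hT x hx))
    have hIntg : Integrable (fun x => g x * (x ^ k * u t x)) nu := by
      have := phi_int h ht.le hT (φ := fun x => g x * |x| ^ k) (by fun_prop)
        (fun z => mul_nonneg (hg0 z) (by positivity)) (C := (m+1) * (m + 1)) (by positivity)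
        (fun z hz => ?_)
      · refine this.congr ?_
        filter_upwards [ae_restrict_mem measurableSet_Ioi] with x hx
        have hx : 0 < x := hx
        rw [abs_of_pos hx, mul_assoc]
      · by_cases hx : z ∈ J
        · simp only [g, hx, indicator_of_mem, one_mul]
          rw [abs_of_pos hz]
          have h1 : z ^ k ≤ (m + 1 : ℝ) := by
            calc z ^ k ≤ (m + 1 : ℝ) ^ k := Real.rpow_le_rpow hz.le hx.2.le hk.1.le
              _ ≤ (m + 1 : ℝ) ^ (1:ℝ) := by
                apply Real.rpow_le_rpow_of_exponent_le _ hk.2.le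
                linarith [(Nat.cast_nonneg m : (0:ℝ) ≤ m)]
              _ = _ := Real.rpow_one _
          have h2 : 1 ≤ (m + 1) * z := by
            have := hx.1
            rw [div_lt_iff₀ hm1] at this
            linarith
          calc z ^ k ≤ (m + 1) * 1 := by linarith
            _ ≤ (m + 1) * ((m + 1) * z) := by gcongr
            _ = _ := by ring
        · simp only [g, hx, indicator_of_notMem, not_false_eq_true, zero_mul]
          positivity
    have hle : ∫ x in Ioi (0:ℝ), g x * (x ^ k * u t x) ≤ 0 := by
      by_contra hpos
      push Not at hpos
      set c := ∫ x in Ioi (0:ℝ), g x * (x ^ k * u t x)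
      have ev1 := (hG.tendsto.mono_left hD).eventually (lt_mem_nhds (half_lt_self hpos))
      have ev2 := (hF.tendsto.mono_left hD).eventually
        (gt_mem_nhds (show (∫ x in Ioi (0:ℝ), 1 * (x ^ k * u t x)) < c / 2 by rw [hF0]; linarith))
      obtain ⟨s, hs, h1, h2, h3⟩ := (hfreq.and_eventually (ev1.and (ev2.and
        (Ioo_mem_nhdsLT ht)))).exists
      have : ∫ x in Ioi (0:ℝ), g x * (x ^ k * u s x) ≤ ∫ x in Ioi (0:ℝ), 1 * (x ^ k * u s x) := by
        have hsT := lt_T hT h3.2.le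
        apply integral_mono_of_nonneg
        · filter_upwards [ae_restrict_mem measurableSet_Ioi] with x hx
          exact mul_nonneg (hg0 x) (mul_nonneg (Real.rpow_nonneg (le_of_lt hx) _)
            (h.nonneg s h3.1.le hsT x hx))
        · simp only [one_mul]; exact hs
        · filter_upwards [ae_restrict_mem measurableSet_Ioi] with x hx
          have := mul_nonneg (Real.rpow_nonneg (le_of_lt hx) k)
            (h.nonneg s h3.1.le hsT x hx)
          exact mul_le_mul_of_nonneg_right (hg1 x) this
      linarith
    have h0 : ∫ x in Ioi (0:ℝ), g x * (x ^ k * u t x) = 0 :=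
      le_antisymm hle (integral_nonneg_of_ae hnn')
    have h00 := (integral_eq_zero_iff_of_nonneg_ae hnn' hIntg).1 h0
    have hp := pw_meas k
    have hU := UU_meas1 h t
    rw [lintegral_eq_zero_iff (by fun_prop)]
    have hJs : volume.restrict J ≤ nu := Measure.restrict_mono hJ0 le_rfl
    filter_upwards [ae_mono hJs h00, ae_restrict_mem measurableSet_Ioo] with x hx hxJ
    have hxJ : x ∈ J := hxJ
    simp only [g, hxJ, indicator_of_mem, one_mul, Pi.zero_apply] at hx
    simp only [pw, UU, Pi.zero_apply]
    rw [← ENNReal.ofReal_mul (Real.rpow_nonneg (hJ0 x hxJ).le _), hx, ENNReal.ofReal_zero]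
  apply hbad
  rw [memXk_iff h ht.le hT]
  have hu : Ioi (0:ℝ) = ⋃ m : ℕ, Ioo (1 / ((m:ℝ) + 1)) (m + 1) := by
    ext z
    simp only [mem_Ioi, mem_iUnion, mem_Ioo]
    constructor
    · intro hz
      obtain ⟨m, hm⟩ := exists_nat_one_div_lt hz
      obtain ⟨m', hm'⟩ := exists_nat_ge z
      refine ⟨max m m', lt_of_le_of_lt ?_ hm, ?_⟩
      · gcongr; exact le_max_left _ _
      · have : (m':ℝ) ≤ (max m m' : ℕ) := by exact_mod_cast le_max_right _ _
        linarith
    · rintro ⟨n, hn, -⟩; exact lt_trans (by positivity) hn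
  have : ∫⁻ z, pw k z * UU u t z ∂nu ≤ 0 := by
    unfold nu
    rw [hu]
    refine (lintegral_iUnion_le _ _).trans ?_
    rw [ENNReal.tsum_eq_zero.2 key]
  rw [le_zero_iff.1 this]
  simp

end
end

open MeasureTheory Set Filter
open scoped ENNReal

noncomputable section
section
variable {k l₁ l₂ : ℝ} {bs : ℝ → ℝ → ℝ → ℝ} {uin : ℝ → ℝ} {T : ℝ≥0∞} {u : ℝ → ℝ → ℝ}

theorem Mm_meas {L : ℝ → ℝ → ℝ≥0∞} (hL : Measurable fun q : ℝ × ℝ => L q.1 q.2) (a : ℝ) :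
    Measurable fun τ => Mm a (L τ) := by
  unfold Mm
  exact Measurable.lintegral_prod_right' (f := fun w : ℝ × ℝ => pw a w.2 * L w.1 w.2)
      (((pw_meas _).comp measurable_snd).mul hL)

theorem Mm_add (a : ℝ) {f g : ℝ → ℝ≥0∞} (hf : Measurable f) :
    Mm a (fun x => f x + g x) = Mm a f + Mm a g := by
  have := pw_meas a
  unfold Mm
  rw [← lintegral_add_left (by fun_prop)]
  simp only [mul_add]

theorem Mm_mono (a : ℝ) {f g : ℝ → ℝ≥0∞} (h : ∀ x, f x ≤ g x) : Mm a f ≤ Mm a g := by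
  unfold Mm
  gcongr with x
  exact h x

theorem bil {k l₁ l₂ a b c : ℝ} (h1 : k ≤ a + l₁) (h12 : l₁ ≤ l₂) (h2 : a ≤ 1 + k)
    (h3 : k ≤ b + l₁) (h4 : b + l₂ ≤ c) {f g : ℝ → ℝ≥0∞} (hf : Measurable f) (hg : Measurable g) :
    ∫⁻ q, (pw a q.1 * pw b q.2) * (PP l₁ l₂ q.1 q.2 * (f q.1 * g q.2)) ∂nu2 ≤
      2 * ((Mm k f + Mm (1 + k + l₂) f) * (Mm k g + Mm c g)) := by
  have e : ∫⁻ q, (pw a q.1 * pw b q.2) * (PP l₁ l₂ q.1 q.2 * (f q.1 * g q.2)) ∂nu2 =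
      Mm (a + l₁) f * Mm (b + l₂) g + Mm (a + l₂) f * Mm (b + l₁) g := by
    have := pw_meas (a + l₁)
    have := pw_meas (b + l₂)
    rw [← Mm_prod hf hg, ← Mm_prod hf hg, ← lintegral_add_left (by fun_prop)]
    apply lintegral_congr_ae
    filter_upwards [nu2_ae] with q hq
    rw [PP_eq _ _ hq.1 hq.2, ← pw_mul a l₁ hq.1, ← pw_mul a l₂ hq.1, ← pw_mul b l₁ hq.2,
      ← pw_mul b l₂ hq.2]
    ring
  rw [e, two_mul]
  gcongr <;> apply Mm_between <;> first | assumption | linarith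

theorem pw_zero {x : ℝ} : pw 0 x = 1 := by simp [pw]

theorem bil1 {k l₁ l₂ a c : ℝ} (h1 : k ≤ a + l₁) (h12 : l₁ ≤ l₂) (h2 : a ≤ 1 + k)
    (h3 : k ≤ l₁) (h4 : l₂ ≤ c) {f g : ℝ → ℝ≥0∞} (hf : Measurable f) (hg : Measurable g) :
    ∫⁻ q, pw a q.1 * (PP l₁ l₂ q.1 q.2 * (f q.1 * g q.2)) ∂nu2 ≤
      2 * ((Mm k f + Mm (1 + k + l₂) f) * (Mm k g + Mm c g)) := by
  have := bil (b := 0) (c := c) h1 h12 h2 (by linarith) (by linarith) hf hg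
  simpa only [pw_zero, mul_one] using this

theorem bil2 {k l₁ l₂ b c : ℝ} (h1 : k ≤ l₁) (hk : 0 ≤ 1 + k) (h12 : l₁ ≤ l₂)
    (h3 : k ≤ b + l₁) (h4 : b + l₂ ≤ c) {f g : ℝ → ℝ≥0∞} (hf : Measurable f) (hg : Measurable g) :
    ∫⁻ q, pw b q.2 * (PP l₁ l₂ q.1 q.2 * (f q.1 * g q.2)) ∂nu2 ≤
      2 * ((Mm k f + Mm (1 + k + l₂) f) * (Mm k g + Mm c g)) := by
  have := bil (a := 0) (c := c) (by linarith) h12 hk h3 h4 hf hg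
  simpa only [pw_zero, one_mul] using this

theorem sol_eq (hk : k ∈ Ioo (0:ℝ) 1) (hβ : FragKernel k bs) {E : ℝ}
    (hb : KerProp k E (be k bs)) (hl₁ : k ≤ l₁) (hl₁₂ : l₁ ≤ l₂) (hl₂ : l₂ ≤ 1)
    (hin : Measurable uin) (hnn : ∀ x, 0 ≤ uin x)
    (hX : MemXk k uin)
    (h : IsWeakSolution k bs (Phi l₁ l₂) uin T u)
    (hm : ∀ t : ℝ, 0 < t → ENNReal.ofReal t < T →
      (∫⁻ τ in Ioo (0:ℝ) t, Mm (1 + k + l₂) (UU u τ)) < ⊤) {t : ℝ} (ht : 0 < t)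
    (hT : ENNReal.ofReal t < T) : ∀ᵐ z ∂nu, UU u t z + ∫⁻ τ in Ioo 0 t, ls l₁ l₂ u τ z =
      ENNReal.ofReal (uin z) + ∫⁻ τ in Ioo 0 t, gn k bs l₁ l₂ u τ z := by
  have := step1 hk hβ hb hin hnn hX h ht hT
  simpa [Vt, if_pos (all_good hk hβ hb hl₁ hl₁₂ hl₂ hin hnn hX h hm ht hT)] using this

theorem mom_le {a : ℝ} {t t0 : ℝ} (htt : t ≤ t0) {E : ℝ} (hin : Measurable uin)
    (hb : KerProp k E (be k bs))
    (h : IsWeakSolution k bs (Phi l₁ l₂) uin T u)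
    (hs : ∀ᵐ z ∂nu, UU u t z + ∫⁻ τ in Ioo 0 t, ls l₁ l₂ u τ z =
      ENNReal.ofReal (uin z) + ∫⁻ τ in Ioo 0 t, gn k bs l₁ l₂ u τ z) :
    Mm a (UU u t) ≤ (∫⁻ z, pw a z * ENNReal.ofReal (uin z) ∂nu) +
      ∫⁻ z, pw a z * (∫⁻ τ in Ioo 0 t0, gn k bs l₁ l₂ u τ z) ∂nu := by
  have := pw_meas a
  rw [← lintegral_add_left (by fun_prop)]
  unfold Mm
  apply lintegral_mono_ae
  filter_upwards [hs] with z hz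
  rw [← mul_add]
  gcongr
  refine le_self_add.trans (hz.le.trans ?_)
  gcongr

theorem gn_le_ls (hk : 0 < k) {E : ℝ} (hb : KerProp k E (be k bs))
    (h : IsWeakSolution k bs (Phi l₁ l₂) uin T u) (τ : ℝ) :
    ∫⁻ z, pw (1 + k) z * gn k bs l₁ l₂ u τ z ∂nu ≤
      ∫⁻ q, pw (1 + k) q.1 * (PP l₁ l₂ q.1 q.2 * (UU u τ q.1 * UU u τ q.2)) ∂nu2 := by
  have hU := UU_meas1 h τ
  have hP := PP_prop l₁ l₂
  have hp := pw_meas (1 + k)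
  unfold gn
  rw [gain_test hb hP hp hU hU, ← loss_test hP hp hU hU, loss_test2 hP hp hU]
  gcongr 2⁻¹ * ?_
  apply lintegral_mono_ae
  filter_upwards [nu2_ae] with q hq
  gcongr
  exact (hb.P2 _ _ hq.1 hq.2).le

theorem bdd_k (hk : k ∈ Ioo (0:ℝ) 1) (hβ : FragKernel k bs) {E : ℝ}
    (hb : KerProp k E (be k bs)) (hl₁ : k ≤ l₁) (hl₁₂ : l₁ ≤ l₂) (hl₂ : l₂ ≤ 1)
    (hin : Measurable uin) (hnn : ∀ x, 0 ≤ uin x)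
    (hX : MemXk k uin)
    (h : IsWeakSolution k bs (Phi l₁ l₂) uin T u)
    (hm : ∀ t : ℝ, 0 < t → ENNReal.ofReal t < T →
      (∫⁻ τ in Ioo (0:ℝ) t, Mm (1 + k + l₂) (UU u τ)) < ⊤) {t0 : ℝ} (ht0 : 0 < t0)
    (hT : ENNReal.ofReal t0 < T) :
    ∃ C : ℝ≥0∞, C ≠ ⊤ ∧ ∀ t, 0 < t → t ≤ t0 → Mm k (UU u t) + Mm 1 (UU u t) ≤ C := by
  obtain ⟨C, hC⟩ := mass_fin h
  refine ⟨((∫⁻ z, pw k z * ENNReal.ofReal (uin z) ∂nu) +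
      ∫⁻ z, pw k z * (∫⁻ τ in Ioo 0 t0, gn k bs l₁ l₂ u τ z) ∂nu) + ENNReal.ofReal C,
      ?_, fun t ht htt => ?_⟩
  · have h1 := in_fin hnn hX
    have h2 := gn_fin hb h ht0 hT
    simp [h1, h2]
  · have hs := sol_eq hk hβ hb hl₁ hl₁₂ hl₂ hin hnn hX h hm ht (lt_T hT htt)
    gcongr
    · exact mom_le htt hin hb h hs
    · exact hC t ht.le (lt_T hT htt)

theorem int_W (h : IsWeakSolution k bs (Phi l₁ l₂) uin T u)
    (hm : ∀ t : ℝ, 0 < t → ENNReal.ofReal t < T →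
      (∫⁻ τ in Ioo (0:ℝ) t, Mm (1 + k + l₂) (UU u τ)) < ⊤) {t0 : ℝ} (ht0 : 0 < t0)
    (hT : ENNReal.ofReal t0 < T) {C : ℝ≥0∞} (hC : C ≠ ⊤)
    (hCb : ∀ t, 0 < t → t ≤ t0 → Mm k (UU u t) + Mm 1 (UU u t) ≤ C) :
    ∫⁻ τ in Ioo (0:ℝ) t0, (Mm k (UU u τ) + Mm (1 + k + l₂) (UU u τ)) ≠ ⊤ := by
  have h1 : ∫⁻ τ in Ioo (0:ℝ) t0, (Mm k (UU u τ) + Mm (1 + k + l₂) (UU u τ)) ≤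
      (∫⁻ τ in Ioo (0:ℝ) t0, C) + ∫⁻ τ in Ioo (0:ℝ) t0, Mm (1 + k + l₂) (UU u τ) := by
    rw [← lintegral_add_left measurable_const]
    apply setLIntegral_mono' measurableSet_Ioo
    intro τ hτ
    gcongr
    exact le_self_add.trans (hCb τ hτ.1 hτ.2.le)
  refine ne_top_of_le_ne_top ?_ h1
  refine ENNReal.add_ne_top.2 ⟨?_, (hm t0 ht0 hT).ne⟩
  simp [ENNReal.mul_eq_top, hC]

theorem bdd_w (hk : k ∈ Ioo (0:ℝ) 1) (hβ : FragKernel k bs) {E : ℝ}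
    (hb : KerProp k E (be k bs)) (hl₁ : k ≤ l₁) (hl₁₂ : l₁ ≤ l₂) (hl₂ : l₂ ≤ 1)
    (hin : Measurable uin) (hnn : ∀ x, 0 ≤ uin x)
    (hX : MemXk k uin) (hX1 : MemXk (k + 1) uin)
    (h : IsWeakSolution k bs (Phi l₁ l₂) uin T u)
    (hm : ∀ t : ℝ, 0 < t → ENNReal.ofReal t < T →
      (∫⁻ τ in Ioo (0:ℝ) t, Mm (1 + k + l₂) (UU u τ)) < ⊤) {t0 : ℝ} (ht0 : 0 < t0)
    (hT : ENNReal.ofReal t0 < T) :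
    ∃ C : ℝ≥0∞, C ≠ ⊤ ∧ ∀ t, 0 < t → t ≤ t0 → Mm k (UU u t) + Mm (1 + k) (UU u t) ≤ C := by
  obtain ⟨C, hC, hCb⟩ := bdd_k hk hβ hb hl₁ hl₁₂ hl₂ hin hnn hX h hm ht0 hT
  rw [add_comm] at hX1
  refine ⟨C + ((∫⁻ z, pw (1 + k) z * ENNReal.ofReal (uin z) ∂nu) +
      ∫⁻ z, pw (1 + k) z * (∫⁻ τ in Ioo 0 t0, gn k bs l₁ l₂ u τ z) ∂nu),
      ?_, fun t ht htt => ?_⟩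
  · have h1 := in_fin hnn hX1
    have h2 : ∫⁻ z, pw (1 + k) z * (∫⁻ τ in Ioo 0 t0, gn k bs l₁ l₂ u τ z) ∂nu ≠ ⊤ := by
      rw [time_test (pw_meas _) (gn_meas hb h)]
      have h3 : ∫⁻ τ in Ioo 0 t0, ∫⁻ z, pw (1 + k) z * gn k bs l₁ l₂ u τ z ∂nu ≤
          ∫⁻ τ in Ioo 0 t0, (2 * C) * (Mm k (UU u τ) + Mm (1 + k + l₂) (UU u τ)) := by
        apply setLIntegral_mono' measurableSet_Ioo
        intro τ hτ
        refine (gn_le_ls hk.1 hb h τ).trans ?_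
        have hU := UU_meas1 h τ
        have hk0 := hk.1
        refine (bil1 (c := 1) (by linarith) hl₁₂ le_rfl hl₁ hl₂ hU hU).trans ?_
        have := hCb τ hτ.1 hτ.2.le
        calc _ ≤ 2 * ((Mm k (UU u τ) + Mm (1 + k + l₂) (UU u τ)) * C) := by gcongr
          _ = _ := by ring
      refine ne_top_of_le_ne_top ?_ h3
      rw [lintegral_const_mul' _ _ (ENNReal.mul_ne_top (by simp) hC)]
      exact ENNReal.mul_ne_top (ENNReal.mul_ne_top (by simp) hC) (int_W h hm ht0 hT hC hCb)
    simp [h1, h2, hC]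
  · have hs := sol_eq hk hβ hb hl₁ hl₁₂ hl₂ hin hnn hX h hm ht (lt_T hT htt)
    gcongr
    · exact le_self_add.trans (hCb t ht htt)
    · exact mom_le htt hin hb h hs

end
end

open MeasureTheory Set Filter
open scoped ENNReal

noncomputable section

/-- distance in the extended nonnegative reals -/
def dE (a b : ℝ≥0∞) : ℝ≥0∞ := ENNReal.ofReal |a.toReal - b.toReal|

theorem dE_symm (a b : ℝ≥0∞) : dE a b = dE b a := by unfold dE; rw [abs_sub_comm]

theorem dE_meas : Measurable fun q : ℝ≥0∞ × ℝ≥0∞ => dE q.1 q.2 := by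
  unfold dE
  fun_prop

theorem dE_le_add {a b : ℝ≥0∞} (ha : a ≠ ⊤) (hb : b ≠ ⊤) : dE a b ≤ a + b := by
  unfold dE
  rw [← ENNReal.ofReal_toReal ha, ← ENNReal.ofReal_toReal hb,
    ← ENNReal.ofReal_add (by positivity) (by positivity)]
  apply ENNReal.ofReal_le_ofReal
  have := a.toReal_nonneg
  have := b.toReal_nonneg
  simp only [ENNReal.toReal_ofReal, ENNReal.toReal_nonneg]
  rw [abs_le]; constructor <;> linarith

theorem le_add_dE {a b : ℝ≥0∞} (ha : a ≠ ⊤) (hb : b ≠ ⊤) : a ≤ b + dE a b := by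
  unfold dE
  nth_rw 1 [← ENNReal.ofReal_toReal ha, ← ENNReal.ofReal_toReal hb]
  rw [← ENNReal.ofReal_add (by positivity) (by positivity)]
  apply ENNReal.ofReal_le_ofReal
  have := le_abs_self (a.toReal - b.toReal)
  linarith

theorem prod_diff {a b c e : ℝ≥0∞} (ha : a ≠ ⊤) (hb : b ≠ ⊤) (hc : c ≠ ⊤) (he : e ≠ ⊤) :
    a * c ≤ b * e + (2⁻¹ * ((a + b) * dE c e) + 2⁻¹ * (dE a b * (c + e))) := by
  lift a to NNReal using ha
  lift b to NNReal using hb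
  lift c to NNReal using hc
  lift e to NNReal using he
  have h2 : (2⁻¹ : ℝ≥0∞) = ENNReal.ofReal (2⁻¹) := by
    rw [ENNReal.ofReal_inv_of_pos (by norm_num)]; simp
  unfold dE
  rw [h2]
  simp only [ENNReal.coe_toReal]
  simp only [← ENNReal.ofReal_coe_nnreal]
  rw [← ENNReal.ofReal_mul (by positivity), ← ENNReal.ofReal_mul (by positivity),
    ← ENNReal.ofReal_add (by positivity) (by positivity), ← ENNReal.ofReal_mul (by positivity),
    ← ENNReal.ofReal_mul (by positivity), ← ENNReal.ofReal_add (by positivity) (by positivity),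
    ← ENNReal.ofReal_mul (by positivity), ← ENNReal.ofReal_mul (by positivity),
    ← ENNReal.ofReal_add (by positivity) (by positivity),
    ← ENNReal.ofReal_add (by positivity) (by positivity)]
  apply ENNReal.ofReal_le_ofReal
  have h1 : ((a:ℝ) + b) * (c - e) ≤ ((a:ℝ) + b) * |(c:ℝ) - e| := by
    gcongr; exact le_abs_self _
  have h2 : ((a:ℝ) - b) * (c + e) ≤ |(a:ℝ) - b| * (c + e) := by
    gcongr; exact le_abs_self _
  nlinarith

section
variable {k E l₁ l₂ : ℝ} {b : ℝ → ℝ → ℝ → ℝ≥0∞} {P : ℝ → ℝ → ℝ≥0∞} {f g : ℝ → ℝ≥0∞}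

theorem Q_diff (hb : KerProp k E b) (hP : PProp P) (hf : Measurable f) (hg : Measurable g)
    (hft : ∀ x, f x ≠ ⊤) (hgt : ∀ x, g x ≠ ⊤) (z : ℝ) :
    Qg b P f f z ≤ Qg b P g g z + Qg b P (fun x => f x + g x) (fun x => dE (f x) (g x)) z := by
  have hd : Measurable fun x => dE (f x) (g x) := dE_meas.comp (hf.prodMk hg)
  have hv : Measurable fun x => f x + g x := hf.add hg
  have hbz := b_meas_xy hb z
  have key : Qg b P f f z ≤ Qg b P g g z +
      (2⁻¹ * Qg b P (fun x => f x + g x) (fun x => dE (f x) (g x)) z +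
       2⁻¹ * Qg b P (fun x => dE (f x) (g x)) (fun x => f x + g x) z) := by
    unfold Qg
    simp only [← mul_add]
    rw [← lintegral_add_left (by exact (hbz.mul (PP_meas hP hv hd))),
      ← lintegral_const_mul' 2⁻¹ (fun q : ℝ × ℝ =>
          b z q.1 q.2 * (P q.1 q.2 * ((f q.1 + g q.1) * dE (f q.2) (g q.2))) +
            b z q.1 q.2 * (P q.1 q.2 * (dE (f q.1) (g q.1) * (f q.2 + g q.2)))) (by simp),
      ← lintegral_add_left (by exact (hbz.mul (PP_meas hP hg hg)))]
    gcongr 2⁻¹ * ?_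
    apply lintegral_mono
    intro q
    dsimp only
    calc b z q.1 q.2 * (P q.1 q.2 * (f q.1 * f q.2)) ≤ b z q.1 q.2 * (P q.1 q.2 *
        (g q.1 * g q.2 + (2⁻¹ * ((f q.1 + g q.1) * dE (f q.2) (g q.2)) +
          2⁻¹ * (dE (f q.1) (g q.1) * (f q.2 + g q.2))))) := by
          gcongr
          exact prod_diff (hft _) (hgt _) (hft _) (hgt _)
      _ = _ := by ring
  refine key.trans ?_
  rw [Qg_symm hb hP (fun x => dE (f x) (g x)), ← add_mul, ENNReal.inv_two_add_inv_two, one_mul]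

theorem Al_diff (hP : PProp P) (hg : Measurable g)
    (hft : ∀ x, f x ≠ ⊤) (hgt : ∀ x, g x ≠ ⊤) (z : ℝ) :
    Al P f z ≤ Al P g z + Al P (fun x => dE (f x) (g x)) z := by
  have hPz : Measurable fun y => P z y :=
    hP.meas.comp ((measurable_const (a := z)).prodMk measurable_id)
  unfold Al
  rw [← lintegral_add_left (by exact hPz.mul hg)]
  apply lintegral_mono
  intro y
  dsimp only
  rw [← mul_add]
  gcongr
  exact le_add_dE (hft _) (hgt _)

/-- the weight -/
def sw (k z : ℝ) : ℝ≥0∞ := pw k z + pw (1 + k) z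

theorem sw_meas (k : ℝ) : Measurable (sw k) := (pw_meas k).add (pw_meas (1 + k))

theorem weight_ineq (hb : KerProp k E b) (hk : k ∈ Ioo (0:ℝ) 1)
    (hl₁ : k ≤ l₁) (hl₁₂ : l₁ ≤ l₂) (hl₂ : l₂ ≤ 1) {v d : ℝ → ℝ≥0∞}
    (hv : Measurable v) (hd : Measurable d) :
    ∫⁻ z, sw k z * (Qg b (PP l₁ l₂) v d z + 2⁻¹ * (v z * Al (PP l₁ l₂) d z)) ∂nu ≤
      (∫⁻ z, sw k z * (2⁻¹ * (d z * Al (PP l₁ l₂) v z)) ∂nu) +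
      (ENNReal.ofReal E + ENNReal.ofReal E + 3) *
        ((Mm k v + Mm (1 + k + l₂) v) * (Mm k d + Mm (1 + k) d)) := by
  have hP := PP_prop l₁ l₂
  have hs := sw_meas k
  have hH := PP_meas hP hv hd
  have hA := Al_meas1 hP hv
  have hA' := Al_meas1 hP hd
  have hQ := Qg_meas1 hb hP hv hd
  have hk0 := hk.1
  have hpk := pw_meas k
  have hp1 := pw_meas (1 + k)
  set M := (Mm k v + Mm (1 + k + l₂) v) * (Mm k d + Mm (1 + k) d)
  have e0 : ∀ F : ℝ → ℝ≥0∞, ∫⁻ z, sw k z * (2⁻¹ * F z) ∂nu = 2⁻¹ * ∫⁻ z, sw k z * F z ∂nu := by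
    intro F
    rw [← lintegral_const_mul' _ _ (by simp)]
    congr 1; ext z; ring
  have B1 : ∫⁻ q, pw k q.1 * (PP l₁ l₂ q.1 q.2 * (v q.1 * d q.2)) ∂nu2 ≤ 2 * M :=
    bil1 (c := 1 + k) (by linarith) hl₁₂ (by linarith) hl₁ (by linarith) hv hd
  have B2 : ∫⁻ q, pw (1 + k) q.1 * (PP l₁ l₂ q.1 q.2 * (v q.1 * d q.2)) ∂nu2 ≤ 2 * M :=
    bil1 (c := 1 + k) (by linarith) hl₁₂ le_rfl hl₁ (by linarith) hv hd
  have B3 : ∫⁻ q, pw k q.2 * (PP l₁ l₂ q.1 q.2 * (v q.1 * d q.2)) ∂nu2 ≤ 2 * M :=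
    bil2 (c := 1 + k) hl₁ (by linarith) hl₁₂ (by linarith) (by linarith) hv hd
  have e1 : ∫⁻ z, sw k z * (d z * Al (PP l₁ l₂) v z) ∂nu =
      ∫⁻ q, sw k q.2 * (PP l₁ l₂ q.1 q.2 * (v q.1 * d q.2)) ∂nu2 := by
    rw [loss_test hP hs hd hv, ← lintegral_prod_swap]
    congr 1; ext q
    simp only [Prod.fst_swap, Prod.snd_swap]
    rw [hP.symm, mul_comm (d q.2)]
  set H : ℝ × ℝ → ℝ≥0∞ := fun q => PP l₁ l₂ q.1 q.2 * (v q.1 * d q.2) with hHdef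
  have e2 : ∫⁻ z, sw k z * (Qg b (PP l₁ l₂) v d z + 2⁻¹ * (v z * Al (PP l₁ l₂) d z)) ∂nu =
      2⁻¹ * ((∫⁻ q, (∫⁻ z, sw k z * b z q.1 q.2 ∂nu) * H q ∂nu2) +
        ∫⁻ q, sw k q.1 * H q ∂nu2) := by
    simp only [mul_add (sw k _)]
    rw [lintegral_add_left (by exact hs.mul hQ), gain_test hb hP hs hv hd, e0,
      loss_test hP hs hv hd, ← mul_add]
  rw [e2, e0, e1]
  have hH1 : Measurable fun q : ℝ × ℝ => sw k q.2 * H q := (hs.comp measurable_snd).mul hH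
  have ineq : (∫⁻ q, (∫⁻ z, sw k z * b z q.1 q.2 ∂nu) * H q ∂nu2) +
        ∫⁻ q, sw k q.1 * H q ∂nu2 ≤ (∫⁻ q, sw k q.2 * H q ∂nu2) +
        ((ENNReal.ofReal E + 1) * (∫⁻ q, pw k q.1 * H q ∂nu2) +
          (ENNReal.ofReal E * (∫⁻ q, pw k q.2 * H q ∂nu2) +
          2 * ∫⁻ q, pw (1 + k) q.1 * H q ∂nu2)) := by
    rw [← lintegral_const_mul' _ _ (by simp), ← lintegral_const_mul' _ _ (by simp),
      ← lintegral_const_mul' _ _ (by simp), 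
      ← lintegral_add_right _ (by exact (hs.comp measurable_fst).mul hH),
      ← lintegral_add_left (by exact ((hpk.comp measurable_snd).mul hH).const_mul _),
      ← lintegral_add_left (by exact ((hpk.comp measurable_fst).mul hH).const_mul _),
      ← lintegral_add_left (by exact (hs.comp measurable_snd).mul hH)]
    apply lintegral_mono_ae
    filter_upwards [nu2_ae] with q hq
    have hbz := b_meas_z hb q.1 q.2
    have : ∫⁻ z, sw k z * b z q.1 q.2 ∂nu ≤ ENNReal.ofReal E * (pw k q.1 + pw k q.2) +
        (pw (1 + k) q.1 + pw (1 + k) q.2) := by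
      unfold sw
      simp only [add_mul]
      rw [lintegral_add_left (by exact hpk.mul hbz)]
      exact add_le_add (hb.P1 _ _ hq.1 hq.2) (hb.P2 _ _ hq.1 hq.2).le
    calc _ ≤ (ENNReal.ofReal E * (pw k q.1 + pw k q.2) +
        (pw (1 + k) q.1 + pw (1 + k) q.2)) * H q + sw k q.1 * H q := by gcongr
      _ ≤ (ENNReal.ofReal E * (pw k q.1 + pw k q.2) +
        (pw (1 + k) q.1 + pw (1 + k) q.2)) * H q + sw k q.1 * H q + pw k q.2 * H q := le_self_add
      _ = _ := by unfold sw; ring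
  calc _ ≤ 2⁻¹ * ((∫⁻ q, sw k q.2 * H q ∂nu2) +
        ((ENNReal.ofReal E + 1) * (2 * M) + (ENNReal.ofReal E * (2 * M) + 2 * (2 * M)))) := by
        gcongr 2⁻¹ * ?_
        refine ineq.trans ?_
        gcongr
    _ = 2⁻¹ * (∫⁻ q, sw k q.2 * H q ∂nu2) +
        (2⁻¹ * 2) * (ENNReal.ofReal E + ENNReal.ofReal E + 3) * M := by ring
    _ = _ := by rw [ENNReal.inv_mul_cancel (by simp) (by simp), one_mul]

theorem loss_bound (hk : k ∈ Ioo (0:ℝ) 1)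
    (hl₁ : k ≤ l₁) (hl₁₂ : l₁ ≤ l₂) (hl₂ : l₂ ≤ 1) {v d : ℝ → ℝ≥0∞}
    (hv : Measurable v) (hd : Measurable d) (hdv : ∀ x, d x ≤ v x) :
    ∫⁻ z, sw k z * (2⁻¹ * (d z * Al (PP l₁ l₂) v z)) ∂nu ≤
      2 * ((Mm k v + Mm (1 + k + l₂) v) * (Mm k v + Mm (1 + k) v)) := by
  have hP := PP_prop l₁ l₂
  have hs := sw_meas k
  have hk0 := hk.1
  have hpk := pw_meas k
  have hH := PP_meas hP hv hv
  calc ∫⁻ z, sw k z * (2⁻¹ * (d z * Al (PP l₁ l₂) v z)) ∂nu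
      ≤ 2⁻¹ * ∫⁻ z, sw k z * (v z * Al (PP l₁ l₂) v z) ∂nu := by
        rw [← lintegral_const_mul' _ _ (by simp)]
        apply lintegral_mono
        intro z
        dsimp only
        rw [mul_left_comm]
        gcongr
        exact hdv z
    _ = 2⁻¹ * ((∫⁻ q, pw k q.1 * (PP l₁ l₂ q.1 q.2 * (v q.1 * v q.2)) ∂nu2) +
        ∫⁻ q, pw (1 + k) q.1 * (PP l₁ l₂ q.1 q.2 * (v q.1 * v q.2)) ∂nu2) := by
        rw [loss_test hP hs hv hv, 
          ← lintegral_add_left (by exact (hpk.comp measurable_fst).mul hH)]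
        simp only [sw, add_mul]
    _ ≤ 2⁻¹ * (2 * ((Mm k v + Mm (1 + k + l₂) v) * (Mm k v + Mm (1 + k) v)) +
          2 * ((Mm k v + Mm (1 + k + l₂) v) * (Mm k v + Mm (1 + k) v))) := by
        gcongr
        · exact bil1 (c := 1 + k) (by linarith) hl₁₂ (by linarith) hl₁ (by linarith) hv hv
        · exact bil1 (c := 1 + k) (by linarith) hl₁₂ le_rfl hl₁ (by linarith) hv hv
    _ = (2⁻¹ * 2) * (2 * ((Mm k v + Mm (1 + k + l₂) v) * (Mm k v + Mm (1 + k) v))) := by ring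
    _ = _ := by rw [ENNReal.inv_mul_cancel (by simp) (by simp), one_mul]

theorem Al_fin (hl₁ : k ≤ l₁) (hl₁₂ : l₁ ≤ l₂) (hl₂ : l₂ ≤ 1) {v : ℝ → ℝ≥0∞}
    (hv : Measurable v) (h : Mm k v + Mm 1 v ≠ ⊤) {z : ℝ} (hz : 0 < z) :
    Al (PP l₁ l₂) v z ≠ ⊤ := by
  have h2 : Mm l₂ v ≠ ⊤ := ne_top_of_le_ne_top h (Mm_between (by linarith) hl₂ hv)
  have h1 : Mm l₁ v ≠ ⊤ := ne_top_of_le_ne_top h (Mm_between hl₁ (by linarith) hv)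
  have : Al (PP l₁ l₂) v z = pw l₁ z * Mm l₂ v + pw l₂ z * Mm l₁ v := by
    have := pw_meas l₁
    have := pw_meas l₂
    unfold Mm
    rw [← lintegral_const_mul' _ _ (pw_fin _ _), ← lintegral_const_mul' _ _ (pw_fin _ _),
      ← lintegral_add_left (by fun_prop)]
    apply setLIntegral_congr_fun measurableSet_Ioi
    intro y hy
    dsimp only
    rw [PP_eq l₁ l₂ hz hy]
    ring
  rw [this]
  exact ENNReal.add_ne_top.2 ⟨ENNReal.mul_ne_top (pw_fin _ _) h2,
    ENNReal.mul_ne_top (pw_fin _ _) h1⟩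

theorem sign_ineq {p q A1 A2 Ad G1 G2 Q : ℝ} (hp : 0 ≤ p) (hq : 0 ≤ q)
    (h1 : A1 ≤ A2 + Ad) (h2 : A2 ≤ A1 + Ad) (h3 : G1 ≤ G2 + Q) (h4 : G2 ≤ G1 + Q) :
    Real.sign (p - q) * ((G1 - G2) - (p * A1 - q * A2)) + 2⁻¹ * (|p - q| * (A1 + A2)) ≤
      Q + 2⁻¹ * ((p + q) * Ad) := by
  have hpq : 0 ≤ p + q := by linarith
  have m1 := mul_le_mul_of_nonneg_left h1 hpq
  have m2 := mul_le_mul_of_nonneg_left h2 hpq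
  rcases lt_trichotomy (p - q) 0 with h | h | h
  · rw [Real.sign_of_neg h, abs_of_neg h]; nlinarith
  · rw [h, Real.sign_zero, abs_zero]; nlinarith
  · rw [Real.sign_of_pos h, abs_of_pos h]; nlinarith

end
end

open MeasureTheory Set Filter
open scoped ENNReal

noncomputable section

theorem trunc_meas {L : ℝ → ℝ → ℝ≥0∞} (hL : Measurable fun q : ℝ × ℝ => L q.1 q.2) :
    Measurable fun q : ℝ × ℝ => ∫⁻ s in Ioo 0 q.1, L s q.2 := by
  have : (fun q : ℝ × ℝ => ∫⁻ s in Ioo 0 q.1, L s q.2) = fun q : ℝ × ℝ =>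
      ∫⁻ s, (if s ∈ Ioo 0 q.1 then L s q.2 else 0) := by
    ext q
    rw [← lintegral_indicator measurableSet_Ioo]
    congr 1
    ext s
    simp [indicator]
  rw [this]
  apply Measurable.lintegral_prod_right' (f := fun (w : (ℝ × ℝ) × ℝ) =>
    (if w.2 ∈ Ioo 0 w.1.1 then L w.2 w.1.2 else 0))
  refine Measurable.ite ?_ ?_ measurable_const
  · exact (measurableSet_lt measurable_const measurable_snd).inter
      (measurableSet_lt measurable_snd (measurable_fst.comp measurable_fst))
  · exact hL.comp (measurable_snd.prodMk (measurable_snd.comp measurable_fst))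

theorem conv_real {I : Set ℝ} {G L : ℝ → ℝ≥0∞} (hG : Measurable G) (hL : Measurable L)
    (hGi : ∫⁻ s in I, G s ≠ ⊤) (hLi : ∫⁻ s in I, L s ≠ ⊤) {U : ℝ≥0∞} (hU : U ≠ ⊤) {c : ℝ}
    (hc : 0 ≤ c) (h : U + ∫⁻ s in I, L s = ENNReal.ofReal c + ∫⁻ s in I, G s) :
    U.toReal = c + ∫ s in I, ((G s).toReal - (L s).toReal) := by
  rw [integral_sub (integrable_toReal_of_lintegral_ne_top hG.aemeasurable hGi)
    (integrable_toReal_of_lintegral_ne_top hL.aemeasurable hLi),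
    integral_toReal hG.aemeasurable (ae_lt_top hG hGi),
    integral_toReal hL.aemeasurable (ae_lt_top hL hLi)]
  have := congrArg ENNReal.toReal h
  rw [ENNReal.toReal_add hU hLi, ENNReal.toReal_add (by simp) hGi, ENNReal.toReal_ofReal hc] at this
  linarith

/-- Facts about a solution on a time interval. -/
structure SolF (k : ℝ) (bs : ℝ → ℝ → ℝ → ℝ) (l₁ l₂ : ℝ) (uin : ℝ → ℝ) (t0 : ℝ)
    (u : ℝ → ℝ → ℝ) : Prop where
  meas : Measurable fun q : ℝ × ℝ => UU u q.1 q.2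
  gnm : Measurable fun q : ℝ × ℝ => gn k bs l₁ l₂ u q.1 q.2
  lsm : Measurable fun q : ℝ × ℝ => ls l₁ l₂ u q.1 q.2
  eqn : ∀ t, 0 < t → t ≤ t0 → ∀ᵐ z ∂nu, UU u t z + ∫⁻ τ in Ioo 0 t, ls l₁ l₂ u τ z =
      ENNReal.ofReal (uin z) + ∫⁻ τ in Ioo 0 t, gn k bs l₁ l₂ u τ z
  gf : ∀ᵐ z ∂nu, ∫⁻ τ in Ioo 0 t0, gn k bs l₁ l₂ u τ z ≠ ⊤
  lf : ∀ᵐ z ∂nu, ∫⁻ τ in Ioo 0 t0, ls l₁ l₂ u τ z ≠ ⊤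
  bk : ∃ C : ℝ≥0∞, C ≠ ⊤ ∧ ∀ t, 0 < t → t ≤ t0 → Mm k (UU u t) + Mm 1 (UU u t) ≤ C
  bw : ∃ C : ℝ≥0∞, C ≠ ⊤ ∧ ∀ t, 0 < t → t ≤ t0 → Mm k (UU u t) + Mm (1 + k) (UU u t) ≤ C
  W : ∫⁻ τ in Ioo (0:ℝ) t0, (Mm k (UU u τ) + Mm (1 + k + l₂) (UU u τ)) ≠ ⊤

section
variable {k l₁ l₂ : ℝ} {bs : ℝ → ℝ → ℝ → ℝ} {uin : ℝ → ℝ} {T : ℝ≥0∞} {u u₁ u₂ : ℝ → ℝ → ℝ} {t0 : ℝ}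

theorem solF_of (hk : k ∈ Ioo (0:ℝ) 1) (hβ : FragKernel k bs) {E : ℝ}
    (hb : KerProp k E (be k bs)) (hl₁ : k ≤ l₁) (hl₁₂ : l₁ ≤ l₂) (hl₂ : l₂ ≤ 1)
    (hin : Measurable uin) (hnn : ∀ x, 0 ≤ uin x)
    (hX : MemXk k uin) (hX1 : MemXk (k + 1) uin)
    (h : IsWeakSolution k bs (Phi l₁ l₂) uin T u)
    (hm : ∀ t : ℝ, 0 < t → ENNReal.ofReal t < T →
      (∫⁻ τ in Ioo (0:ℝ) t, Mm (1 + k + l₂) (UU u τ)) < ⊤) (ht0 : 0 < t0)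
    (hT : ENNReal.ofReal t0 < T) : SolF k bs l₁ l₂ uin t0 u where
  meas := UU_meas h
  gnm := gn_meas hb h
  lsm := ls_meas h
  eqn := fun _ ht htt => sol_eq hk hβ hb hl₁ hl₁₂ hl₂ hin hnn hX h hm ht (lt_T hT htt)
  gf := ae_fin_of_pw (time_meas (gn_meas hb h) _) (gn_fin hb h ht0 hT)
  lf := ae_fin_of_pw (time_meas (ls_meas h) _) (ls_fin h ht0 hT)
  bk := bdd_k hk hβ hb hl₁ hl₁₂ hl₂ hin hnn hX h hm ht0 hT
  bw := bdd_w hk hβ hb hl₁ hl₁₂ hl₂ hin hnn hX hX1 h hm ht0 hT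
  W := by
    obtain ⟨C, hC, hCb⟩ := bdd_k hk hβ hb hl₁ hl₁₂ hl₂ hin hnn hX h hm ht0 hT
    exact int_W h hm ht0 hT hC hCb

theorem SolF.rep (S : SolF k bs l₁ l₂ uin t0 u) (hin : Measurable uin) (hnn : ∀ x, 0 ≤ uin x)
    {t : ℝ} (ht : 0 < t) (htt : t ≤ t0) :
    ∀ᵐ z ∂nu, IntegrableOn (fun s => (gn k bs l₁ l₂ u s z).toReal - (ls l₁ l₂ u s z).toReal)
        (Ioo 0 t) ∧
      (UU u t z).toReal = uin z + ∫ s in Ioo 0 t,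
        ((gn k bs l₁ l₂ u s z).toReal - (ls l₁ l₂ u s z).toReal) ∧
      ∀ᵐ τ ∂(volume.restrict (Ioo 0 t)), (UU u τ z).toReal = uin z + ∫ s in Ioo 0 τ,
        ((gn k bs l₁ l₂ u s z).toReal - (ls l₁ l₂ u s z).toReal) := by
  have h1 : ∀ᵐ τ ∂(volume.restrict (Ioo 0 t)), ∀ᵐ z ∂nu,
      UU u τ z + ∫⁻ s in Ioo 0 τ, ls l₁ l₂ u s z =
      ENNReal.ofReal (uin z) + ∫⁻ s in Ioo 0 τ, gn k bs l₁ l₂ u s z := by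
    filter_upwards [ae_restrict_mem measurableSet_Ioo] with τ hτ
    exact S.eqn τ hτ.1 (hτ.2.le.trans htt)
  have hmL := trunc_meas S.lsm
  have hmG := trunc_meas S.gnm
  have hms : MeasurableSet {p : ℝ × ℝ | UU u p.1 p.2 + ∫⁻ s in Ioo 0 p.1, ls l₁ l₂ u s p.2 =
      ENNReal.ofReal (uin p.2) + ∫⁻ s in Ioo 0 p.1, gn k bs l₁ l₂ u s p.2} :=
    measurableSet_eq_fun (S.meas.add hmL) (((hin.comp measurable_snd).ennreal_ofReal).add hmG)
  rw [Measure.ae_ae_comm hms] at h1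
  filter_upwards [h1, S.eqn t ht htt, S.gf, S.lf] with z e1 e2 f1 f2
  have hG : Measurable fun s => gn k bs l₁ l₂ u s z := slice_meas (L := gn k bs l₁ l₂ u) S.gnm z
  have hL : Measurable fun s => ls l₁ l₂ u s z := slice_meas (L := ls l₁ l₂ u) S.lsm z
  have mono : ∀ (F : ℝ → ℝ≥0∞) (τ : ℝ), τ ≤ t → ∫⁻ s in Ioo 0 t0, F s ≠ ⊤ →
      ∫⁻ s in Ioo 0 τ, F s ≠ ⊤ := fun F τ hτ hF =>
    ne_top_of_le_ne_top hF (lintegral_mono_set (Ioo_subset_Ioo_right (hτ.trans htt)))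
  refine ⟨?_, ?_, ?_⟩
  · exact (integrable_toReal_of_lintegral_ne_top hG.aemeasurable (mono _ t le_rfl f1)).sub
      (integrable_toReal_of_lintegral_ne_top hL.aemeasurable (mono _ t le_rfl f2))
  · exact conv_real hG hL (mono _ t le_rfl f1) (mono _ t le_rfl f2) (by simp [UU]) (hnn z) e2
  · filter_upwards [e1, ae_restrict_mem measurableSet_Ioo] with τ h3 hτ
    exact conv_real hG hL (mono _ τ hτ.2.le f1) (mono _ τ hτ.2.le f2) (by simp [UU]) (hnn z) h3

def vv (u₁ u₂ : ℝ → ℝ → ℝ) (τ x : ℝ) : ℝ≥0∞ := UU u₁ τ x + UU u₂ τ x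
def dd (u₁ u₂ : ℝ → ℝ → ℝ) (τ x : ℝ) : ℝ≥0∞ := dE (UU u₁ τ x) (UU u₂ τ x)

def lossT (l₁ l₂ : ℝ) (u₁ u₂ : ℝ → ℝ → ℝ) (τ z : ℝ) : ℝ≥0∞ :=
  2⁻¹ * (dd u₁ u₂ τ z * Al (PP l₁ l₂) (vv u₁ u₂ τ) z)
def gainT (k : ℝ) (bs : ℝ → ℝ → ℝ → ℝ) (l₁ l₂ : ℝ) (u₁ u₂ : ℝ → ℝ → ℝ) (τ z : ℝ) : ℝ≥0∞ :=
  Qg (be k bs) (PP l₁ l₂) (vv u₁ u₂ τ) (dd u₁ u₂ τ) z +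
    2⁻¹ * (vv u₁ u₂ τ z * Al (PP l₁ l₂) (dd u₁ u₂ τ) z)

theorem vv_meas (S₁ : SolF k bs l₁ l₂ uin t0 u₁) (S₂ : SolF k bs l₁ l₂ uin t0 u₂) :
    Measurable fun q : ℝ × ℝ => vv u₁ u₂ q.1 q.2 := S₁.meas.add S₂.meas

theorem dE_comp {α : Type} [MeasurableSpace α] {F G : α → ℝ≥0∞} (hF : Measurable F)
    (hG : Measurable G) : Measurable fun a => dE (F a) (G a) := by
  unfold dE
  fun_prop

theorem dd_meas (S₁ : SolF k bs l₁ l₂ uin t0 u₁) (S₂ : SolF k bs l₁ l₂ uin t0 u₂) :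
    Measurable fun q : ℝ × ℝ => dd u₁ u₂ q.1 q.2 := by
  exact dE_comp (F := fun q : ℝ × ℝ => UU u₁ q.1 q.2) (G := fun q : ℝ × ℝ => UU u₂ q.1 q.2)
    S₁.meas S₂.meas

theorem slice2 {L : ℝ → ℝ → ℝ≥0∞} (hL : Measurable fun q : ℝ × ℝ => L q.1 q.2) (τ : ℝ) :
    Measurable (L τ) :=
  hL.comp ((measurable_const (a := τ)).prodMk measurable_id)

theorem lossT_meas (S₁ : SolF k bs l₁ l₂ uin t0 u₁) (S₂ : SolF k bs l₁ l₂ uin t0 u₂) :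
    Measurable fun q : ℝ × ℝ => lossT l₁ l₂ u₁ u₂ q.1 q.2 :=
  ((dd_meas S₁ S₂).mul (Al_meas (PP_prop l₁ l₂) (vv_meas S₁ S₂))).const_mul _

theorem gainT_meas {E : ℝ} (hb : KerProp k E (be k bs))
    (S₁ : SolF k bs l₁ l₂ uin t0 u₁) (S₂ : SolF k bs l₁ l₂ uin t0 u₂) :
    Measurable fun q : ℝ × ℝ => gainT k bs l₁ l₂ u₁ u₂ q.1 q.2 :=
  (Qg_meas hb (PP_prop l₁ l₂) (vv_meas S₁ S₂) (dd_meas S₁ S₂)).add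
    (((vv_meas S₁ S₂).mul (Al_meas (PP_prop l₁ l₂) (dd_meas S₁ S₂))).const_mul _)

theorem dd_le_vv (τ x : ℝ) : dd u₁ u₂ τ x ≤ vv u₁ u₂ τ x :=
  dE_le_add (by simp [UU]) (by simp [UU])

theorem vv_w (S₁ : SolF k bs l₁ l₂ uin t0 u₁) (S₂ : SolF k bs l₁ l₂ uin t0 u₂) :
    ∃ C : ℝ≥0∞, C ≠ ⊤ ∧ ∀ t, 0 < t → t ≤ t0 →
      Mm k (vv u₁ u₂ t) + Mm (1 + k) (vv u₁ u₂ t) ≤ C := by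
  obtain ⟨C₁, h1, h1'⟩ := S₁.bw
  obtain ⟨C₂, h2, h2'⟩ := S₂.bw
  refine ⟨C₁ + C₂, by simp [h1, h2], fun t ht htt => ?_⟩
  unfold vv
  rw [Mm_add _ (slice2 S₁.meas t), Mm_add _ (slice2 S₁.meas t), add_add_add_comm]
  exact add_le_add (h1' t ht htt) (h2' t ht htt)

theorem vv_k (S₁ : SolF k bs l₁ l₂ uin t0 u₁) (S₂ : SolF k bs l₁ l₂ uin t0 u₂) 
    {t : ℝ} (ht : 0 < t) (htt : t ≤ t0) :
      Mm k (vv u₁ u₂ t) + Mm 1 (vv u₁ u₂ t) ≠ ⊤ := by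
  obtain ⟨C₁, h1, h1'⟩ := S₁.bk
  obtain ⟨C₂, h2, h2'⟩ := S₂.bk
  refine ne_top_of_le_ne_top (b := C₁ + C₂) (by simp [h1, h2]) ?_
  unfold vv
  rw [Mm_add _ (slice2 S₁.meas t), Mm_add _ (slice2 S₁.meas t), add_add_add_comm]
  exact add_le_add (h1' t ht htt) (h2' t ht htt)

theorem vv_W (S₁ : SolF k bs l₁ l₂ uin t0 u₁) (S₂ : SolF k bs l₁ l₂ uin t0 u₂) :
    ∫⁻ τ in Ioo (0:ℝ) t0, (Mm k (vv u₁ u₂ τ) + Mm (1 + k + l₂) (vv u₁ u₂ τ)) ≠ ⊤ := by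
  have e : ∀ τ, Mm k (vv u₁ u₂ τ) + Mm (1 + k + l₂) (vv u₁ u₂ τ) =
      (Mm k (UU u₁ τ) + Mm (1 + k + l₂) (UU u₁ τ)) +
      (Mm k (UU u₂ τ) + Mm (1 + k + l₂) (UU u₂ τ)) := by
    intro τ
    unfold vv
    rw [Mm_add _ (slice2 S₁.meas τ), Mm_add _ (slice2 S₁.meas τ), add_add_add_comm]
  simp only [e]
  rw [lintegral_add_left (by exact (Mm_meas S₁.meas _).add (Mm_meas S₁.meas _))]
  exact ENNReal.add_ne_top.2 ⟨S₁.W, S₂.W⟩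

/-- the Gronwall rate -/
def rate (k E l₂ : ℝ) (u₁ u₂ : ℝ → ℝ → ℝ) (τ : ℝ) : ℝ≥0∞ :=
  (ENNReal.ofReal E + ENNReal.ofReal E + 3) *
    (Mm k (vv u₁ u₂ τ) + Mm (1 + k + l₂) (vv u₁ u₂ τ))
def RR (k : ℝ) (u₁ u₂ : ℝ → ℝ → ℝ) (τ : ℝ) : ℝ≥0∞ :=
  Mm k (dd u₁ u₂ τ) + Mm (1 + k) (dd u₁ u₂ τ)

theorem rate_int (E : ℝ) (S₁ : SolF k bs l₁ l₂ uin t0 u₁) (S₂ : SolF k bs l₁ l₂ uin t0 u₂) :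
    ∫⁻ τ in Ioo (0:ℝ) t0, rate k E l₂ u₁ u₂ τ ≠ ⊤ := by
  unfold rate
  rw [lintegral_const_mul' _ _ (by simp)]
  exact ENNReal.mul_ne_top (by simp) (vv_W S₁ S₂)

theorem RR_bdd (S₁ : SolF k bs l₁ l₂ uin t0 u₁) (S₂ : SolF k bs l₁ l₂ uin t0 u₂) :
    ∃ C : ℝ≥0∞, C ≠ ⊤ ∧ ∀ t, 0 < t → t ≤ t0 → RR k u₁ u₂ t ≤ C := by
  obtain ⟨C, hC, h⟩ := vv_w S₁ S₂
  refine ⟨C, hC, fun t ht htt => le_trans ?_ (h t ht htt)⟩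
  exact add_le_add (Mm_mono _ (dd_le_vv t)) (Mm_mono _ (dd_le_vv t))

theorem gain_le {E : ℝ} (hk : k ∈ Ioo (0:ℝ) 1)
    (hb : KerProp k E (be k bs)) (hl₁ : k ≤ l₁) (hl₁₂ : l₁ ≤ l₂) (hl₂ : l₂ ≤ 1)
    (S₁ : SolF k bs l₁ l₂ uin t0 u₁) (S₂ : SolF k bs l₁ l₂ uin t0 u₂) (t : ℝ) :
    ∫⁻ z, sw k z * (∫⁻ τ in Ioo 0 t, gainT k bs l₁ l₂ u₁ u₂ τ z) ∂nu ≤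
      (∫⁻ z, sw k z * (∫⁻ τ in Ioo 0 t, lossT l₁ l₂ u₁ u₂ τ z) ∂nu) +
        ∫⁻ τ in Ioo 0 t, rate k E l₂ u₁ u₂ τ * RR k u₁ u₂ τ := by
  rw [time_test (sw_meas k) (gainT_meas hb S₁ S₂), time_test (sw_meas k) (lossT_meas S₁ S₂),
    ← lintegral_add_left]
  · apply lintegral_mono
    intro τ
    refine (weight_ineq hb hk hl₁ hl₁₂ hl₂ (slice2 (vv_meas S₁ S₂) τ)
      (slice2 (dd_meas S₁ S₂) τ)).trans (le_of_eq ?_)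
    simp only [rate, RR, lossT]
    ring
  · exact Measurable.lintegral_prod_right'
      (f := fun w : ℝ × ℝ => sw k w.2 * lossT l₁ l₂ u₁ u₂ w.1 w.2)
      (((sw_meas k).comp measurable_snd).mul (lossT_meas S₁ S₂))

theorem loss_fin (hk : k ∈ Ioo (0:ℝ) 1)
    (hl₁ : k ≤ l₁) (hl₁₂ : l₁ ≤ l₂) (hl₂ : l₂ ≤ 1)
    (S₁ : SolF k bs l₁ l₂ uin t0 u₁) (S₂ : SolF k bs l₁ l₂ uin t0 u₂) :
    ∫⁻ z, sw k z * (∫⁻ τ in Ioo 0 t0, lossT l₁ l₂ u₁ u₂ τ z) ∂nu ≠ ⊤ := by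
  rw [time_test (sw_meas k) (lossT_meas S₁ S₂)]
  obtain ⟨C, hC, h⟩ := vv_w S₁ S₂
  have h3 : ∫⁻ τ in Ioo 0 t0, ∫⁻ z, sw k z * lossT l₁ l₂ u₁ u₂ τ z ∂nu ≤
      ∫⁻ τ in Ioo 0 t0, (2 * C) * (Mm k (vv u₁ u₂ τ) + Mm (1 + k + l₂) (vv u₁ u₂ τ)) := by
    apply setLIntegral_mono' measurableSet_Ioo
    intro τ hτ
    refine (loss_bound hk hl₁ hl₁₂ hl₂ (slice2 (vv_meas S₁ S₂) τ)
      (slice2 (dd_meas S₁ S₂) τ) (dd_le_vv τ)).trans ?_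
    have := h τ hτ.1 hτ.2.le
    calc _ ≤ 2 * ((Mm k (vv u₁ u₂ τ) + Mm (1 + k + l₂) (vv u₁ u₂ τ)) * C) := by gcongr
      _ = _ := by ring
  refine ne_top_of_le_ne_top ?_ h3
  rw [lintegral_const_mul' _ _ (ENNReal.mul_ne_top (by simp) hC)]
  exact ENNReal.mul_ne_top (ENNReal.mul_ne_top (by simp) hC) (vv_W S₁ S₂)

theorem ae_fin_of_sw {f : ℝ → ℝ≥0∞} (hf : Measurable f)
    (h : ∫⁻ z, sw k z * f z ∂nu ≠ ⊤) : ∀ᵐ z ∂nu, f z ≠ ⊤ := by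
  refine ae_fin_of_pw (a := k) hf (ne_top_of_le_ne_top h ?_)
  gcongr
  exact le_self_add

theorem rateRR_fin (E : ℝ) (S₁ : SolF k bs l₁ l₂ uin t0 u₁) (S₂ : SolF k bs l₁ l₂ uin t0 u₂) :
    ∫⁻ τ in Ioo 0 t0, rate k E l₂ u₁ u₂ τ * RR k u₁ u₂ τ ≠ ⊤ := by
  obtain ⟨C, hC, h⟩ := RR_bdd S₁ S₂
  have : ∫⁻ τ in Ioo 0 t0, rate k E l₂ u₁ u₂ τ * RR k u₁ u₂ τ ≤
      ∫⁻ τ in Ioo 0 t0, rate k E l₂ u₁ u₂ τ * C := by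
    apply setLIntegral_mono' measurableSet_Ioo
    intro τ hτ
    gcongr
    exact h τ hτ.1 hτ.2.le
  refine ne_top_of_le_ne_top ?_ this
  rw [lintegral_mul_const' _ _ hC]
  exact ENNReal.mul_ne_top (rate_int E S₁ S₂) hC

theorem pt_ineq {E : ℝ} (hb : KerProp k E (be k bs)) (hl₁ : k ≤ l₁) (hl₁₂ : l₁ ≤ l₂) (hl₂ : l₂ ≤ 1)
    (S₁ : SolF k bs l₁ l₂ uin t0 u₁) (S₂ : SolF k bs l₁ l₂ uin t0 u₂) {s z : ℝ} (hs : 0 < s)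
    (hst : s ≤ t0) (hz : 0 < z) (hg₁ : gn k bs l₁ l₂ u₁ s z ≠ ⊤) (hg₂ : gn k bs l₁ l₂ u₂ s z ≠ ⊤)
    (hG : gainT k bs l₁ l₂ u₁ u₂ s z ≠ ⊤) :
    Real.sign ((UU u₁ s z).toReal - (UU u₂ s z).toReal) *
      (((gn k bs l₁ l₂ u₁ s z).toReal - (ls l₁ l₂ u₁ s z).toReal) -
       ((gn k bs l₁ l₂ u₂ s z).toReal - (ls l₁ l₂ u₂ s z).toReal)) +
      (lossT l₁ l₂ u₁ u₂ s z).toReal ≤ (gainT k bs l₁ l₂ u₁ u₂ s z).toReal := by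
  have hP := PP_prop l₁ l₂
  have m1 := slice2 S₁.meas s
  have m2 := slice2 S₂.meas s
  have hv := vv_k S₁ S₂ hs hst
  have hd : Mm k (dd u₁ u₂ s) + Mm 1 (dd u₁ u₂ s) ≠ ⊤ := ne_top_of_le_ne_top hv
    (add_le_add (Mm_mono _ (dd_le_vv s)) (Mm_mono _ (dd_le_vv s)))
  have hAv := Al_fin hl₁ hl₁₂ hl₂ (slice2 (vv_meas S₁ S₂) s) hv hz
  have hAd := Al_fin hl₁ hl₁₂ hl₂ (slice2 (dd_meas S₁ S₂) s) hd hz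
  have hf1 : ∀ x, UU u₁ s x ≠ ⊤ := fun x => by simp [UU]
  have hf2 : ∀ x, UU u₂ s x ≠ ⊤ := fun x => by simp [UU]
  have eAv : Al (PP l₁ l₂) (vv u₁ u₂ s) z = Al (PP l₁ l₂) (UU u₁ s) z + Al (PP l₁ l₂) (UU u₂ s) z := by
    have hPz : Measurable fun y => PP l₁ l₂ z y :=
      hP.meas.comp ((measurable_const (a := z)).prodMk measurable_id)
    unfold Al vv
    rw [← lintegral_add_left (by exact hPz.mul m1)]
    simp only [mul_add]
  have hA12 := hAv
  rw [eAv, ENNReal.add_ne_top] at hA12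
  obtain ⟨hA1, hA2⟩ := hA12
  have hQ : Qg (be k bs) (PP l₁ l₂) (vv u₁ u₂ s) (dd u₁ u₂ s) z ≠ ⊤ :=
    (ENNReal.add_ne_top.1 hG).1
  have i1 := Al_diff hP m2 hf1 hf2 z
  have i2 := Al_diff hP m1 hf2 hf1 z
  have i3 := Q_diff hb hP m1 m2 hf1 hf2 z
  have i4 := Q_diff hb hP m2 m1 hf2 hf1 z
  have c1 : (fun x => dE (UU u₂ s x) (UU u₁ s x)) = dd u₁ u₂ s := by
    ext x; exact dE_symm _ _
  have c2 : (fun x => UU u₂ s x + UU u₁ s x) = vv u₁ u₂ s := by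
    ext x; exact add_comm _ _
  rw [c1] at i2
  rw [c1, c2] at i4
  change _ ≤ _ + Al (PP l₁ l₂) (dd u₁ u₂ s) z at i1
  change gn k bs l₁ l₂ u₁ s z ≤ gn k bs l₁ l₂ u₂ s z +
    Qg (be k bs) (PP l₁ l₂) (vv u₁ u₂ s) (dd u₁ u₂ s) z at i3
  change gn k bs l₁ l₂ u₂ s z ≤ gn k bs l₁ l₂ u₁ s z +
    Qg (be k bs) (PP l₁ l₂) (vv u₁ u₂ s) (dd u₁ u₂ s) z at i4
  have tr : ∀ {x y w : ℝ≥0∞}, y ≠ ⊤ → w ≠ ⊤ → x ≤ y + w → x.toReal ≤ y.toReal + w.toReal := by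
    intro x y w hy hw h
    rw [← ENNReal.toReal_add hy hw]
    exact ENNReal.toReal_mono (ENNReal.add_ne_top.2 ⟨hy, hw⟩) h
  have := sign_ineq (p := (UU u₁ s z).toReal) (q := (UU u₂ s z).toReal)
    ENNReal.toReal_nonneg ENNReal.toReal_nonneg
    (tr hA2 hAd i1) (tr hA1 hAd i2) (tr hg₂ hQ i3) (tr hg₁ hQ i4)
  have eL : (lossT l₁ l₂ u₁ u₂ s z).toReal = 2⁻¹ * (|(UU u₁ s z).toReal - (UU u₂ s z).toReal| *
      ((Al (PP l₁ l₂) (UU u₁ s) z).toReal + (Al (PP l₁ l₂) (UU u₂ s) z).toReal)) := by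
    unfold lossT
    rw [eAv, ENNReal.toReal_mul, ENNReal.toReal_mul, ENNReal.toReal_add hA1 hA2]
    unfold dd dE
    rw [ENNReal.toReal_ofReal (abs_nonneg _)]
    simp
  have eG : (gainT k bs l₁ l₂ u₁ u₂ s z).toReal =
      (Qg (be k bs) (PP l₁ l₂) (vv u₁ u₂ s) (dd u₁ u₂ s) z).toReal +
      2⁻¹ * (((UU u₁ s z).toReal + (UU u₂ s z).toReal) *
        (Al (PP l₁ l₂) (dd u₁ u₂ s) z).toReal) := by
    have := (ENNReal.add_ne_top.1 hG).2
    unfold gainT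
    rw [ENNReal.toReal_add hQ this, ENNReal.toReal_mul, ENNReal.toReal_mul]
    unfold vv
    rw [ENNReal.toReal_add (hf1 z) (hf2 z)]
    simp
  rw [eL, eG]
  refine le_trans (le_of_eq ?_) this
  simp only [ls, ENNReal.toReal_mul]
  ring

end
end

open MeasureTheory Set Filter
open scoped ENNReal

noncomputable section
section
variable {k l₁ l₂ : ℝ} {bs : ℝ → ℝ → ℝ → ℝ} {uin : ℝ → ℝ} {T : ℝ≥0∞} {u u₁ u₂ : ℝ → ℝ → ℝ} {t0 : ℝ}

theorem z_ineq {E : ℝ} (hk : k ∈ Ioo (0:ℝ) 1)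
    (hb : KerProp k E (be k bs)) (hl₁ : k ≤ l₁) (hl₁₂ : l₁ ≤ l₂) (hl₂ : l₂ ≤ 1)
    (hin : Measurable uin) (hnn : ∀ x, 0 ≤ uin x)
    (S₁ : SolF k bs l₁ l₂ uin t0 u₁) (S₂ : SolF k bs l₁ l₂ uin t0 u₂) {t : ℝ} (ht : 0 < t)
    (htt : t ≤ t0) :
    ∀ᵐ z ∂nu, dd u₁ u₂ t z + ∫⁻ τ in Ioo 0 t, lossT l₁ l₂ u₁ u₂ τ z ≤
      ∫⁻ τ in Ioo 0 t, gainT k bs l₁ l₂ u₁ u₂ τ z := by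
  have hgm := gainT_meas hb S₁ S₂
  have hlm := lossT_meas S₁ S₂
  have lf := loss_fin hk hl₁ hl₁₂ hl₂ S₁ S₂
  have gf : ∫⁻ z, sw k z * (∫⁻ τ in Ioo 0 t0, gainT k bs l₁ l₂ u₁ u₂ τ z) ∂nu ≠ ⊤ :=
    ne_top_of_le_ne_top (ENNReal.add_ne_top.2 ⟨lf, rateRR_fin E S₁ S₂⟩)
      (gain_le hk hb hl₁ hl₁₂ hl₂ S₁ S₂ t0)
  have lf' := ae_fin_of_sw (time_meas hlm _) lf
  have gf' := ae_fin_of_sw (time_meas hgm _) gf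
  filter_upwards [lf', gf', S₁.rep hin hnn ht htt, S₂.rep hin hnn ht htt, S₁.gf, S₂.gf,
    ae_restrict_mem measurableSet_Ioi] with z a1 a2 r1 r2 g1 g2 hz
  have mono : ∀ (F : ℝ → ℝ≥0∞), ∫⁻ s in Ioo 0 t0, F s ≠ ⊤ →
      ∫⁻ s in Ioo 0 t, F s ≠ ⊤ := fun F hF =>
    ne_top_of_le_ne_top hF (lintegral_mono_set (Ioo_subset_Ioo_right htt))
  have mG := slice_meas (L := gainT k bs l₁ l₂ u₁ u₂) hgm z
  have mL := slice_meas (L := lossT l₁ l₂ u₁ u₂) hlm z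
  have mU1 := slice_meas (L := UU u₁) S₁.meas z
  have mU2 := slice_meas (L := UU u₂) S₂.meas z
  have mg1 := slice_meas (L := gn k bs l₁ l₂ u₁) S₁.gnm z
  have mg2 := slice_meas (L := gn k bs l₁ l₂ u₂) S₂.gnm z
  have sub : ∀ τ, τ ≤ t → 
      ∫ s in Ioo 0 τ, (((gn k bs l₁ l₂ u₁ s z).toReal - (ls l₁ l₂ u₁ s z).toReal) -
       ((gn k bs l₁ l₂ u₂ s z).toReal - (ls l₁ l₂ u₂ s z).toReal)) =
      (∫ s in Ioo 0 τ, ((gn k bs l₁ l₂ u₁ s z).toReal - (ls l₁ l₂ u₁ s z).toReal)) -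
      ∫ s in Ioo 0 τ, ((gn k bs l₁ l₂ u₂ s z).toReal - (ls l₁ l₂ u₂ s z).toReal) := by
    intro τ hτ
    exact integral_sub (r1.1.mono_set (Ioo_subset_Ioo_right hτ))
      (r2.1.mono_set (Ioo_subset_Ioo_right hτ))
  refine ode_abs' (f := fun τ => (UU u₁ τ z).toReal - (UU u₂ τ z).toReal)
    (g := fun s => ((gn k bs l₁ l₂ u₁ s z).toReal - (ls l₁ l₂ u₁ s z).toReal) -
       ((gn k bs l₁ l₂ u₂ s z).toReal - (ls l₁ l₂ u₂ s z).toReal)) ht (r1.1.sub r2.1) ?_ ?_ ?_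
       mL.aemeasurable mG.aemeasurable (mono _ a1) (mono _ a2) ?_
  · exact mU1.ennreal_toReal.sub mU2.ennreal_toReal
  · rw [sub t le_rfl, r1.2.1, r2.2.1]; ring
  · filter_upwards [r1.2.2, r2.2.2, ae_restrict_mem measurableSet_Ioo] with τ e1 e2 hτ
    rw [sub τ hτ.2.le, e1, e2]; ring
  · filter_upwards [ae_lt_top mG (mono _ a2), ae_lt_top mg1 (mono _ g1), ae_lt_top mg2 (mono _ g2),
      ae_restrict_mem measurableSet_Ioo] with s f1 f2 f3 hs
    exact pt_ineq hb hl₁ hl₁₂ hl₂ S₁ S₂ hs.1 (hs.2.le.trans htt) hz f2.ne f3.ne f1.ne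

theorem RR_ineq {E : ℝ} (hk : k ∈ Ioo (0:ℝ) 1)
    (hb : KerProp k E (be k bs)) (hl₁ : k ≤ l₁) (hl₁₂ : l₁ ≤ l₂) (hl₂ : l₂ ≤ 1)
    (hin : Measurable uin) (hnn : ∀ x, 0 ≤ uin x)
    (S₁ : SolF k bs l₁ l₂ uin t0 u₁) (S₂ : SolF k bs l₁ l₂ uin t0 u₂) {t : ℝ} (ht : 0 < t)
    (htt : t ≤ t0) :
    RR k u₁ u₂ t ≤ ∫⁻ τ in Ioo 0 t, rate k E l₂ u₁ u₂ τ * RR k u₁ u₂ τ := by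
  have hlm := lossT_meas S₁ S₂
  have md := slice2 (dd_meas S₁ S₂) t
  have ms := sw_meas k
  have hpk := pw_meas k
  have lf : ∫⁻ z, sw k z * (∫⁻ τ in Ioo 0 t, lossT l₁ l₂ u₁ u₂ τ z) ∂nu ≠ ⊤ := by
    refine ne_top_of_le_ne_top (loss_fin hk hl₁ hl₁₂ hl₂ S₁ S₂) ?_
    gcongr
  have e : RR k u₁ u₂ t = ∫⁻ z, sw k z * dd u₁ u₂ t z ∂nu := by
    unfold RR Mm sw
    rw [← lintegral_add_left (by exact hpk.mul md)]
    simp only [add_mul]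
  have key : RR k u₁ u₂ t + ∫⁻ z, sw k z * (∫⁻ τ in Ioo 0 t, lossT l₁ l₂ u₁ u₂ τ z) ∂nu ≤
      (∫⁻ τ in Ioo 0 t, rate k E l₂ u₁ u₂ τ * RR k u₁ u₂ τ) +
      ∫⁻ z, sw k z * (∫⁻ τ in Ioo 0 t, lossT l₁ l₂ u₁ u₂ τ z) ∂nu := by
    rw [e, ← lintegral_add_left (by exact ms.mul md), add_comm (∫⁻ τ in Ioo 0 t, _)]
    refine le_trans ?_ (gain_le hk hb hl₁ hl₁₂ hl₂ S₁ S₂ t)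
    apply lintegral_mono_ae
    filter_upwards [z_ineq hk hb hl₁ hl₁₂ hl₂ hin hnn S₁ S₂ ht htt] with z hz
    rw [← mul_add]
    gcongr
  exact (ENNReal.add_le_add_iff_right lf).1 key

theorem main_eq {E : ℝ} (hk : k ∈ Ioo (0:ℝ) 1)
    (hb : KerProp k E (be k bs)) (hl₁ : k ≤ l₁) (hl₁₂ : l₁ ≤ l₂) (hl₂ : l₂ ≤ 1)
    (hin : Measurable uin) (hnn : ∀ x, 0 ≤ uin x) (ht0 : 0 < t0)
    (S₁ : SolF k bs l₁ l₂ uin t0 u₁) (S₂ : SolF k bs l₁ l₂ uin t0 u₂) :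
    ∀ᵐ z ∂nu, (UU u₁ t0 z).toReal = (UU u₂ t0 z).toReal := by
  obtain ⟨C, hC, hR⟩ := RR_bdd S₁ S₂
  have h0 : RR k u₁ u₂ t0 = 0 := gronwall_zero ht0 hC (rate_int E S₁ S₂) hR
    fun t ht htt => RR_ineq hk hb hl₁ hl₁₂ hl₂ hin hnn S₁ S₂ ht htt
  have h1 : Mm k (dd u₁ u₂ t0) = 0 := (add_eq_zero.1 h0).1
  filter_upwards [Mm_zero (slice2 (dd_meas S₁ S₂) t0) h1] with z hz
  unfold dd dE at hz
  rw [ENNReal.ofReal_eq_zero] at hz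
  have := abs_nonpos_iff.1 hz
  linarith

end

theorem uniqueness'
    (k₀ l₁ l₂ : ℝ) (hk₀ : k₀ ∈ Ioo (0:ℝ) 1)
    (bs : ℝ → ℝ → ℝ → ℝ) (hβ : FragKernel k₀ bs)
    (hl₁ : k₀ ≤ l₁) (hl₁₂ : l₁ ≤ l₂) (hl₂ : l₂ ≤ 1)
    (uin : ℝ → ℝ) (hmeas : Measurable uin) (hnn : ∀ x : ℝ, 0 ≤ uin x)
    (hXk₀ : MemXk k₀ uin) (hXk₁ : MemXk (k₀ + 1) uin)
    (T : ℝ≥0∞)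
    (u₁ u₂ : ℝ → ℝ → ℝ)
    (h₁ : IsWeakSolution k₀ bs (Phi l₁ l₂) uin T u₁)
    (h₂ : IsWeakSolution k₀ bs (Phi l₁ l₂) uin T u₂)
    (hm₁ : ∀ t : ℝ, 0 < t → ENNReal.ofReal t < T →
      (∫⁻ τ in Ioo (0:ℝ) t, ∫⁻ x in Ioi (0:ℝ),
        ENNReal.ofReal (x ^ (1 + k₀ + l₂) * u₁ τ x)) < ⊤)
    (hm₂ : ∀ t : ℝ, 0 < t → ENNReal.ofReal t < T →
      (∫⁻ τ in Ioo (0:ℝ) t, ∫⁻ x in Ioi (0:ℝ),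
        ENNReal.ofReal (x ^ (1 + k₀ + l₂) * u₂ τ x)) < ⊤) :
    ∀ t : ℝ, 0 ≤ t → ENNReal.ofReal t < T →
      ∀ᵐ x ∂(volume.restrict (Ioi (0:ℝ))), u₁ t x = u₂ t x := by
  intro t ht hT
  rcases ht.eq_or_lt with rfl | ht'
  · filter_upwards [ae_restrict_mem measurableSet_Ioi] with x hx
    rw [h₁.init x hx, h₂.init x hx]
  obtain ⟨E, -, hb⟩ := kerProp_be hk₀.1 hβ
  have cv : ∀ u : ℝ → ℝ → ℝ, (∀ t : ℝ, 0 < t → ENNReal.ofReal t < T →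
      (∫⁻ τ in Ioo (0:ℝ) t, ∫⁻ x in Ioi (0:ℝ),
        ENNReal.ofReal (x ^ (1 + k₀ + l₂) * u τ x)) < ⊤) →
      ∀ t : ℝ, 0 < t → ENNReal.ofReal t < T →
      (∫⁻ τ in Ioo (0:ℝ) t, Mm (1 + k₀ + l₂) (UU u τ)) < ⊤ := by
    intro u hu s hs hsT
    have := hu s hs hsT
    simp only [pw_lint] at this
    exact this
  have S₁ := solF_of hk₀ hβ hb hl₁ hl₁₂ hl₂ hmeas hnn hXk₀ hXk₁ h₁ (cv u₁ hm₁) ht' hT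
  have S₂ := solF_of hk₀ hβ hb hl₁ hl₁₂ hl₂ hmeas hnn hXk₀ hXk₁ h₂ (cv u₂ hm₂) ht' hT
  filter_upwards [main_eq hk₀ hb hl₁ hl₁₂ hl₂ hmeas hnn ht' S₁ S₂,
    ae_restrict_mem measurableSet_Ioi] with z hz hz0
  simp only [UU] at hz
  rwa [ENNReal.toReal_ofReal (h₁.nonneg t ht hT z hz0),
    ENNReal.toReal_ofReal (h₂.nonneg t ht hT z hz0)] at hz

end

noncomputable section

/-- Uniqueness of weak solutions with finite `L¹(0,t)` moment of order
`1 + k₀ + λ₂`. -/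
theorem uniqueness
    (k₀ l₁ l₂ : ℝ) (hk₀ : k₀ ∈ Ioo (0:ℝ) 1)
    (bs : ℝ → ℝ → ℝ → ℝ) (hβ : FragKernel k₀ bs)
    (hl₁ : k₀ ≤ l₁) (hl₁₂ : l₁ ≤ l₂) (hl₂ : l₂ ≤ 1)
    (uin : ℝ → ℝ) (hmeas : Measurable uin) (hnn : ∀ x : ℝ, 0 ≤ uin x)
    (hXk₀ : MemXk k₀ uin) (hXk₁ : MemXk (k₀ + 1) uin)
    (T : ℝ≥0∞) (hT : 0 < T)
    (u₁ u₂ : ℝ → ℝ → ℝ)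
    (h₁ : IsWeakSolution k₀ bs (Phi l₁ l₂) uin T u₁)
    (h₂ : IsWeakSolution k₀ bs (Phi l₁ l₂) uin T u₂)
    (hm₁ : ∀ t : ℝ, 0 < t → ENNReal.ofReal t < T →
      (∫⁻ τ in Ioo (0:ℝ) t, ∫⁻ x in Ioi (0:ℝ),
        ENNReal.ofReal (x ^ (1 + k₀ + l₂) * u₁ τ x)) < ⊤)
    (hm₂ : ∀ t : ℝ, 0 < t → ENNReal.ofReal t < T →
      (∫⁻ τ in Ioo (0:ℝ) t, ∫⁻ x in Ioi (0:ℝ),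
        ENNReal.ofReal (x ^ (1 + k₀ + l₂) * u₂ τ x)) < ⊤) :
    ∀ t : ℝ, 0 ≤ t → ENNReal.ofReal t < T →
      ∀ᵐ x ∂(volume.restrict (Ioi (0:ℝ))), u₁ t x = u₂ t x := by
  exact uniqueness' k₀ l₁ l₂ hk₀ bs hβ hl₁ hl₁₂ hl₂ uin hmeas hnn hXk₀ hXk₁ T u₁ u₂ h₁ h₂ hm₁ hm₂

end
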